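/- arXiv:2007.14696 — 4 statements merged into one kernel-verified Lean document; each statement's English description precedes it below -/
import Mathlib

section
/- Let F be a field, V an F-vector space with dim V ≥ 3, and κ : V → F a non-singular quadratic form possessing a nonzero isotropic vector (i.e., κ(u) = 0 for some u ≠ 0). Let f : V → V be a bijection such that for all x, y ∈ V one has κ(x − y) = 0 if and only if κ(f(x) − f(y)) = 0. Then there exist a vector v ∈ V and a semisimilarity φ of κ — that is, an α-semilinear bijection φ of V for some field automorphism α of F, together with a scalar λ ∈ F^×, satisfying κ(φ(x)) = λ·α(κ(x)) for all x ∈ V — such that f(x) = φ(x) + v for all x ∈ V. -/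
open QuadraticMap

namespace Lester

theorem hua {F : Type*} [Field F] (α g : F → F)
    (ha : ∀ x y, α (x + y) = α x + α y) (hg : ∀ x y, g (x + y) = g x + g y)
    (hα1 : α 1 = 1)
    (h : ∀ c, c ≠ 0 → α c * g c⁻¹ = 1) :
    (∀ x, g x = α x) ∧ ∀ x y, α (x * y) = α x * α y := by
  have a0 : α 0 = 0 := by simpa using ha 0 0
  have g0 : g 0 = 0 := by simpa using hg 0 0
  have asub : ∀ x y, α (x - y) = α x - α y := fun x y => by
    have := ha (x - y) y
    rw [sub_add_cancel] at this
    rw [this]; ring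
  have an : ∀ c, c ≠ 0 → α c ≠ 0 := fun c hc h0 => by
    have := h c hc; rw [h0] at this; simp at this
  have key : ∀ a b, α (a ^ 2 * b) = α a ^ 2 * g b := by
    intro a b
    by_cases hA : a = 0
    · subst hA; simp [a0]
    by_cases hb : b = 0
    · subst hb; simp [a0, g0]
    by_cases hab : b⁻¹ - a = 0
    · have hab' : b = a⁻¹ := by rw [sub_eq_zero] at hab; rw [← hab, inv_inv]
      subst hab'
      have e : a ^ 2 * a⁻¹ = a := by field_simp
      rw [e, pow_two, mul_assoc, h a hA, mul_one]
    have h1 := h a hA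
    have h2 := h (b⁻¹ - a) hab
    have h3 := h b⁻¹ (inv_ne_zero hb)
    rw [inv_inv] at h3
    have hx : a⁻¹ + (b⁻¹ - a)⁻¹ = (a - a ^ 2 * b)⁻¹ := by
      have : 1 - b * a ≠ 0 := by
        intro h0; apply hab; field_simp; rw [h0, mul_zero]
      have h5 : a - a ^ 2 * b ≠ 0 := by
        have : a - a ^ 2 * b = a * (1 - b * a) := by ring
        rw [this]; positivity
      have e1 : b⁻¹ - a = b⁻¹ * (1 - b * a) := by field_simp
      have e2 : a - a ^ 2 * b = a * (1 - b * a) := by ring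
      rw [e1, e2, mul_inv, mul_inv, inv_inv]
      generalize ht : 1 - b * a = t at *
      field_simp
      linear_combination -ht
    have h5 : a - a ^ 2 * b ≠ 0 := by
      intro h0
      have : a - a ^ 2 * b = a * b * (b⁻¹ - a) := by field_simp
      rw [this] at h0
      simp_all
    have h4 := h _ h5
    rw [← hx, hg, asub] at h4
    have hAn := an a hA
    have hBn := an _ hab
    rw [asub] at h2 hBn
    generalize g a⁻¹ = p at *
    generalize g (b⁻¹ - a)⁻¹ = q at *
    generalize α b⁻¹ = r at *
    generalize α (a ^ 2 * b) = s at *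
    generalize α a = A at *
    generalize g b = G at *
    have hr : r ≠ 0 := by rintro rfl; simp at h3
    -- (A - s)(p+q)=1, A p = 1, (r-A) q = 1, r G = 1
    have : (A - s) * r = A * (r - A) := by
      linear_combination (A * (r - A)) * h4 - (A - s) * (r - A) * h1 - (A - s) * A * h2
    have e : s * r = (A ^ 2 * G) * r := by linear_combination -this - A ^ 2 * h3
    exact mul_right_cancel₀ hr e
  have hag : ∀ x, g x = α x := fun x => by
    have := key 1 x
    simpa [hα1] using this.symm
  refine ⟨hag, fun x y => ?_⟩
  have k2 : ∀ a b, α (a ^ 2 * b) = α a ^ 2 * α b := fun a b => by rw [key, hag]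
  have sq : ∀ a, α (a ^ 2) = α a ^ 2 := fun a => by simpa [hα1] using k2 a 1
  by_cases h2 : (2 : F) = 0
  · have e : α (x * y) ^ 2 = (α x * α y) ^ 2 := by
      rw [← sq, mul_pow, k2, sq, mul_pow]
    have : (α (x * y) - α x * α y) ^ 2 = 0 := by
      linear_combination e + (α x * α y) * ((α x * α y) - α (x * y)) * h2
    exact sub_eq_zero.1 (by simpa using this)
  · have e := k2 (x + 1) y
    have e2 : (x + 1) ^ 2 * y = x ^ 2 * y + (x * y + x * y) + y := by ring
    rw [e2, ha, ha, ha, ha, k2, hα1] at e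
    exact mul_left_cancel₀ h2 (by linear_combination e)

variable {F V : Type*} [Field F] [AddCommGroup V] [Module F V]

def NS (κ : QuadraticForm F V) : Prop :=
  ∀ x : V, (∀ y : V, polar (⇑κ) x y = 0) → κ x = 0 → x = 0

theorem kadd (κ : QuadraticForm F V) (x y : V) : κ (x + y) = κ x + κ y + polar κ x y := by
  rw [polar]; ring

theorem ksub (κ : QuadraticForm F V) (x y : V) : κ (x - y) = κ x + κ y - polar κ x y := by
  rw [sub_eq_add_neg, kadd, QuadraticMap.map_neg, polar_neg_right]; ring

theorem kself (κ : QuadraticForm F V) (x : V) (h : κ x = 0) : polar κ x x = 0 := by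
  rw [polar_self, h, smul_zero]

/-- null partner inside the orthogonal complement of a hyperbolic pair -/
theorem lemH (κ : QuadraticForm F V) (hns : NS κ) {u a p : V}
    (hu : κ u = 0) (ha : κ a = 0) (hua : polar κ u a ≠ 0)
    (hpu : polar κ p u = 0) (hpa : polar κ p a = 0) (hp : κ p = 0) (hp0 : p ≠ 0) (r : F) :
    ∃ w, κ w = 0 ∧ polar κ w u = 0 ∧ polar κ w a = 0 ∧ polar κ w p = r := by
  obtain ⟨w0, hw0⟩ : ∃ w0, polar κ p w0 ≠ 0 := by
    by_contra! h
    exact hp0 (hns p h hp)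
  rw [polar_comm] at hw0
  have huu := kself κ u hu
  have haa := kself κ a ha
  have hpp := kself κ p hp
  have hau := polar_comm κ a u
  have hup : polar κ u p = 0 := by rw [polar_comm, hpu]
  have hap : polar κ a p = 0 := by rw [polar_comm, hpa]
  set b := polar κ u a with hb
  set s := polar κ w0 p
  obtain ⟨w1, hw1⟩ : ∃ w1, w1 = w0 - (polar κ w0 a / b) • u - (polar κ w0 u / b) • a := ⟨_, rfl⟩
  have e1 : polar κ w1 u = 0 := by
    rw [hw1]
    simp only [polar_sub_left, polar_smul_left, smul_eq_mul, huu, hau]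
    field_simp; ring
  have e2 : polar κ w1 a = 0 := by
    rw [hw1]
    simp only [polar_sub_left, polar_smul_left, smul_eq_mul, haa, ← hb]
    field_simp; ring
  have e3 : polar κ w1 p = s := by
    rw [hw1]
    simp only [polar_sub_left, polar_smul_left, smul_eq_mul, hup, hap]
    simp [s]
  -- first null with product s, then scale
  refine ⟨(r / s) • (w1 - (κ w1 / s) • p), ?_, ?_, ?_, ?_⟩
  · rw [QuadraticMap.map_smul, ksub, QuadraticMap.map_smul, polar_smul_right, hp, e3]
    simp only [smul_eq_mul]; field_simp; ring
  · simp [polar_smul_left, polar_sub_left, e1, hpu]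
  · simp [polar_smul_left, polar_sub_left, e2, hpa]
  · simp only [polar_smul_left, polar_sub_left, e3, hpp, smul_eq_mul]; field_simp; ring

theorem partner (κ : QuadraticForm F V) (hns : NS κ) {u : V} (hu : κ u = 0) (hu0 : u ≠ 0) :
    ∃ v, κ v = 0 ∧ polar κ u v = 1 := by
  obtain ⟨w0, hw0⟩ : ∃ w0, polar κ u w0 ≠ 0 := by
    by_contra! h
    exact hu0 (hns u h hu)
  have huu := kself κ u hu
  set s := polar κ u w0 with hs
  have hs' : polar κ w0 u = s := by rw [polar_comm]
  refine ⟨s⁻¹ • (w0 - (κ w0 / s) • u), ?_, ?_⟩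
  · rw [QuadraticMap.map_smul, ksub, QuadraticMap.map_smul, polar_smul_right, hu, hs']
    simp only [smul_eq_mul]; field_simp; ring
  · simp only [polar_smul_right, polar_sub_right, huu, smul_eq_mul, ← hs]; field_simp; ring

theorem decomp (κ : QuadraticForm F V) {u v : V} (hu : κ u = 0) (hv : κ v = 0)
    (huv : polar κ u v = 1) (x : V) :
    ∃ w, polar κ w u = 0 ∧ polar κ w v = 0 ∧ x = polar κ x v • u + polar κ x u • v + w := by
  have huu := kself κ u hu
  have hvv := kself κ v hv
  have hvu : polar κ v u = 1 := by rw [polar_comm, huv]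
  refine ⟨x - polar κ x v • u - polar κ x u • v, ?_, ?_, by abel⟩
  · simp [polar_sub_left, polar_smul_left, huu, hvu]
  · simp [polar_sub_left, polar_smul_left, hvv, huv]

theorem kexp (κ : QuadraticForm F V) {u v : V} (hu : κ u = 0) (hv : κ v = 0)
    (c d : F) (w : V) :
    κ (c • u + d • v + w) = c * d * polar κ u v + c * polar κ w u + d * polar κ w v + κ w := by
  simp only [kadd, QuadraticMap.map_smul, polar_add_left, polar_smul_left,
    polar_smul_right, hu, hv, smul_eq_mul]
  rw [polar_comm κ u w, polar_comm κ v w]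
  ring

theorem line_char (κ : QuadraticForm F V) (hns : NS κ) {u w : V} (hu : κ u = 0) (hu0 : u ≠ 0) :
    (∀ z, κ z = 0 → κ (z - u) = 0 → κ (z - w) = 0) ↔ ∃ c : F, w = c • u := by
  constructor
  · intro h
    have hw : κ w = 0 := by
      have := h 0 (map_zero κ) (by simpa using hu)
      simpa using this
    have huw : polar κ w u = 0 := by
      have := h u hu (by simp)
      rw [ksub, hu, hw] at this
      rw [polar_comm]; simpa using this
    obtain ⟨v, hv, huv⟩ := partner κ hns hu hu0
    obtain ⟨w1, h1, h2, h3⟩ := decomp κ hu hv huv w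
    rw [huw] at h3
    have hw1 : κ w1 = 0 := by
      have := kexp κ hu hv (polar κ w v) 0 w1
      rw [← h3, hw, h1, h2] at this
      simpa using this.symm
    by_cases h0 : w1 = 0
    · exact ⟨_, by rw [h0] at h3; simpa using h3⟩
    obtain ⟨t, ht, htu, htv, htw⟩ := lemH κ hns hu hv (by rw [huv]; exact one_ne_zero) h1 h2 hw1 h0 1
    exfalso
    have := h t ht (by rw [ksub, ht, hu, htu]; simp)
    rw [ksub, ht, hw, h3] at this
    simp [polar_add_right, polar_smul_right, htu, htw] at this
  · rintro ⟨c, rfl⟩ z hz hzu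
    rw [ksub, hz, hu] at hzu
    rw [ksub, QuadraticMap.map_smul, polar_smul_right, hz, hu]
    have : polar κ z u = 0 := by simpa using hzu
    simp [this]

def Pres (κ : QuadraticForm F V) (f : V ≃ V) : Prop :=
  ∀ x y : V, κ (x - y) = 0 ↔ κ (f x - f y) = 0

theorem Pres.symm {κ : QuadraticForm F V} {f : V ≃ V} (h : Pres κ f) : Pres κ f.symm := by
  intro x y
  have := h (f.symm x) (f.symm y)
  simpa using this.symm

/-- null lines go into null lines -/
theorem line_map (κ : QuadraticForm F V) (hns : NS κ) (f : V ≃ V) (hf : Pres κ f)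
    (x : V) {u : V} (hu : κ u = 0) (hu0 : u ≠ 0) (c : F) :
    ∃ c' : F, f (x + c • u) - f x = c' • (f (x + u) - f x) := by
  have hu' : κ (f (x + u) - f x) = 0 := (hf _ _).1 (by simpa using hu)
  have hu0' : f (x + u) - f x ≠ 0 := by
    intro h; rw [sub_eq_zero] at h
    exact hu0 (by simpa using f.injective h)
  rw [← line_char κ hns hu' hu0']
  intro z hz hzu
  obtain ⟨y, hy⟩ : ∃ y, z = f (x + y) - f x :=
    ⟨f.symm (z + f x) - x, by simp⟩
  subst hy
  have k1 : κ y = 0 := by simpa using (hf _ _).2 hz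
  have k2 : κ (y - u) = 0 := by
    have : κ (f (x + y) - f (x + u)) = 0 := by simpa using hzu
    simpa using (hf _ _).2 this
  have k3 := (line_char κ hns (w := c • u) hu hu0).2 ⟨c, rfl⟩ y k1 k2
  have := (hf (x + y) (x + c • u)).1 (by simpa using k3)
  simpa using this

theorem line_map' (κ : QuadraticForm F V) (hns : NS κ) (f : V ≃ V) (hf : Pres κ f)
    (x : V) {u : V} (hu : κ u = 0) (hu0 : u ≠ 0) (c' : F) :
    ∃ c : F, f (x + c • u) - f x = c' • (f (x + u) - f x) := by
  have hu' : κ (f (x + u) - f x) = 0 := (hf _ _).1 (by simpa using hu)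
  have hu0' : f (x + u) - f x ≠ 0 := by
    intro h; rw [sub_eq_zero] at h
    exact hu0 (by simpa using f.injective h)
  obtain ⟨c, hc⟩ := line_map κ hns f.symm hf.symm (f x) hu' hu0' c'
  simp only [add_sub_cancel, Equiv.symm_apply_apply, add_sub_cancel_left] at hc
  refine ⟨c, ?_⟩
  rw [← hc]; simp

/-- hyperbolic parallelograms are preserved -/
theorem para (κ : QuadraticForm F V) (hns : NS κ) (f : V ≃ V) (hf : Pres κ f)
    (x : V) {u z : V} (hu : κ u = 0) (hz : κ z = 0) (huz : polar κ u z ≠ 0) :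
    f (x + z + u) - f (x + z) = f (x + u) - f x := by
  have hu0 : u ≠ 0 := by rintro rfl; simp at huz
  have hT : ∀ p q, κ (p - q) = 0 ↔ κ ((f (x + p) - f x) - (f (x + q) - f x)) = 0 := by
    intro p q
    have := hf (x + p) (x + q)
    simpa using this
  obtain ⟨T, hTd⟩ : ∃ T : V → V, T = fun p => f (x + p) - f x := ⟨_, rfl⟩
  have hT2 : ∀ p q, κ (p - q) = 0 ↔ κ (T p - T q) = 0 := by rw [hTd]; exact hT
  have T0 : T 0 = 0 := by rw [hTd]; simp
  have hT1 : ∀ p, κ p = 0 ↔ κ (T p) = 0 := fun p => by simpa [T0] using hT2 p 0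
  have Tsurj : ∀ y, ∃ p, T p = y := fun y => ⟨f.symm (y + f x) - x, by rw [hTd]; simp⟩
  have line' : ∀ c' : F, ∃ c : F, T (c • u) = c' • T u := fun c' => by
    rw [hTd]; exact line_map' κ hns f hf x hu hu0 c'
  have lineM : ∀ c : F, ∃ c' : F, T (z + c • u) = T z + c' • (T (z + u) - T z) := fun c => by
    obtain ⟨c', hc⟩ := line_map κ hns f hf (x + z) hu hu0 c
    refine ⟨c', ?_⟩
    rw [hTd]
    simp only [← add_assoc]
    rw [sub_sub_sub_cancel_right, ← hc]; abel
  suffices h : T (z + u) = T z + T u by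
    have h' : f (x + (z + u)) - f x = f (x + z) - f x + (f (x + u) - f x) := by
      rw [hTd] at h; exact h
    rw [← add_assoc] at h'
    rw [sub_eq_iff_eq_add] at h'
    rw [h']; abel
  have a1 : κ (T u) = 0 := (hT1 _).1 hu
  have a2 : κ (T z) = 0 := (hT1 _).1 hz
  have a3 : polar κ (T u) (T z) ≠ 0 := by
    intro h
    have : κ (T u - T z) = 0 := by rw [ksub, a1, a2, h]; simp
    have := (hT2 _ _).2 this
    rw [ksub, hu, hz] at this
    exact huz (by simpa using this)
  have a4 : κ (T (z + u)) ≠ 0 := by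
    intro h
    have := (hT1 _).2 h
    rw [kadd, hu, hz, polar_comm] at this
    exact huz (by simpa using this)
  have a5 : κ (T (z + u) - T z) = 0 := (hT2 _ _).1 (by simpa using hu)
  have a6 : κ (T (z + u) - T u) = 0 := (hT2 _ _).1 (by simpa using hz)
  -- every point c' • T u has a neighbour on the other line
  have a7 : ∀ c' : F, ∃ d : F, κ (T z + d • (T (z + u) - T z) - c' • T u) = 0 := by
    intro c'
    obtain ⟨c, hc⟩ := line' c'
    obtain ⟨d, hd⟩ := lineM c
    refine ⟨d, ?_⟩
    rw [← hc, ← hd, ← hT2]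
    simpa using hz
  -- no common neighbour
  have a8 : ∀ w, κ w = 0 → κ (w - T u) = 0 → κ (w - T z) = 0 → κ (w - T (z + u)) ≠ 0 := by
    intro w h0 h1 h2 h3
    obtain ⟨p, rfl⟩ := Tsurj w
    rw [← hT1] at h0
    rw [← hT2] at h1 h2 h3
    rw [ksub] at h1 h2 h3
    rw [h0, hu] at h1
    rw [h0, hz] at h2
    rw [h0, kadd, hu, hz, polar_add_right, polar_comm κ z u] at h3
    apply huz
    linear_combination h3 - h1 - h2
  generalize T (z + u) = q at *
  generalize T u = u' at *
  generalize T z = a at *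
  clear hT1 hT2 hT line' lineM Tsurj
  rw [ksub, a2] at a5
  rw [ksub, a1] at a6
  -- polar q a = κ q , polar q u' = κ q
  have b1 : polar κ q a = κ q := by linear_combination -a5
  have b2 : polar κ q u' = κ q := by linear_combination -a6
  have b3 : polar κ a u' = polar κ u' a := polar_comm _ _ _
  have b4 : polar κ a q = κ q := by rw [polar_comm, b1]
  have haa := kself κ a a2
  have b5 : κ q = polar κ u' a := by
    by_contra hne
    have hne' : κ q - polar κ u' a ≠ 0 := sub_ne_zero.2 hne
    obtain ⟨d, hd⟩ := a7 (κ q / (κ q - polar κ u' a))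
    simp only [ksub, kadd, QuadraticMap.map_smul, polar_add_left, polar_smul_left,
      polar_smul_right, polar_sub_left, polar_sub_right, smul_eq_mul, a1, a2, b1, b2, b3, b4, haa] at hd
    field_simp at hd
    have : κ q * polar κ u' a * (κ q - polar κ u' a) = 0 := by
      linear_combination -hd
    exact mul_ne_zero (mul_ne_zero a4 a3) hne' this
  by_contra hcon
  have hp0 : q - a - u' ≠ 0 := by
    intro h; apply hcon
    rw [sub_sub, sub_eq_zero] at h; exact h
  have huu := kself κ u' a1
  obtain ⟨w, w1, w2, w3, w4⟩ := lemH κ hns (p := q - a - u') a1 a2 a3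
    (by simp only [polar_sub_left, huu, b2, b3, b5]; ring)
    (by simp only [polar_sub_left, haa, b1, b5]; ring)
    (by simp only [ksub, polar_sub_left, b1, b2, b3, b5, a1, a2]; ring) hp0 (polar κ u' a)
  refine a8 w w1 (by rw [ksub, w1, w2, a1]; ring) (by rw [ksub, w1, w3, a2]; ring) ?_
  rw [polar_sub_right, polar_sub_right, w2, w3] at w4
  rw [ksub, w1, b5]
  linear_combination -w4

theorem exists_aniso (hdim : 3 ≤ Module.rank F V) (κ : QuadraticForm F V) (hns : NS κ) {u v : V}
    (hu : κ u = 0) (hv : κ v = 0) (huv : polar κ u v = 1) :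
    ∃ w, polar κ w u = 0 ∧ polar κ w v = 0 ∧ κ w ≠ 0 := by
  by_contra! h
  have hW : ∀ w, polar κ w u = 0 → polar κ w v = 0 → w = 0 := by
    intro w h1 h2
    refine hns w (fun y => ?_) (h w h1 h2)
    obtain ⟨w', h1', h2', h3'⟩ := decomp κ hu hv huv y
    rw [h3', polar_add_right, polar_add_right, polar_smul_right, polar_smul_right, h1, h2]
    have := h (w + w') (by rw [polar_add_left, h1, h1', add_zero])
      (by rw [polar_add_left, h2, h2', add_zero])
    rw [kadd, h w h1 h2, h w' h1' h2'] at this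
    simpa using this
  classical
  have htop : Submodule.span F (({u, v} : Finset V) : Set V) = ⊤ := by
    rw [eq_top_iff]
    intro x _
    obtain ⟨w, h1, h2, h3⟩ := decomp κ hu hv huv x
    rw [hW w h1 h2, add_zero] at h3
    rw [h3]
    refine Submodule.add_mem _ (Submodule.smul_mem _ _ (Submodule.subset_span ?_))
      (Submodule.smul_mem _ _ (Submodule.subset_span ?_)) <;> simp
  have h1 := rank_span_finset_le (R := F) ({u, v} : Finset V)
  rw [htop, rank_top] at h1
  have h2 : (({u, v} : Finset V).card : Cardinal) ≤ 2 := by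
    exact_mod_cast Finset.card_le_two
  have h3 := (hdim.trans h1).trans h2
  have : (3 : ℕ) ≤ 2 := by exact_mod_cast h3
  omega

/-- every vector is a combination of `u`, `v` and a null vector not orthogonal to `u` -/
theorem three (κ : QuadraticForm F V) {u v : V}
    (hu : κ u = 0) (hv : κ v = 0) (huv : polar κ u v = 1) (x : V) :
    ∃ (a b : F) (z : V), κ z = 0 ∧ polar κ u z = 1 ∧ x = a • u + b • v + z := by
  obtain ⟨w, h1, h2, h3⟩ := decomp κ hu hv huv x
  refine ⟨polar κ x v + κ w, polar κ x u - 1, (-κ w) • u + (1 : F) • v + w, ?_, ?_, ?_⟩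
  · rw [kexp κ hu hv, h1, h2, huv]; ring
  · rw [polar_comm] at h1
    simp [polar_add_right, polar_smul_right, kself κ u hu, h1, huv]
  · nth_rw 1 [h3]
    module

theorem step_null (hdim : 3 ≤ Module.rank F V) (κ : QuadraticForm F V) (hns : NS κ)
    (f : V ≃ V) (hf : Pres κ f) {u : V} (hu : κ u = 0) (hu0 : u ≠ 0) (x : V) :
    f (x + u) - f x = f u - f 0 := by
  obtain ⟨v, hv, huv⟩ := partner κ hns hu hu0
  obtain ⟨w, hwu, hwv, hw⟩ := exists_aniso hdim κ hns hu hv huv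
  obtain ⟨P, hP⟩ : ∃ P : AddSubgroup V, ∀ p, p ∈ P ↔
      ∀ x, f (x + p + u) - f (x + p) = f (x + u) - f x := by
    refine ⟨{ carrier := {p | ∀ x, f (x + p + u) - f (x + p) = f (x + u) - f x},
              add_mem' := ?_, zero_mem' := ?_, neg_mem' := ?_ }, fun p => Iff.rfl⟩
    · intro p q hp hq x
      have h1 := hp x
      have h2 := hq (x + p)
      rw [← add_assoc, h2, h1]
    · intro x; simp
    · intro p hp x
      have h1 := hp (x + -p)
      rw [neg_add_cancel_right] at h1
      exact h1.symm
  have hN : ∀ z, κ z = 0 → polar κ u z ≠ 0 → z ∈ P := fun z hz huz =>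
    (hP z).2 fun x => para κ hns f hf x hu hz huz
  have hv' : ∀ c : F, c • v ∈ P := by
    intro c
    by_cases hc : c = 0
    · simp [hc]
    · exact hN _ (by simp [QuadraticMap.map_smul, hv]) (by simp [polar_smul_right, huv, hc])
  have hw' : ∀ c d : F, c • (d • w - (d ^ 2 * κ w) • u) ∈ P := by
    intro c d
    by_cases hc : c = 0
    · simp [hc]
    have hz : c • ((-(d ^ 2 * κ w)) • u + (1 : F) • v + d • w) ∈ P := by
      apply hN
      · rw [QuadraticMap.map_smul, kexp κ hu hv, polar_smul_left, polar_smul_left, hwu, hwv,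
          QuadraticMap.map_smul, huv]
        simp only [smul_eq_mul]; ring
      · have : polar κ u w = 0 := by rw [polar_comm, hwu]
        simp [polar_smul_right, polar_add_right, kself κ u hu, huv, this, hc]
    have := P.sub_mem hz (hv' c)
    convert this using 1
    module
  have hu' : ∀ c : F, c • u ∈ P := by
    by_cases h : ∃ d : F, d ≠ 0 ∧ d ≠ 1
    · obtain ⟨d, hd0, hd1⟩ := h
      intro c
      have hd1' : d - 1 ≠ 0 := sub_ne_zero.2 hd1
      have e1 := hw' (c / (d * (d - 1) * κ w)) d
      have e2 := hw' (c / (d * (d - 1) * κ w) * d) 1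
      have := P.sub_mem e2 e1
      convert this using 1
      have : c = (c / (d * (d - 1) * κ w)) * (d * (d - 1) * κ w) := by field_simp
      nth_rw 1 [this]
      module
    · push Not at h
      have h2 : (2 : F) = 0 := by
        by_contra h0
        have := h 2 h0
        have : (1 : F) = 0 := by linear_combination this
        exact one_ne_zero this
      have huu : u + u = 0 := by rw [← two_smul F, h2, zero_smul]
      have hneg : ∀ y : V, -y = y := fun y => by
        rw [neg_eq_iff_add_eq_zero, ← two_smul F, h2, zero_smul]
      intro c
      by_cases hc : c = 0
      · simp [hc]
      rw [h c hc, one_smul, hP]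
      intro x
      rw [add_assoc x, huu, add_zero, ← hneg (f (x + u) - f x), neg_sub]
  obtain ⟨a, b, z, hz, huz, hx⟩ := three κ hu hv huv x
  have hxP : x ∈ P := by
    rw [hx]
    exact P.add_mem (P.add_mem (hu' a) (hv' b)) (hN z hz (by rw [huz]; exact one_ne_zero))
  have := (hP x).1 hxP 0
  simpa using this

theorem additive (hdim : 3 ≤ Module.rank F V) (κ : QuadraticForm F V) (hns : NS κ)
    (hiso : ∃ u : V, u ≠ 0 ∧ κ u = 0)
    (f : V ≃ V) (hf : Pres κ f) (f0 : f 0 = 0) (x y : V) : f (x + y) = f x + f y := by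
  have hn : ∀ z, κ z = 0 → ∀ x, f (x + z) = f x + f z := by
    intro z hz x
    by_cases h0 : z = 0
    · simp [h0, f0]
    have := step_null hdim κ hns f hf hz h0 x
    rw [f0, sub_zero, sub_eq_iff_eq_add] at this
    rw [this, add_comm]
  obtain ⟨u, hu0, hu⟩ := hiso
  obtain ⟨v, hv, huv⟩ := partner κ hns hu hu0
  obtain ⟨a, b, z, hz, -, rfl⟩ := three κ hu hv huv y
  have hu' : κ (a • u) = 0 := by simp [QuadraticMap.map_smul, hu]
  have hv' : κ (b • v) = 0 := by simp [QuadraticMap.map_smul, hv]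
  rw [← add_assoc, ← add_assoc, hn z hz, hn _ hv', hn _ hu', hn z hz, hn _ hv']
  abel

/-- behaviour on the orthogonal complement of a hyperbolic pair -/
theorem perp (κ : QuadraticForm F V) (f : V ≃ V)
    (hadd : ∀ x y, f (x + y) = f x + f y) (hnull : ∀ x, κ x = 0 ↔ κ (f x) = 0)
    {u v : V} (hu : κ u = 0) (hv : κ v = 0) (huv : polar κ u v = 1) (α γ : F → F)
    (hα : ∀ c, f (c • u) = α c • f u) (hγ : ∀ c, f (c • v) = γ c • f v)
    (α0 : α 0 = 0) (γ0 : γ 0 = 0) (α1 : α 1 = 1) (γ1 : γ 1 = 1)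
    (αs : Function.Surjective α) (γs : Function.Surjective γ)
    {w : V} (hwu : polar κ w u = 0) (hwv : polar κ w v = 0) :
    polar κ (f w) (f u) = 0 ∧ polar κ (f w) (f v) = 0 ∧
    ∀ c d, c * d + κ w = 0 → α c * γ d * polar κ (f u) (f v) + κ (f w) = 0 := by
  have hu' := (hnull u).1 hu
  have hv' := (hnull v).1 hv
  have key : ∀ c d, c * d + κ w = 0 ↔ α c * γ d * polar κ (f u) (f v) + α c * polar κ (f w) (f u)
      + γ d * polar κ (f w) (f v) + κ (f w) = 0 := by
    intro c d
    have := hnull (c • u + d • v + w)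
    rw [hadd, hadd, hα, hγ, kexp κ hu hv, kexp κ hu' hv', huv, hwu, hwv] at this
    simpa using this
  have k1 : polar κ (f w) (f v) = 0 := by
    by_contra h
    obtain ⟨d, hd⟩ := γs (-κ (f w) / polar κ (f w) (f v))
    have h1 := (key 0 d).2 (by rw [α0, hd]; field_simp; ring)
    have hw : κ w = 0 := by simpa using h1
    have h2 := (key 0 0).1 (by rw [hw]; ring)
    have h3 := (key 0 1).1 (by rw [hw]; ring)
    rw [α0, γ0] at h2
    rw [α0, γ1] at h3
    exact h (by linear_combination h3 - h2)
  have k2 : polar κ (f w) (f u) = 0 := by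
    by_contra h
    obtain ⟨d, hd⟩ := αs (-κ (f w) / polar κ (f w) (f u))
    have h1 := (key d 0).2 (by rw [γ0, hd]; field_simp; ring)
    have hw : κ w = 0 := by simpa using h1
    have h2 := (key 0 0).1 (by rw [hw]; ring)
    have h3 := (key 1 0).1 (by rw [hw]; ring)
    rw [α0, γ0] at h2
    rw [α1, γ0] at h3
    exact h (by linear_combination h3 - h2)
  refine ⟨k2, k1, fun c d h => ?_⟩
  have := (key c d).1 h
  rw [k1, k2] at this
  linear_combination this

theorem coord (κ : QuadraticForm F V) (hns : NS κ) (f : V ≃ V) (hf : Pres κ f)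
    (hadd : ∀ x y, f (x + y) = f x + f y) (f0 : f 0 = 0) {u : V} (hu : κ u = 0) (hu0 : u ≠ 0) :
    ∃ α : F → F, (∀ c, f (c • u) = α c • f u) ∧ (∀ x y, α (x + y) = α x + α y) ∧ α 0 = 0 ∧
      α 1 = 1 ∧ Function.Bijective α := by
  have h1 : ∀ c : F, ∃ c' : F, f (c • u) = c' • f u := fun c => by
    simpa [f0] using line_map κ hns f hf 0 hu hu0 c
  have h2 : ∀ c' : F, ∃ c : F, f (c • u) = c' • f u := fun c => by
    simpa [f0] using line_map' κ hns f hf 0 hu hu0 c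
  have hfu : f u ≠ 0 := by
    intro h; rw [← f0] at h; exact hu0 (f.injective h)
  have canc : ∀ {a b : F}, a • f u = b • f u → a = b := fun {a b} h => smul_left_injective F hfu h
  choose α hα using h1
  refine ⟨α, hα, ?_, ?_, ?_, ?_, ?_⟩
  · intro x y; apply canc; rw [← hα, add_smul, add_smul, hadd, hα, hα]
  · apply canc; rw [← hα]; simp [f0]
  · apply canc; rw [← hα]; simp
  · intro x y h
    have : f (x • u) = f (y • u) := by rw [hα, hα, h]
    exact smul_left_injective F hu0 (f.injective this)
  · intro c
    obtain ⟨d, hd⟩ := h2 c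
    exact ⟨d, canc (by rw [← hα, hd])⟩

theorem mult (hdim : 3 ≤ Module.rank F V) (κ : QuadraticForm F V) (hns : NS κ)
    (f : V ≃ V)
    (hadd : ∀ x y, f (x + y) = f x + f y) (hnull : ∀ x, κ x = 0 ↔ κ (f x) = 0)
    {u v : V} (hu : κ u = 0) (hv : κ v = 0) (huv : polar κ u v = 1) (α γ : F → F)
    (hα : ∀ c, f (c • u) = α c • f u) (hγ : ∀ c, f (c • v) = γ c • f v)
    (αa : ∀ x y, α (x + y) = α x + α y) (γa : ∀ x y, γ (x + y) = γ x + γ y)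
    (α0 : α 0 = 0) (γ0 : γ 0 = 0) (α1 : α 1 = 1) (γ1 : γ 1 = 1)
    (αs : Function.Bijective α) (γs : Function.Bijective γ) :
    (∀ x y, α (x * y) = α x * α y) ∧ ∃ k, k ≠ 0 ∧ γ k ≠ 0 ∧ ∀ x, γ (k * x) = γ k * α x := by
  obtain ⟨w, hwu, hwv, hw⟩ := exists_aniso hdim κ hns hu hv huv
  obtain ⟨-, -, h⟩ := perp κ f hadd hnull hu hv huv α γ hα hγ α0 γ0 α1 γ1 αs.2 γs.2 hwu hwv
  have hk : -κ w ≠ 0 := neg_ne_zero.2 hw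
  have hγk : γ (-κ w) ≠ 0 := by
    intro h0; rw [← γ0] at h0; exact hk (γs.1 h0)
  have hb : polar κ (f u) (f v) ≠ 0 := by
    intro h0
    have := h 1 (-κ w) (by ring)
    rw [h0] at this
    exact hw ((hnull w).2 (by linear_combination this))
  have H := hua α (fun x => γ (-κ w * x) / γ (-κ w)) αa
    (fun x y => by rw [mul_add, γa, add_div]) α1 (by
      intro c hc
      have e1 := h 1 (-κ w) (by ring)
      have e2 := h c (-κ w * c⁻¹) (by field_simp; ring)
      rw [α1] at e1
      have : α c * γ (-κ w * c⁻¹) = γ (-κ w) :=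
        mul_right_cancel₀ hb (by linear_combination e2 - e1)
      rw [mul_div_assoc', this, div_self hγk])
  refine ⟨H.2, -κ w, hk, hγk, fun x => ?_⟩
  rw [← H.1 x]
  field_simp

theorem same (hdim : 3 ≤ Module.rank F V) (κ : QuadraticForm F V) (hns : NS κ)
    (f : V ≃ V)
    (hadd : ∀ x y, f (x + y) = f x + f y) (hnull : ∀ x, κ x = 0 ↔ κ (f x) = 0)
    {u v : V} (hu : κ u = 0) (hv : κ v = 0) (huv : polar κ u v = 1) (α γ : F → F)
    (hα : ∀ c, f (c • u) = α c • f u) (hγ : ∀ c, f (c • v) = γ c • f v)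
    (αa : ∀ x y, α (x + y) = α x + α y) (γa : ∀ x y, γ (x + y) = γ x + γ y)
    (α0 : α 0 = 0) (γ0 : γ 0 = 0) (α1 : α 1 = 1) (γ1 : γ 1 = 1)
    (αs : Function.Bijective α) (γs : Function.Bijective γ) :
    (∀ x y, α (x * y) = α x * α y) ∧ ∀ x, γ x = α x := by
  obtain ⟨h1, k, -, hk, h2⟩ := mult hdim κ hns f hadd hnull hu hv huv α γ hα hγ αa γa
    α0 γ0 α1 γ1 αs γs
  obtain ⟨h3, -⟩ := mult hdim κ hns f hadd hnull hv hu (by rw [polar_comm, huv]) γ α hγ hα γa αa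
    γ0 α0 γ1 α1 γs αs
  exact ⟨h1, fun x => mul_left_cancel₀ hk (by rw [← h3, h2])⟩

theorem main0 (hdim : 3 ≤ Module.rank F V) (κ : QuadraticForm F V) (hns : NS κ)
    (hiso : ∃ u : V, u ≠ 0 ∧ κ u = 0)
    (f : V ≃ V) (hf : Pres κ f) (f0 : f 0 = 0) :
    ∃ (α : F ≃+* F) (lam : Fˣ),
      (∀ x y : V, f (x + y) = f x + f y) ∧
      (∀ (c : F) (x : V), f (c • x) = α c • f x) ∧
      (∀ x : V, κ (f x) = (lam : F) * α (κ x)) := by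
  have hadd := additive hdim κ hns hiso f hf f0
  have hnull : ∀ x, κ x = 0 ↔ κ (f x) = 0 := fun x => by simpa [f0] using hf x 0
  obtain ⟨u, hu0, hu⟩ := hiso
  obtain ⟨v, hv, huv⟩ := partner κ hns hu hu0
  obtain ⟨α, hα, αa, α0, α1, αb⟩ := coord κ hns f hf hadd f0 hu hu0
  have hz : ∀ z, κ z = 0 → polar κ u z = 1 →
      (∀ x y, α (x * y) = α x * α y) ∧ ∀ c : F, f (c • z) = α c • f z := by
    intro z hz huz
    have hz0 : z ≠ 0 := by rintro rfl; simp at huz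
    obtain ⟨γ, hγ, γa, γ0, γ1, γb⟩ := coord κ hns f hf hadd f0 hz hz0
    have := same hdim κ hns f hadd hnull hu hz huz α γ hα hγ αa γa α0 γ0 α1 γ1 αb γb
    exact ⟨this.1, fun c => by rw [hγ, this.2]⟩
  obtain ⟨αm, hαv⟩ := hz v hv huv
  have hsm : ∀ (c : F) (x : V), f (c • x) = α c • f x := by
    intro c x
    obtain ⟨a, b, z, hz1, hz2, rfl⟩ := three κ hu hv huv x
    rw [smul_add, smul_add, hadd, hadd, hadd, hadd, smul_smul, smul_smul, hα, hα, hαv, hαv,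
      (hz z hz1 hz2).2, αm, αm]
    module
  have hb : polar κ (f u) (f v) ≠ 0 := by
    intro h0
    have := (hnull (u + v)).2 (by
      rw [hadd, kadd, (hnull u).1 hu, (hnull v).1 hv, h0]; simp)
    rw [kadd, hu, hv, huv] at this
    simp at this
  refine ⟨RingEquiv.ofBijective (⟨⟨⟨α, α1⟩, αm⟩, α0, αa⟩ : F →+* F) αb, Units.mk0 _ hb, hadd, hsm, ?_⟩
  intro x
  change κ (f x) = polar κ (f u) (f v) * α (κ x)
  obtain ⟨w, hwu, hwv, hx⟩ := decomp κ hu hv huv x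
  obtain ⟨p1, p2, p3⟩ := perp κ f hadd hnull hu hv huv α α hα hαv α0 α0 α1 α1 αb.2 αb.2 hwu hwv
  have e := p3 (-1) (κ w) (by ring)
  have e1 : α (-1) = -1 := by
    have := αa (-1) 1
    rw [neg_add_cancel, α0, α1] at this
    linear_combination -this
  rw [hx, kexp κ hu hv, hadd, hadd, hα, hαv, kexp κ ((hnull u).1 hu) ((hnull v).1 hv), p1, p2, hwu,
    hwv, huv]
  simp only [mul_zero, mul_one, add_zero]
  rw [αa, αm]
  rw [e1] at e
  linear_combination e

end Lester

theorem bijection_preserving_isotropy_is_affine_semisimilarity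
    {F V : Type*} [Field F] [AddCommGroup V] [Module F V]
    (hdim : 3 ≤ Module.rank F V) (κ : QuadraticForm F V)
    (hns : ∀ x : V, (∀ y : V, QuadraticMap.polar (⇑κ) x y = 0) → κ x = 0 → x = 0)
    (hiso : ∃ u : V, u ≠ 0 ∧ κ u = 0)
    (f : V ≃ V)
    (hf : ∀ x y : V, κ (x - y) = 0 ↔ κ (f x - f y) = 0) :
    ∃ (α : F ≃+* F) (φ : V ≃ V) (lam : Fˣ) (v : V),
      (∀ x y : V, φ (x + y) = φ x + φ y) ∧
      (∀ (c : F) (x : V), φ (c • x) = α c • φ x) ∧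
      (∀ x : V, κ (φ x) = (lam : F) * α (κ x)) ∧
      (∀ x : V, f x = φ x + v) := by
  have hφ : ∀ x, (f.trans (Equiv.subRight (f 0))) x = f x - f 0 := fun x => rfl
  obtain ⟨α, lam, h1, h2, h3⟩ := Lester.main0 hdim κ hns hiso (f.trans (Equiv.subRight (f 0)))
    (by intro x y; rw [hφ, hφ, sub_sub_sub_cancel_right]; exact hf x y) (by rw [hφ, sub_self])
  exact ⟨α, _, lam, f 0, h1, h2, h3, fun x => by rw [hφ, sub_add_cancel]⟩
end

section
/- Let q be a prime power, m ≥ 2, F = GF(q) and V = F^{2m}, and let κ : V → F be a non-degenerate quadratic form. Let Γ be the affine polar graph: the graph with vertex set V in which two distinct vectors u, v are adjacent if and only if κ(u − v) = 0. Then the automorphism group of Γ consists exactly of the maps x ↦ φ(x) + w, where w ∈ V and φ is a semisimilarity of κ; that is, Aut(Γ) = F^{2m} ⋊ ΓO(κ), the semidirect product of the translation group with the group of all semisimilarities of κ. -/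
open QuadraticMap in
theorem ap_kadd {F V : Type*} [Field F] [AddCommGroup V] [Module F V] (κ : QuadraticForm F V)
    (x v : V) (t : F) : κ (x + t • v) = κ x + t * t * κ v + t * polar κ x v := by
  rw [QuadraticMap.map_add κ, QuadraticMap.map_smul, polar_smul_right]; simp

open QuadraticMap in
theorem ap_ksub {F V : Type*} [Field F] [AddCommGroup V] [Module F V] (κ : QuadraticForm F V)
    (x v : V) : κ (x - v) = κ x + κ v - polar κ x v := by
  have := ap_kadd κ x v (-1)
  simp only [neg_smul, one_smul, ← sub_eq_add_neg] at this
  rw [this]; ring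

/-- functional fact -/
theorem ap_fun {F V : Type*} [Field F] [AddCommGroup V] [Module F V] (κ κ' : QuadraticForm F V)
    (v z : V) (h : ∀ x, QuadraticMap.polar κ v x = 0 → QuadraticMap.polar κ' z x = 0) :
    ∃ c : F, ∀ x, QuadraticMap.polar κ' z x = c * QuadraticMap.polar κ v x := by
  by_cases h0 : ∀ x, QuadraticMap.polar κ v x = 0
  · exact ⟨0, fun x => by rw [h x (h0 x)]; ring⟩
  push Not at h0
  obtain ⟨x0, hx0⟩ := h0
  refine ⟨QuadraticMap.polar κ' z x0 / QuadraticMap.polar κ v x0, fun x => ?_⟩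
  have := h (x + (-(QuadraticMap.polar κ v x / QuadraticMap.polar κ v x0)) • x0) (by
    rw [QuadraticMap.polar_add_right, QuadraticMap.polar_smul_right, smul_eq_mul]
    field_simp; ring)
  rw [QuadraticMap.polar_add_right, QuadraticMap.polar_smul_right, smul_eq_mul] at this
  field_simp at this ⊢
  linear_combination this

theorem ap_prop {F V : Type*} [Field F] [AddCommGroup V] [Module F V] (κ : QuadraticForm F V)
    (hnd : ∀ x : V, (∀ y, QuadraticMap.polar κ x y = 0) → x = 0)
    (v z : V) (h : ∀ x, QuadraticMap.polar κ v x = 0 → QuadraticMap.polar κ z x = 0) :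
    ∃ c : F, z = c • v := by
  obtain ⟨c, hc⟩ := ap_fun κ κ v z h
  refine ⟨c, ?_⟩
  rw [← sub_eq_zero]
  apply hnd
  intro y
  rw [QuadraticMap.polar_sub_left, QuadraticMap.polar_smul_left, hc, smul_eq_mul, sub_self]

/-- the double perp -/
def apL {F V : Type*} [Field F] [AddCommGroup V] [Module F V] (κ : QuadraticForm F V)
    (u w y : V) : Prop := ∀ x, κ (x - u) = 0 → κ (x - w) = 0 → κ (x - y) = 0

theorem apL_iff {F V : Type*} [Field F] [AddCommGroup V] [Module F V] (κ : QuadraticForm F V)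
    (hnd : ∀ x : V, (∀ y, QuadraticMap.polar κ x y = 0) → x = 0)
    (u v y : V) (hv : κ v = 0) :
    apL κ u (u + v) y ↔ ∃ t : F, y = u + t • v := by
  constructor
  · intro h
    have h' : ∀ x, κ x = 0 → QuadraticMap.polar κ v x = 0 → κ (x - (y - u)) = 0 := by
      intro x hx hxv
      have := h (x + u) (by simpa using hx) (by
        rw [add_comm u v, add_sub_add_right_eq_sub, ap_ksub, hx, hv, QuadraticMap.polar_comm, hxv]; simp)
      rwa [show x + u - y = x - (y - u) by abel] at this
    obtain ⟨z, rfl⟩ : ∃ z, y = u + z := ⟨y - u, by abel⟩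
    simp only [add_sub_cancel_left] at h'
    have hz : κ z = 0 := by
      have := h' 0 (by simp) (by simp)
      simpa using this
    have hzv : QuadraticMap.polar κ v z = 0 := by
      have := h' v hv (by rw [QuadraticMap.polar_self, hv]; simp)
      rw [ap_ksub, hv, hz] at this
      simpa using this
    have hb : ∀ x, κ x = 0 → QuadraticMap.polar κ v x = 0 → QuadraticMap.polar κ z x = 0 := by
      intro x hx hxv
      have := h' x hx hxv
      rw [ap_ksub, hx, hz, QuadraticMap.polar_comm] at this
      simpa using this
    obtain ⟨c, hc⟩ := ap_prop κ hnd v z (by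
      intro x hx
      by_contra hne
      apply hne
      have := hb (x + (-(κ x / QuadraticMap.polar κ z x)) • z) (by
        rw [ap_kadd, hz, QuadraticMap.polar_comm κ x z]; field_simp; ring) (by
        rw [QuadraticMap.polar_add_right, QuadraticMap.polar_smul_right, hx, hzv]; simp)
      rw [QuadraticMap.polar_add_right, QuadraticMap.polar_smul_right, QuadraticMap.polar_self, hz] at this
      simpa using this)
    exact ⟨c, by rw [hc]⟩
  · rintro ⟨t, rfl⟩ x h1 h2
    obtain ⟨x, rfl⟩ : ∃ z, x = z + u := ⟨x - u, by abel⟩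
    rw [add_sub_cancel_right] at h1
    rw [add_comm u v, add_sub_add_right_eq_sub, ap_ksub, h1, hv] at h2
    rw [add_comm u, add_sub_add_right_eq_sub, sub_eq_add_neg, ← neg_smul, ap_kadd, h1, hv]
    linear_combination t * h2

theorem ap_uniq {F V : Type*} [Field F] [AddCommGroup V] [Module F V] (κ : QuadraticForm F V)
    (hnd : ∀ x : V, (∀ y, QuadraticMap.polar κ x y = 0) → x = 0)
    (u v p : V) (hv : κ v = 0) (hv0 : v ≠ 0) :
    QuadraticMap.polar κ (p - u) v ≠ 0 ↔ ∃! y, apL κ u (u + v) y ∧ κ (p - y) = 0 := by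
  have key : ∀ t : F, κ (p - (u + t • v)) = κ (p - u) - t * QuadraticMap.polar κ (p - u) v := by
    intro t
    rw [show p - (u + t • v) = (p - u) + (-t) • v by rw [neg_smul]; abel, ap_kadd, hv]; ring
  constructor
  · intro h
    refine ⟨u + (κ (p - u) / QuadraticMap.polar κ (p - u) v) • v, ⟨?_, ?_⟩, ?_⟩
    · exact (apL_iff κ hnd u v _ hv).2 ⟨_, rfl⟩
    · rw [key]; field_simp; ring
    · rintro y ⟨hy, hy2⟩
      obtain ⟨t, rfl⟩ := (apL_iff κ hnd u v _ hv).1 hy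
      rw [key] at hy2
      congr 2
      field_simp
      linear_combination -hy2
  · rintro ⟨y, ⟨hy, hy2⟩, hy3⟩ h
    obtain ⟨t, rfl⟩ := (apL_iff κ hnd u v _ hv).1 hy
    have := hy3 (u + (t + 1) • v) ⟨(apL_iff κ hnd u v _ hv).2 ⟨_, rfl⟩, by
      rw [key] at hy2 ⊢; rw [h] at hy2 ⊢; simpa using hy2⟩
    rw [add_smul, one_smul] at this
    simp at this
    exact hv0 this

theorem apL_map {F V : Type*} [Field F] [AddCommGroup V] [Module F V] (κ : QuadraticForm F V)
    (f : Equiv.Perm V) (hf : ∀ u v, κ (f u - f v) = 0 ↔ κ (u - v) = 0) (u w y : V) :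
    apL κ (f u) (f w) (f y) ↔ apL κ u w y := by
  unfold apL
  rw [← f.forall_congr_right]
  simp only [hf]

theorem ap_H {F V : Type*} [Field F] [AddCommGroup V] [Module F V] (κ : QuadraticForm F V)
    (hnd : ∀ x : V, (∀ y, QuadraticMap.polar κ x y = 0) → x = 0)
    (f : Equiv.Perm V) (hf : ∀ u v, κ (f u - f v) = 0 ↔ κ (u - v) = 0)
    (u v p : V) (hv : κ v = 0) (hv0 : v ≠ 0) :
    QuadraticMap.polar κ (f p - f u) (f (u + v) - f u) = 0 ↔ QuadraticMap.polar κ (p - u) v = 0 := by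
  have h1 := ap_uniq κ hnd u v p hv hv0
  have h2 := ap_uniq κ hnd (f u) (f (u + v) - f u) (f p) (by rw [hf]; simpa using hv) (by
    rw [sub_ne_zero, f.injective.ne_iff]; simpa using hv0)
  rw [← not_iff_not]
  refine h2.trans (Iff.trans ?_ h1.symm)
  rw [add_sub_cancel, ← f.existsUnique_congr_right]
  simp only [apL_map κ f hf, hf]

theorem ap_par {F V : Type*} [Field F] [AddCommGroup V] [Module F V] (κ : QuadraticForm F V)
    (hnd : ∀ x : V, (∀ y, QuadraticMap.polar κ x y = 0) → x = 0)
    (f : Equiv.Perm V) (hf : ∀ u v, κ (f u - f v) = 0 ↔ κ (u - v) = 0)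
    (u u2 v : V) (hv : κ v = 0) (hv0 : v ≠ 0) :
    ∃ c : F, f (u2 + v) - f u2 = c • (f (u + v) - f u) := by
  apply ap_prop κ hnd
  intro x hx
  by_contra hne
  set v' := f (u + v) - f u with hv'
  set w' := f (u2 + v) - f u2 with hw'
  have H1 := fun p => ap_H κ hnd f hf u v p hv hv0
  have H2 := fun p => ap_H κ hnd f hf u2 v p hv hv0
  rw [← hv'] at H1
  rw [← hw'] at H2
  have A : ∀ s : F, QuadraticMap.polar κ (f.symm (f u + s • x) - u) v = 0 := by
    intro s
    rw [← H1, f.apply_symm_apply, add_sub_cancel_left, QuadraticMap.polar_smul_left,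
      QuadraticMap.polar_comm, hx, smul_zero]
  have C : ∀ s : F, QuadraticMap.polar κ (f.symm (f u + s • x) - u2) v =
      QuadraticMap.polar κ (u - u2) v := by
    intro s
    have := A s
    rw [show f.symm (f u + s • x) - u2 = (f.symm (f u + s • x) - u) + (u - u2) by abel,
      QuadraticMap.polar_add_left, this, zero_add]
  have D : ∀ s : F, QuadraticMap.polar κ (f u + s • x - f u2) w' =
      QuadraticMap.polar κ (f u - f u2) w' + s * QuadraticMap.polar κ w' x := by
    intro s
    rw [show f u + s • x - f u2 = (f u - f u2) + s • x by abel,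
      QuadraticMap.polar_add_left, QuadraticMap.polar_smul_left, QuadraticMap.polar_comm κ x w',
      smul_eq_mul]
  have E : ∀ s : F, QuadraticMap.polar κ (f u - f u2) w' + s * QuadraticMap.polar κ w' x = 0 ↔
      QuadraticMap.polar κ (u - u2) v = 0 := by
    intro s
    rw [← D, ← C s, ← H2, f.apply_symm_apply]
  have E1 := (E (-(QuadraticMap.polar κ (f u - f u2) w' / QuadraticMap.polar κ w' x))).1
    (by field_simp; ring)
  have E2 := (E (-(QuadraticMap.polar κ (f u - f u2) w' / QuadraticMap.polar κ w' x) + 1)).2 E1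
  apply hne
  field_simp at E2
  linear_combination E2

theorem ap_P {F V : Type*} [Field F] [AddCommGroup V] [Module F V] (κ : QuadraticForm F V)
    (hnd : ∀ x : V, (∀ y, QuadraticMap.polar κ x y = 0) → x = 0)
    (f : Equiv.Perm V) (hf : ∀ u v, κ (f u - f v) = 0 ↔ κ (u - v) = 0)
    (v : V) (hv : κ v = 0) (hv0 : v ≠ 0) :
    ∃ v' : V, (∀ u p, QuadraticMap.polar κ v' (f p - f u) = 0 ↔ QuadraticMap.polar κ v (p - u) = 0)
      ∧ ∀ u p, (∃ t : F, f p - f u = t • v') ↔ ∃ t : F, p - u = t • v := by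
  refine ⟨f (0 + v) - f 0, ?_⟩
  have key : ∀ u, ∃ c : F, c ≠ 0 ∧ f (u + v) - f u = c • (f (0 + v) - f 0) := by
    intro u
    obtain ⟨c, hc⟩ := ap_par κ hnd f hf 0 u v hv hv0
    refine ⟨c, ?_, hc⟩
    rintro rfl
    rw [zero_smul, sub_eq_zero, f.injective.eq_iff] at hc
    simp at hc
    exact hv0 hc
  constructor
  · intro u p
    obtain ⟨c, hc, h⟩ := key u
    have := ap_H κ hnd f hf u v p hv hv0
    rw [h, QuadraticMap.polar_smul_right, smul_eq_mul, mul_eq_zero, or_iff_right hc] at this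
    rwa [QuadraticMap.polar_comm κ _ (f p - f u), QuadraticMap.polar_comm κ v]
  · intro u p
    obtain ⟨c, hc, h⟩ := key u
    have h1 := apL_iff κ hnd u v p hv
    have h2 := apL_iff κ hnd (f u) (f (u + v) - f u) (f p) (by rw [hf]; simpa using hv)
    rw [add_sub_cancel, apL_map κ f hf, h1] at h2
    simp only [← sub_eq_iff_eq_add'] at h2
    rw [h2, h]
    constructor
    · rintro ⟨t, ht⟩
      exact ⟨t / c, by rw [ht, smul_smul, div_mul_cancel₀ _ hc]⟩
    · rintro ⟨t, ht⟩
      exact ⟨t * c, by rw [ht, smul_smul]⟩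

theorem ap_chev {F V : Type*} [Field F] [Fintype F] [AddCommGroup V] [Module F V]
    (κ : QuadraticForm F V) (b : Fin 3 → V) (hb : LinearIndependent F b) :
    ∃ c : Fin 3 → F, ∑ i, c i • b i ≠ 0 ∧ κ (∑ i, c i • b i) = 0 := by
  classical
  let P : MvPolynomial (Fin 3) F :=
    MvPolynomial.C (κ (b 0)) * (MvPolynomial.X 0 * MvPolynomial.X 0)
    + MvPolynomial.C (κ (b 1)) * (MvPolynomial.X 1 * MvPolynomial.X 1)
    + MvPolynomial.C (κ (b 2)) * (MvPolynomial.X 2 * MvPolynomial.X 2)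
    + MvPolynomial.C (QuadraticMap.polar κ (b 0) (b 1)) * (MvPolynomial.X 0 * MvPolynomial.X 1)
    + MvPolynomial.C (QuadraticMap.polar κ (b 0) (b 2)) * (MvPolynomial.X 0 * MvPolynomial.X 2)
    + MvPolynomial.C (QuadraticMap.polar κ (b 1) (b 2)) * (MvPolynomial.X 1 * MvPolynomial.X 2)
  have hm : ∀ (c : F) (i j : Fin 3), (MvPolynomial.C c * (MvPolynomial.X i * MvPolynomial.X j) :
      MvPolynomial (Fin 3) F).totalDegree ≤ 2 := by
    intro c i j
    refine (MvPolynomial.totalDegree_mul _ _).trans ?_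
    rw [MvPolynomial.totalDegree_C, zero_add]
    refine (MvPolynomial.totalDegree_mul _ _).trans ?_
    simp
  have ha : ∀ p q : MvPolynomial (Fin 3) F, p.totalDegree ≤ 2 → q.totalDegree ≤ 2 →
      (p + q).totalDegree ≤ 2 := fun p q hp hq =>
    (MvPolynomial.totalDegree_add p q).trans (max_le hp hq)
  have hdeg : P.totalDegree < Fintype.card (Fin 3) := by
    have : P.totalDegree ≤ 2 := by
      refine ha _ _ (ha _ _ (ha _ _ (ha _ _ (ha _ _ ?_ ?_) ?_) ?_) ?_) ?_ <;> exact hm _ _ _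
    simp; omega
  have hev : ∀ c : Fin 3 → F, MvPolynomial.eval c P = κ (∑ i, c i • b i) := by
    intro c
    rw [Fin.sum_univ_three, ap_kadd, ap_kadd, QuadraticMap.map_smul, QuadraticMap.polar_add_left,
      QuadraticMap.polar_smul_left, QuadraticMap.polar_smul_left, QuadraticMap.polar_smul_left]
    simp [P]
    ring
  obtain ⟨p, hp⟩ := CharP.exists F
  have hpp : p.Prime := (CharP.char_is_prime_or_zero F p).resolve_right (CharP.char_ne_zero_of_finite F p)
  have hd := char_dvd_card_solutions p hdeg
  have h0 : MvPolynomial.eval (0 : Fin 3 → F) P = 0 := by rw [hev]; simp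
  have hpos : 0 < Fintype.card {x : Fin 3 → F // MvPolynomial.eval x P = 0} :=
    Fintype.card_pos_iff.2 ⟨⟨0, h0⟩⟩
  have h1 : 1 < Fintype.card {x : Fin 3 → F // MvPolynomial.eval x P = 0} :=
    lt_of_lt_of_le hpp.one_lt (Nat.le_of_dvd hpos hd)
  obtain ⟨c, hc⟩ := Fintype.exists_ne_of_one_lt_card h1 ⟨0, h0⟩
  refine ⟨c.1, ?_, by rw [← hev]; exact c.2⟩
  intro h
  apply hc
  have := Fintype.linearIndependent_iff.1 hb c.1 h
  ext i
  simpa using this i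

theorem ap_sing {F V : Type*} [Field F] [Fintype F] [AddCommGroup V] [Module F V]
    [FiniteDimensional F V] (κ : QuadraticForm F V) (W : Submodule F V)
    (hW : 3 ≤ Module.finrank F W) : ∃ e ∈ W, e ≠ 0 ∧ κ e = 0 := by
  let b := Module.finBasis F W
  let b' : Fin 3 → V := fun i => (b (Fin.castLE hW i) : V)
  have hb : LinearIndependent F b' := by
    have h1 := b.linearIndependent.comp (Fin.castLE hW) (Fin.castLE_injective hW)
    exact h1.map' W.subtype (Submodule.ker_subtype W)
  obtain ⟨c, h1, h2⟩ := ap_chev κ b' hb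
  refine ⟨_, ?_, h1, h2⟩
  exact W.sum_mem fun i _ => W.smul_mem _ (b _).2

theorem ap_span {F V : Type*} [Field F] [Fintype F] [AddCommGroup V] [Module F V]
    [FiniteDimensional F V] (hV : 4 ≤ Module.finrank F V) (κ : QuadraticForm F V)
    (hnd : ∀ x : V, (∀ y, QuadraticMap.polar κ x y = 0) → x = 0)
    (a : V) (ha : κ a ≠ 0) (z : V) :
    (∀ v, κ v = 0 → v ≠ 0 → QuadraticMap.polar κ a v = 0 → QuadraticMap.polar κ v z = 0) ↔
      ∃ t : F, z = t • a := by
  constructor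
  · intro h
    have hW : 3 ≤ Module.finrank F (LinearMap.ker (κ.polarBilin a)) := by
      have h1 := LinearMap.finrank_range_add_finrank_ker (κ.polarBilin a)
      have h2 := Submodule.finrank_le (LinearMap.range (κ.polarBilin a))
      rw [Module.finrank_self] at h2
      omega
    obtain ⟨e, he, he0, hke⟩ := ap_sing κ _ hW
    replace he : QuadraticMap.polar κ a e = 0 := by simpa using he
    have hze := h e hke he0 he
    have hf0 : ∃ f0, QuadraticMap.polar κ a f0 = 0 ∧ QuadraticMap.polar κ e f0 ≠ 0 := by
      by_contra hcon
      push Not at hcon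
      obtain ⟨c, hc⟩ := ap_prop κ hnd a e hcon
      rw [hc, QuadraticMap.map_smul, smul_eq_mul, mul_eq_zero, or_iff_left ha, mul_self_eq_zero] at hke
      rw [hke, zero_smul] at hc
      exact he0 hc
    obtain ⟨f0, hf1, hf2⟩ := hf0
    have key : ∀ x, QuadraticMap.polar κ a x = 0 → QuadraticMap.polar κ e x ≠ 0 →
        QuadraticMap.polar κ z x = 0 := by
      intro x hx hxe
      have := h (x + (-(κ x / QuadraticMap.polar κ e x)) • e) (by
        rw [ap_kadd, hke, QuadraticMap.polar_comm κ x e]; field_simp; ring) (by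
        intro h0
        apply hxe
        have h1 : QuadraticMap.polar κ e (x + (-(κ x / QuadraticMap.polar κ e x)) • e) = 0 := by
          rw [h0]; simp
        rw [QuadraticMap.polar_add_right, QuadraticMap.polar_smul_right, QuadraticMap.polar_self, hke] at h1
        simpa using h1) (by
        rw [QuadraticMap.polar_add_right, QuadraticMap.polar_smul_right, hx, he]; simp)
      rw [QuadraticMap.polar_add_left, QuadraticMap.polar_smul_left, hze] at this
      rw [QuadraticMap.polar_comm]
      simpa using this
    apply ap_prop κ hnd
    intro x hx
    by_cases hxe : QuadraticMap.polar κ e x = 0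
    · have h1 := key (x + f0) (by rw [QuadraticMap.polar_add_right, hx, hf1, add_zero])
        (by rwa [QuadraticMap.polar_add_right, hxe, zero_add])
      rwa [QuadraticMap.polar_add_right, key f0 hf1 hf2, add_zero] at h1
    · exact key x hx hxe
  · rintro ⟨t, rfl⟩ v _ _ h
    rw [QuadraticMap.polar_smul_right, QuadraticMap.polar_comm, h, smul_zero]

theorem ap_line {F V : Type*} [Field F] [Fintype F] [AddCommGroup V] [Module F V]
    [FiniteDimensional F V] (hV : 4 ≤ Module.finrank F V) (κ : QuadraticForm F V)
    (hnd : ∀ x : V, (∀ y, QuadraticMap.polar κ x y = 0) → x = 0)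
    (f : Equiv.Perm V) (hf : ∀ u v, κ (f u - f v) = 0 ↔ κ (u - v) = 0)
    (a : V) (ha0 : a ≠ 0) :
    ∃ a' : V, ∀ u p, (∃ t : F, f p - f u = t • a') ↔ ∃ t : F, p - u = t • a := by
  by_cases ha : κ a = 0
  · obtain ⟨a', h1, h2⟩ := ap_P κ hnd f hf a ha ha0
    exact ⟨a', h2⟩
  choose! g hg _ using fun (v : V) (hv : κ v = 0) (hv0 : v ≠ 0) => ap_P κ hnd f hf v hv hv0
  let T : Submodule F V := ⨅ v : {v : V // κ v = 0 ∧ v ≠ 0 ∧ QuadraticMap.polar κ a v = 0},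
    LinearMap.ker (κ.polarBilin (g v.1))
  have hT : ∀ u p, f p - f u ∈ T ↔ p - u ∈ Submodule.span F {a} := by
    intro u p
    rw [Submodule.mem_span_singleton]
    have := ap_span hV κ hnd a ha (p - u)
    simp only [eq_comm (a := p - u)] at this
    rw [← this]
    simp only [T, Submodule.mem_iInf, LinearMap.mem_ker, QuadraticMap.polarBilin_apply_apply,
      Subtype.forall]
    constructor
    · intro h v h1 h2 h3
      exact (hg v h1 h2 u p).1 (h v ⟨h1, h2, h3⟩)
    · rintro h v ⟨h1, h2, h3⟩
      exact (hg v h1 h2 u p).2 (h v h1 h2 h3)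
  have hcard : Nat.card (Submodule.span F {a}) = Nat.card T := by
    refine Nat.card_congr ((f.trans (Equiv.subRight (f 0))).subtypeEquiv ?_)
    intro x
    simp only [Equiv.trans_apply, Equiv.subRight_apply]
    rw [hT, sub_zero]
  have hrank : Module.finrank F T = 1 := by
    rw [← finrank_span_singleton (K := F) ha0]
    rw [Module.natCard_eq_pow_finrank (K := F) (V := T),
      Module.natCard_eq_pow_finrank (K := F) (V := Submodule.span F {a})] at hcard
    exact (Nat.pow_right_injective (Nat.card_eq_fintype_card (α := F) ▸ Fintype.one_lt_card) hcard).symm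
  obtain ⟨a', ha', h⟩ := finrank_eq_one_iff'.1 hrank
  refine ⟨a', fun u p => ?_⟩
  have := hT u p
  rw [Submodule.mem_span_singleton] at this
  simp only [eq_comm (a := p - u)]
  rw [← this]
  constructor
  · rintro ⟨t, ht⟩
    rw [ht]; exact T.smul_mem _ a'.2
  · intro hh
    obtain ⟨c, hc⟩ := h ⟨_, hh⟩
    exact ⟨c, by rw [← Submodule.coe_smul, hc]⟩

theorem ap_ft {F V : Type*} [Field F] [AddCommGroup V] [Module F V]
    (h2 : ∀ a : V, ∃ c : V, ∀ t : F, c ≠ t • a) (g : Equiv.Perm V) (g0 : g 0 = 0)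
    (hG : ∀ a : V, a ≠ 0 → ∀ u p, (∃ t : F, g p - g u = t • g a) ↔ ∃ t : F, p - u = t • a) :
    (∀ x y, g (x + y) = g x + g y) ∧ ∃ α : F ≃+* F, ∀ (c : F) x, g (c • x) = α c • g x := by
  have sym : ∀ a b : V, a ≠ 0 → (∀ t : F, b ≠ t • a) → b ≠ 0 ∧ ∀ t : F, a ≠ t • b := by
    intro a b ha hb
    refine ⟨fun h => hb 0 (by simp [h]), fun t ht => ?_⟩
    have t0 : t ≠ 0 := by rintro rfl; simp at ht; exact ha ht
    exact hb t⁻¹ (by rw [ht, smul_smul, inv_mul_cancel₀ t0, one_smul])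
  have gne : ∀ a, a ≠ 0 → g a ≠ 0 := by
    intro a ha h
    rw [← g0, g.injective.eq_iff] at h
    exact ha h
  have gind : ∀ a b : V, a ≠ 0 → (∀ t : F, b ≠ t • a) → ∀ t : F, g b ≠ t • g a := by
    intro a b ha hb t ht
    obtain ⟨s, hs⟩ := (hG a ha 0 b).1 ⟨t, by rw [g0, sub_zero, ht]⟩
    exact hb s (by simpa using hs)
  have add1 : ∀ a b : V, a ≠ 0 → (∀ t : F, b ≠ t • a) → g (a + b) = g a + g b := by
    intro a b ha hb
    obtain ⟨hb0, hba⟩ := sym a b ha hb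
    obtain ⟨s, hs⟩ := (hG b hb0 a (a + b)).2 ⟨1, by simp⟩
    obtain ⟨r, hr⟩ := (hG a ha b (a + b)).2 ⟨1, by simp⟩
    have e : (1 - s) • g b = (1 - r) • g a := by
      rw [sub_smul, sub_smul, one_smul, one_smul, ← hs, ← hr]; abel
    have s1 : 1 - s = 0 := by
      by_contra hne
      apply gind a b ha hb ((1 - s)⁻¹ * (1 - r))
      rw [mul_smul, ← e, smul_smul, inv_mul_cancel₀ hne, one_smul]
    have : s = 1 := by linear_combination -s1
    rw [this, one_smul] at hs
    rw [← hs]; abel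
  have add2 : ∀ a (s t : F), a ≠ 0 → g (s • a + t • a) = g (s • a) + g (t • a) := by
    intro a s t ha
    obtain ⟨c, hc⟩ := h2 a
    have A : ∀ s : F, g (s • a + c) = g (s • a) + g c := by
      intro s
      by_cases hs : s = 0
      · simp [hs, g0]
      · apply add1 _ _ (smul_ne_zero hs ha)
        intro t ht
        exact hc (t * s) (by rw [ht, smul_smul])
    by_cases hs : s = 0
    · simp [hs, g0]
    have h1 : g (s • a + (t • a + c)) = g (s • a) + g (t • a + c) := by
      apply add1 _ _ (smul_ne_zero hs ha)
      intro r hr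
      exact hc (r * s - t) (by rw [sub_smul, mul_smul, ← hr]; abel)
    rw [A, ← add_assoc, ← add_smul, A, ← add_assoc] at h1
    rw [← add_smul]
    exact add_right_cancel h1
  have hadd : ∀ x y, g (x + y) = g x + g y := by
    intro x y
    by_cases hx : x = 0
    · simp [hx, g0]
    by_cases hy : ∃ t : F, y = t • x
    · obtain ⟨t, rfl⟩ := hy
      have := add2 x 1 t hx
      simpa using this
    · push Not at hy
      exact add1 x y hx hy
  refine ⟨hadd, ?_⟩
  have ex : ∀ (x : V), x ≠ 0 → ∀ c : F, ∃ d : F, g (c • x) = d • g x := by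
    intro x hx c
    obtain ⟨t, ht⟩ := (hG x hx 0 (c • x)).2 ⟨c, by simp⟩
    exact ⟨t, by rw [← ht, g0, sub_zero]⟩
  choose! A hA using ex
  have Aeq1 : ∀ a b : V, a ≠ 0 → (∀ t : F, b ≠ t • a) → ∀ c, A a c = A b c := by
    intro a b ha hb c
    obtain ⟨hb0, hba⟩ := sym a b ha hb
    have hab : a + b ≠ 0 := by
      intro h
      exact hb (-1) (by rw [neg_smul, one_smul]; exact (neg_eq_of_add_eq_zero_right h).symm)
    have h1 := hA (a + b) hab c
    rw [smul_add, hadd, hadd, hA a ha, hA b hb0, smul_add] at h1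
    have h3 : (A a c - A (a + b) c) • g a = (A (a + b) c - A b c) • g b := by
      rw [sub_smul, sub_smul, sub_eq_sub_iff_add_eq_add, h1, add_comm]
    have k1 : A (a + b) c - A b c = 0 := by
      by_contra hne
      apply gind a b ha hb ((A (a + b) c - A b c)⁻¹ * (A a c - A (a + b) c))
      rw [mul_smul, h3, smul_smul, inv_mul_cancel₀ hne, one_smul]
    rw [k1, zero_smul, smul_eq_zero, or_iff_left (gne a ha)] at h3
    linear_combination h3 + k1
  obtain ⟨e, he⟩ := h2 0
  have he0 : e ≠ 0 := by simpa using he 0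
  have Aeq : ∀ x, x ≠ 0 → ∀ c, A x c = A e c := by
    intro x hx c
    by_cases hy : ∃ t : F, x = t • e
    · obtain ⟨t, rfl⟩ := hy
      obtain ⟨d, hd⟩ := h2 e
      rw [Aeq1 e d he0 hd, Aeq1 (t • e) d hx]
      intro s hs
      exact hd (s * t) (by rw [hs, smul_smul])
    · push Not at hy
      exact (Aeq1 e x he0 hy c).symm
  have hl : ∀ (c : F) x, g (c • x) = A e c • g x := by
    intro c x
    by_cases hx : x = 0
    · simp [hx, g0]
    · rw [hA x hx, Aeq x hx]
  have canc : ∀ s t : F, s • g e = t • g e → s = t := fun s t h =>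
    smul_left_injective F (gne e he0) h
  let α : F →+* F :=
    { toFun := A e
      map_one' := canc _ _ (by rw [← hl]; simp)
      map_zero' := canc _ _ (by rw [← hl]; simp [g0])
      map_mul' := fun s t => canc _ _ (by rw [← hl, mul_smul, hl, hl, smul_smul])
      map_add' := fun s t => canc _ _ (by rw [← hl, add_smul, hadd, hl, hl, add_smul]) }
  have hbij : Function.Bijective α := by
    refine ⟨α.injective, fun d => ?_⟩
    obtain ⟨c, hc⟩ := (hG e he0 0 (g.symm (d • g e))).1 ⟨d, by simp [g0]⟩
    refine ⟨c, canc _ _ ?_⟩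
    change A e c • g e = _
    rw [← hl, ← hc, sub_zero, g.apply_symm_apply]
  exact ⟨RingEquiv.ofBijective α hbij, fun c x => hl c x⟩

theorem ap_form {F V : Type*} [Field F] [AddCommGroup V] [Module F V]
    (κ κ' : QuadraticForm F V)
    (hnd : ∀ x : V, (∀ y, QuadraticMap.polar κ x y = 0) → x = 0)
    (h : ∀ x, κ' x = 0 ↔ κ x = 0) (e : V) (he0 : e ≠ 0) (he : κ e = 0) :
    ∃ c : F, c ≠ 0 ∧ ∀ x, κ' x = c * κ x := by
  have hv : ∀ v, κ v = 0 → ∃ c : F, ∀ x, QuadraticMap.polar κ' v x = c * QuadraticMap.polar κ v x := by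
    intro v hv
    apply ap_fun
    intro x hx
    by_contra hne
    have hv' := (h v).2 hv
    have k : ∀ t : F, κ (x + t • v) = κ x := by
      intro t; rw [ap_kadd, hv, QuadraticMap.polar_comm, hx]; ring
    have k' : ∀ t : F, κ' (x + t • v) = κ' x + t * QuadraticMap.polar κ' v x := by
      intro t; rw [ap_kadd, hv', QuadraticMap.polar_comm]; ring
    have h1 := (h (x + (-(κ' x / QuadraticMap.polar κ' v x)) • v)).1 (by rw [k']; field_simp; ring)
    rw [k] at h1
    have h3 := (h (x + (1 : F) • v)).2 (by rw [k]; exact h1)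
    rw [k', (h x).2 h1] at h3
    apply hne
    simpa using h3
  obtain ⟨c, hc⟩ := hv e he
  obtain ⟨f0, hf0⟩ : ∃ f0, QuadraticMap.polar κ e f0 ≠ 0 := by
    by_contra hcon
    push Not at hcon
    exact he0 (hnd e hcon)
  have he' := (h e).2 he
  -- vectors not orthogonal to e
  have key : ∀ x, QuadraticMap.polar κ e x ≠ 0 → κ' x = c * κ x ∧
      ∀ y, QuadraticMap.polar κ' x y = c * QuadraticMap.polar κ x y := by
    intro x hx
    set s := κ x / QuadraticMap.polar κ e x with hs
    obtain ⟨v, hxv⟩ : ∃ v, v = x + (-s) • e := ⟨_, rfl⟩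
    have hvs : κ v = 0 := by
      rw [hxv, ap_kadd, he, QuadraticMap.polar_comm κ x e, hs]; field_simp; ring
    have hxv' : x = v + s • e := by rw [hxv, neg_smul]; abel
    have hev : QuadraticMap.polar κ e v ≠ 0 := by
      rw [hxv, QuadraticMap.polar_add_right, QuadraticMap.polar_smul_right, QuadraticMap.polar_self, he]
      simpa using hx
    obtain ⟨d, hd⟩ := hv v hvs
    have hdc : d = c := by
      have h1 := hc v
      rw [QuadraticMap.polar_comm, hd e, QuadraticMap.polar_comm κ v e] at h1
      exact mul_right_cancel₀ hev h1
    subst hdc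
    refine ⟨?_, fun y => ?_⟩
    · rw [hxv', ap_kadd, ap_kadd, he, he', hvs, (h v).2 hvs, hd]; ring
    · rw [hxv']
      simp only [QuadraticMap.polar_add_left, QuadraticMap.polar_smul_left, hd, hc, smul_eq_mul]
      ring
  have all : ∀ x, κ' x = c * κ x := by
    intro x
    by_cases hx : QuadraticMap.polar κ e x = 0
    · obtain ⟨h1, h1'⟩ := key (x + f0) (by rwa [QuadraticMap.polar_add_right, hx, zero_add])
      obtain ⟨h3, h3'⟩ := key f0 hf0
      have := ap_ksub κ' (x + f0) f0
      rw [add_sub_cancel_right, h1, h3, h1'] at this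
      rw [this]
      have h4 := ap_ksub κ (x + f0) f0
      rw [add_sub_cancel_right] at h4
      rw [h4]; ring
    · exact (key x hx).1
  refine ⟨c, ?_, all⟩
  rintro rfl
  have z : ∀ x, κ x = 0 := fun x => (h x).1 (by rw [all, zero_mul])
  exact he0 (hnd e fun y => by simp [QuadraticMap.polar, z])

theorem ap_semi {F V : Type*} [Field F] [AddCommGroup V] [Module F V]
    (κ : QuadraticForm F V) (g : Equiv.Perm V) (hadd : ∀ x y, g (x + y) = g x + g y)
    (α : F ≃+* F) (hl : ∀ (c : F) x, g (c • x) = α c • g x) :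
    ∃ κ' : QuadraticForm F V, ∀ x, κ' x = α.symm (κ (g x)) := by
  have hp : ∀ x y, QuadraticMap.polar (fun x => α.symm (κ (g x))) x y =
      α.symm (QuadraticMap.polar κ (g x) (g y)) := by
    intro x y
    simp only [QuadraticMap.polar, hadd, map_sub]
  refine ⟨QuadraticMap.ofPolar (fun x => α.symm (κ (g x))) ?_ ?_ ?_, fun x => rfl⟩
  · intro a x
    simp [hl, QuadraticMap.map_smul]
  · intro x x' y
    rw [hp, hp, hp, hadd, QuadraticMap.polar_add_left, map_add]
  · intro a x y
    rw [hp, hp, hl, QuadraticMap.polar_smul_left]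
    simp

theorem ap_main {F V : Type*} [Field F] [Fintype F] [AddCommGroup V] [Module F V]
    [FiniteDimensional F V] (hV : 4 ≤ Module.finrank F V) (κ : QuadraticForm F V)
    (hnd : ∀ x : V, (∀ y, QuadraticMap.polar κ x y = 0) → x = 0)
    (f : Equiv.Perm V) (hf : ∀ u v, κ (f u - f v) = 0 ↔ κ (u - v) = 0) :
    ∃ (α : F ≃+* F) (φ : Equiv.Perm V) (lam : Fˣ) (w : V),
        (∀ x y, φ (x + y) = φ x + φ y) ∧
        (∀ (c : F) (x : V), φ (c • x) = α c • φ x) ∧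
        (∀ x, κ (φ x) = (lam : F) * α (κ x)) ∧
        (∀ x, f x = φ x + w) := by
  let g : Equiv.Perm V := f.trans (Equiv.subRight (f 0))
  have hgf : ∀ x, g x = f x - f 0 := fun x => rfl
  have g0 : g 0 = 0 := by rw [hgf, sub_self]
  have hgs : ∀ x y, g x - g y = f x - f y := fun x y => by rw [hgf, hgf]; abel
  have h2 : ∀ a : V, ∃ c : V, ∀ t : F, c ≠ t • a := by
    intro a
    by_contra hcon
    push Not at hcon
    have := finrank_le_one (R := F) a (fun w => by
      obtain ⟨t, ht⟩ := hcon w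
      exact ⟨t, ht.symm⟩)
    omega
  have hG : ∀ a : V, a ≠ 0 → ∀ u p, (∃ t : F, g p - g u = t • g a) ↔ ∃ t : F, p - u = t • a := by
    intro a ha u p
    obtain ⟨a', h⟩ := ap_line hV κ hnd f hf a ha
    obtain ⟨s, hs⟩ := (h 0 a).2 ⟨1, by simp⟩
    have hs0 : s ≠ 0 := by
      rintro rfl
      rw [zero_smul, sub_eq_zero, f.injective.eq_iff] at hs
      exact ha hs
    rw [← h u p, hgs, hgf a, hs]
    constructor
    · rintro ⟨t, ht⟩
      exact ⟨t * s, by rw [ht, smul_smul]⟩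
    · rintro ⟨t, ht⟩
      exact ⟨t / s, by rw [ht, smul_smul, div_mul_cancel₀ _ hs0]⟩
  obtain ⟨hadd, α, hl⟩ := ap_ft h2 g g0 hG
  obtain ⟨κ', hκ'⟩ := ap_semi κ g hadd α hl
  obtain ⟨e, -, he0, he⟩ := ap_sing κ ⊤ (by rw [finrank_top]; omega)
  obtain ⟨c, hc0, hc⟩ := ap_form κ κ' hnd (fun x => by
    rw [hκ', map_eq_zero_iff _ α.symm.injective, hgf, hf, sub_zero]) e he0 he
  refine ⟨α, g, Units.mk0 (α c) (by simpa using hc0), f 0, hadd, hl, fun x => ?_, fun x => by rw [hgf]; abel⟩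
  have := hc x
  rw [hκ', RingEquiv.symm_apply_eq, map_mul] at this
  exact this


/-- The automorphism group of the affine polar graph on
`V = F^{2m}` defined by a non-degenerate quadratic form `κ` (vertices `V`,
`u ~ v` iff `u ≠ v` and `κ(u - v) = 0`) consists exactly of the maps
`x ↦ φ x + w` with `φ` a semisimilarity of `κ`, i.e. it is
`F^{2m} ⋊ ΓO(κ)`. -/
theorem aut_affine_polar_graph {F : Type*} [Field F] [Fintype F]
    (m : ℕ) (hm : 2 ≤ m) (κ : QuadraticForm F (Fin (2 * m) → F))
    (hnd : ∀ x : Fin (2 * m) → F, (∀ y, QuadraticMap.polar (⇑κ) x y = 0) → x = 0)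
    (f : Equiv.Perm (Fin (2 * m) → F)) :
    (∀ u v : Fin (2 * m) → F,
        (f u ≠ f v ∧ κ (f u - f v) = 0) ↔ (u ≠ v ∧ κ (u - v) = 0)) ↔
      ∃ (α : F ≃+* F) (φ : Equiv.Perm (Fin (2 * m) → F)) (lam : Fˣ)
        (w : Fin (2 * m) → F),
        (∀ x y, φ (x + y) = φ x + φ y) ∧
        (∀ (c : F) (x : Fin (2 * m) → F), φ (c • x) = α c • φ x) ∧
        (∀ x, κ (φ x) = (lam : F) * α (κ x)) ∧
        (∀ x, f x = φ x + w) := by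
  constructor
  · intro h
    refine ap_main (by simp; omega) κ hnd f fun u v => ?_
    by_cases huv : u = v
    · simp [huv]
    · have := h u v
      simpa [huv, f.injective.eq_iff] using this
  · rintro ⟨α, φ, lam, w, hadd, hl, hk, hw⟩ u v
    have hs : φ (u - v) = φ u - φ v := by
      rw [eq_sub_iff_add_eq, ← hadd, sub_add_cancel]
    rw [f.injective.ne_iff, hw, hw, add_sub_add_right_eq_sub, ← hs, hk]
    simp
end

section
/- Let q be a prime power, F = GF(q) and m ≥ 2, and let H_q(2, m) be the bilinear forms graph: the graph whose vertices are the 2×m matrices over F, two distinct matrices X, Y being adjacent if and only if rank(X − Y) = 1. For A ∈ GL_2(F), B ∈ GL_m(F), a field automorphism α of F and a 2×m matrix C over F, let f_{A,B,α,C} denote the map X ↦ A·α(X)·B + C, where α(X) applies α to each entry of X. If m > 2, then the automorphism group of H_q(2, m) consists exactly of the maps f_{A,B,α,C}. If m = 2, then the automorphism group of H_q(2, 2) consists exactly of the maps f_{A,B,α,C} together with the maps X ↦ A·α(X)ᵀ·B + C. -/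
open Matrix

namespace BFG

variable {F : Type*} [Field F] {m : ℕ}

def D (X : Matrix (Fin 2) (Fin m) F) : Prop :=
  ∃ (u : Fin 2 → F) (v : Fin m → F), X = vecMulVec u v

lemma D_of_rank {X : Matrix (Fin 2) (Fin m) F} (h : X.rank = 1) : D X := by
  have h1 : Module.finrank F (LinearMap.range X.mulVecLin) ≤ 1 := h.le
  rw [finrank_le_one_iff] at h1
  obtain ⟨⟨u, hu⟩, h2⟩ := h1
  choose c hc using fun j : Fin m => h2 ⟨X *ᵥ Pi.single j 1, ⟨Pi.single j 1, rfl⟩⟩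
  refine ⟨u, c, ?_⟩
  ext i j
  have := congrFun (congrArg Subtype.val (hc j)) i
  simp at this
  rw [vecMulVec_apply, mul_comm, this]

lemma adj_iff (X Y : Matrix (Fin 2) (Fin m) F) :
    (X ≠ Y ∧ (X - Y).rank = 1) ↔ (X ≠ Y ∧ D (X - Y)) := by
  refine ⟨fun h => ⟨h.1, D_of_rank h.2⟩, fun ⟨h, u, v, e⟩ => ⟨h, ?_⟩⟩
  have h1 : (X - Y).rank ≤ 1 := by rw [e]; exact rank_vecMulVec_le u v
  have h2 : (X - Y).rank ≠ 0 := by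
    intro h0
    apply h
    have h3 : Module.finrank F (LinearMap.range (X - Y).mulVecLin) = 0 := h0
    rw [Submodule.finrank_eq_zero, LinearMap.range_eq_bot] at h3
    rw [← sub_eq_zero]
    ext i j
    have := congrFun (LinearMap.congr_fun h3 (Pi.single j 1)) i
    simpa using this
  omega

lemma D_zero : D (0 : Matrix (Fin 2) (Fin m) F) := ⟨0, 0, by simp⟩

lemma vm (p : Fin 2 → F) (X : Matrix (Fin 2) (Fin m) F) (j : Fin m) :
    (p ᵥ* X) j = p 0 * X 0 j + p 1 * X 1 j := by
  simp [vecMul, dotProduct, Fin.sum_univ_two]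

lemma ne_cases {p : Fin 2 → F} (hp : p ≠ 0) : p 0 ≠ 0 ∨ p 1 ≠ 0 := by
  by_contra! h
  apply hp
  ext i
  fin_cases i
  · exact h.1
  · exact h.2

lemma perp_iff {p : Fin 2 → F} (hp : p ≠ 0) (X : Matrix (Fin 2) (Fin m) F) :
    p ᵥ* X = 0 ↔ ∃ v, X = vecMulVec ![p 1, - p 0] v := by
  constructor
  · intro h
    have h' : ∀ j, p 0 * X 0 j + p 1 * X 1 j = 0 := fun j => by rw [← vm, h]; rfl
    rcases ne_cases hp with h0 | h0
    · refine ⟨fun j => - X 1 j / p 0, ?_⟩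
      ext i j
      have := h' j
      fin_cases i
      · simp [vecMulVec_apply]; field_simp; linear_combination this
      · simp [vecMulVec_apply]; field_simp
    · refine ⟨fun j => X 0 j / p 1, ?_⟩
      ext i j
      have := h' j
      fin_cases i
      · simp [vecMulVec_apply]; field_simp
      · simp [vecMulVec_apply]; field_simp; linear_combination this
  · rintro ⟨v, rfl⟩
    ext j
    rw [vm]
    simp [vecMulVec_apply]; ring

lemma par {v b : Fin m → F} (hv : v ≠ 0) (h : ∀ i j, v i * b j = v j * b i) :
    ∃ k : F, b = k • v := by
  obtain ⟨i, hi⟩ := Function.ne_iff.1 hv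
  simp only [Pi.zero_apply] at hi
  refine ⟨b i / v i, ?_⟩
  ext j
  have := h i j
  simp; field_simp; linear_combination this

lemma D_sub {u u' : Fin 2 → F} {v v' : Fin m → F} (h : D (vecMulVec u v - vecMulVec u' v')) :
    u 0 * u' 1 = u 1 * u' 0 ∨ ∀ i j, v i * v' j = v j * v' i := by
  obtain ⟨a, b, e⟩ := h
  by_cases hd : u 0 * u' 1 = u 1 * u' 0
  · exact Or.inl hd
  refine Or.inr fun i j => ?_
  have e' : ∀ k l, u k * v l - u' k * v' l = a k * b l := fun k l => by
    simpa [vecMulVec_apply] using congrFun (congrFun e k) l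
  have h1 : (u 0 * u' 1 - u 1 * u' 0) * (v i * v' j - v j * v' i) = 0 := by
    have h2 : (u 0 * v i - u' 0 * v' i) * (u 1 * v j - u' 1 * v' j) =
      (u 0 * v j - u' 0 * v' j) * (u 1 * v i - u' 1 * v' i) := by
      rw [e', e', e', e']; ring
    linear_combination -h2
  rcases mul_eq_zero.1 h1 with h | h
  · exact absurd (sub_eq_zero.1 h) hd
  · exact sub_eq_zero.1 h

lemma clique (S : Set (Matrix (Fin 2) (Fin m) F)) (h0 : 0 ∈ S)
    (hS : ∀ X ∈ S, ∀ Y ∈ S, D (X - Y)) :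
    (∃ p : Fin 2 → F, p ≠ 0 ∧ ∀ X ∈ S, p ᵥ* X = 0) ∨
    (∃ v : Fin m → F, v ≠ 0 ∧ ∀ X ∈ S, ∃ u, X = vecMulVec u v) := by
  have hD : ∀ X ∈ S, D X := fun X hX => by simpa using hS X hX 0 h0
  by_cases hz : ∀ X ∈ S, X = 0
  · left
    refine ⟨![1, 0], fun h => by simpa using congrFun h 0, fun X hX => by rw [hz X hX]; simp⟩
  push Not at hz
  obtain ⟨X, hX, hX0⟩ := hz
  obtain ⟨u, v, rfl⟩ := hD X hX
  have hu : u ≠ 0 := by rintro rfl; simp at hX0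
  have hv : v ≠ 0 := by rintro rfl; exact hX0 (by ext; simp [vecMulVec_apply])
  by_cases hp : ∀ Y ∈ S, ![u 1, - u 0] ᵥ* Y = 0
  · left
    refine ⟨_, fun h => ?_, hp⟩
    rcases ne_cases hu with h' | h'
    · exact h' (by simpa using congrFun h 1)
    · exact h' (by simpa using congrFun h 0)
  push Not at hp
  obtain ⟨Y, hY, hYp⟩ := hp
  obtain ⟨u', v', rfl⟩ := hD Y hY
  right
  refine ⟨v, hv, fun Z hZ => ?_⟩
  obtain ⟨a, b, rfl⟩ := hD Z hZ
  have hd : u 0 * u' 1 ≠ u 1 * u' 0 := by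
    intro hd
    apply hYp
    ext j
    rw [vm]
    simp [vecMulVec_apply]
    linear_combination (-v' j) * hd
  have hv' : v' ≠ 0 := by
    rintro rfl
    exact hYp (by ext; rw [vm]; simp [vecMulVec_apply])
  obtain ⟨k, rfl⟩ := par hv ((D_sub (hS _ hX _ hY)).resolve_left hd)
  have hk : k ≠ 0 := by rintro rfl; simp at hv'
  have key : (∀ i j, v i * b j = v j * b i) → ∃ w, vecMulVec a b = vecMulVec w v := by
    intro h
    obtain ⟨c, rfl⟩ := par hv h
    exact ⟨c • a, by simp [vecMulVec_smul, smul_vecMulVec]⟩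
  rcases D_sub (hS _ hX _ hZ) with h1 | h1
  · rcases D_sub (hS _ hY _ hZ) with h2 | h2
    · have hdd : u 0 * u' 1 - u 1 * u' 0 ≠ 0 := sub_ne_zero.2 hd
      have a0 : a 0 = 0 := by
        apply (mul_eq_zero.1 (_ : (u 0 * u' 1 - u 1 * u' 0) * a 0 = 0)).resolve_left hdd
        linear_combination u' 0 * h1 - u 0 * h2
      have a1 : a 1 = 0 := by
        apply (mul_eq_zero.1 (_ : (u 0 * u' 1 - u 1 * u' 0) * a 1 = 0)).resolve_left hdd
        linear_combination u' 1 * h1 - u 1 * h2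
      refine ⟨0, ?_⟩
      ext i j
      fin_cases i <;> simp [vecMulVec_apply, a0, a1]
    · apply key
      intro i j
      have := h2 i j
      simp only [Pi.smul_apply, smul_eq_mul] at this
      apply mul_left_cancel₀ hk
      linear_combination this
  · exact key h1

lemma solve {p r : Fin 2 → F} (h : p 0 * r 1 ≠ p 1 * r 0) (b c : Fin m → F) :
    ∃ Z : Matrix (Fin 2) (Fin m) F, p ᵥ* Z = b ∧ r ᵥ* Z = c := by
  have hd : p 0 * r 1 - p 1 * r 0 ≠ 0 := sub_ne_zero.2 h
  refine ⟨of ![fun j => (r 1 * b j - p 1 * c j) / (p 0 * r 1 - p 1 * r 0),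
    fun j => (p 0 * c j - r 0 * b j) / (p 0 * r 1 - p 1 * r 0)], ?_, ?_⟩
  · ext j; rw [vm]; simp; rw [mul_div_assoc', mul_div_assoc', ← add_div, div_eq_iff hd]; ring
  · ext j; rw [vm]; simp; rw [mul_div_assoc', mul_div_assoc', ← add_div, div_eq_iff hd]; ring

lemma solve_unique {p r : Fin 2 → F} (h : p 0 * r 1 ≠ p 1 * r 0)
    {Z : Matrix (Fin 2) (Fin m) F} (h1 : p ᵥ* Z = 0) (h2 : r ᵥ* Z = 0) : Z = 0 := by
  have hd : p 0 * r 1 - p 1 * r 0 ≠ 0 := sub_ne_zero.2 h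
  have e1 : ∀ j, p 0 * Z 0 j + p 1 * Z 1 j = 0 := fun j => by rw [← vm, h1]; rfl
  have e2 : ∀ j, r 0 * Z 0 j + r 1 * Z 1 j = 0 := fun j => by rw [← vm, h2]; rfl
  ext i j
  apply (mul_eq_zero.1 (_ : (p 0 * r 1 - p 1 * r 0) * Z i j = 0)).resolve_left hd
  fin_cases i
  · simp only [Fin.zero_eta]
    linear_combination r 1 * e1 j - p 1 * e2 j
  · simp only [Fin.mk_one]
    linear_combination p 0 * e2 j - r 0 * e1 j

def L (p : Fin 2 → F) (C : Matrix (Fin 2) (Fin m) F) : Set (Matrix (Fin 2) (Fin m) F) :=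
  {X | p ᵥ* (X - C) = 0}

lemma L_card {p : Fin 2 → F} (hp : p ≠ 0) (C : Matrix (Fin 2) (Fin m) F) :
    (L p C).ncard = Nat.card (Fin m → F) := by
  have e : L p C = Set.range (fun v : Fin m → F => vecMulVec ![p 1, - p 0] v + C) := by
    ext X
    simp only [L, Set.mem_ofPred_eq, perp_iff hp, Set.mem_range]
    exact exists_congr fun v => by rw [sub_eq_iff_eq_add, eq_comm]
  rw [e, ← Nat.card_coe_set_eq, Nat.card_range_of_injective]
  intro v w h
  have h' : vecMulVec ![p 1, - p 0] v = vecMulVec ![p 1, - p 0] w := add_right_cancel h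
  ext j
  rcases ne_cases hp with h0 | h0
  · have := congrFun (congrFun h' 1) j
    simpa [vecMulVec_apply, h0] using this
  · have := congrFun (congrFun h' 0) j
    simpa [vecMulVec_apply, h0] using this

def T (f : Equiv.Perm (Matrix (Fin 2) (Fin m) F)) (p : Fin 2 → F)
    (C : Matrix (Fin 2) (Fin m) F) : Prop :=
  ∃ p' : Fin 2 → F, p' ≠ 0 ∧ ∀ X, p ᵥ* (X - C) = 0 ↔ p' ᵥ* (f X - f C) = 0

lemma T_of [Finite F] (f : Equiv.Perm (Matrix (Fin 2) (Fin m) F)) {p : Fin 2 → F} (hp : p ≠ 0)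
    (C : Matrix (Fin 2) (Fin m) F) (p' : Fin 2 → F) (hp' : p' ≠ 0)
    (h : ∀ X, p ᵥ* (X - C) = 0 → p' ᵥ* (f X - f C) = 0) : T f p C := by
  refine ⟨p', hp', fun X => ⟨h X, fun hX => ?_⟩⟩
  have hs : f '' L p C ⊆ L p' (f C) := by
    rintro _ ⟨Y, hY, rfl⟩
    exact h Y hY
  have he : f '' L p C = L p' (f C) := by
    apply Set.eq_of_subset_of_ncard_le hs _ (Set.toFinite _)
    rw [Set.ncard_image_of_injective _ f.injective, L_card hp, L_card hp']
  have : f X ∈ f '' L p C := by rw [he]; exact hX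
  obtain ⟨Y, hY, e⟩ := this
  rw [← f.injective e]; exact hY

lemma T_shift {f : Equiv.Perm (Matrix (Fin 2) (Fin m) F)} {p : Fin 2 → F}
    {C C' : Matrix (Fin 2) (Fin m) F} (h : T f p C) (hC : p ᵥ* (C' - C) = 0) : T f p C' := by
  obtain ⟨p', hp', H⟩ := h
  refine ⟨p', hp', fun X => ?_⟩
  have h1 := (H C').1 hC
  have h2 := H X
  simp only [vecMul_sub, sub_eq_zero] at *
  rw [hC, h1]; exact h2

lemma dichotomy [Finite F] (f : Equiv.Perm (Matrix (Fin 2) (Fin m) F))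
    (hf : ∀ X Y, D (X - Y) → D (f X - f Y)) {p : Fin 2 → F} (hp : p ≠ 0)
    (C : Matrix (Fin 2) (Fin m) F) :
    T f p C ∨ ∃ v : Fin m → F, v ≠ 0 ∧ ∀ X, p ᵥ* (X - C) = 0 → ∃ u, f X - f C = vecMulVec u v := by
  have := clique ((fun X => f X - f C) '' L p C) ⟨C, by simp [L], by simp⟩ (by
    rintro _ ⟨X, hX, rfl⟩ _ ⟨Y, hY, rfl⟩
    simp only [sub_sub_sub_cancel_right]
    apply hf
    have : p ᵥ* (X - Y) = 0 := by
      simp only [L, Set.mem_ofPred_eq, vecMul_sub, sub_eq_zero] at *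
      rw [hX, hY]
    obtain ⟨v, hv⟩ := (perp_iff hp _).1 this
    exact ⟨_, v, hv⟩)
  rcases this with ⟨p', hp', h⟩ | ⟨v, hv, h⟩
  · exact Or.inl (T_of f hp C p' hp' fun X hX => h _ ⟨X, hX, rfl⟩)
  · exact Or.inr ⟨v, hv, fun X hX => h _ ⟨X, hX, rfl⟩⟩

lemma allT_big [Finite F] (hm : 2 < m) (f : Equiv.Perm (Matrix (Fin 2) (Fin m) F))
    (hf : ∀ X Y, D (X - Y) → D (f X - f Y)) {p : Fin 2 → F} (hp : p ≠ 0)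
    (C : Matrix (Fin 2) (Fin m) F) : T f p C := by
  refine (dichotomy f hf hp C).resolve_right ?_
  rintro ⟨v, hv, h⟩
  have hs : f '' L p C ⊆ Set.range (fun u : Fin 2 → F => vecMulVec u v + f C) := by
    rintro _ ⟨X, hX, rfl⟩
    obtain ⟨u, hu⟩ := h X hX
    exact ⟨u, by simp [← hu]⟩
  have h1 := Set.ncard_le_ncard hs (Set.toFinite _)
  rw [Set.ncard_image_of_injective _ f.injective, L_card hp] at h1
  have h2 : (Set.range (fun u : Fin 2 → F => vecMulVec u v + f C)).ncard ≤ Nat.card (Fin 2 → F) := by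
    rw [← Set.image_univ, ← Set.ncard_univ]
    exact Set.ncard_image_le (Set.toFinite _)
  have h3 := h1.trans h2
  simp only [Nat.card_fun, Nat.card_fin] at h3
  have h4 : 1 < Nat.card F := Finite.one_lt_card
  exact absurd h3 (not_le.2 (by simpa using Nat.pow_lt_pow_right h4 hm))

def tr (f : Equiv.Perm (Matrix (Fin 2) (Fin 2) F)) : Equiv.Perm (Matrix (Fin 2) (Fin 2) F) :=
  f.trans ⟨transpose, transpose, fun X => by simp, fun X => by simp⟩

lemma tr_apply (f : Equiv.Perm (Matrix (Fin 2) (Fin 2) F)) (X) : tr f X = (f X)ᵀ := rfl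

lemma dich2 [Finite F] (f : Equiv.Perm (Matrix (Fin 2) (Fin 2) F))
    (hf : ∀ X Y, D (X - Y) → D (f X - f Y)) {p : Fin 2 → F} (hp : p ≠ 0)
    (C : Matrix (Fin 2) (Fin 2) F) : T f p C ∨ T (tr f) p C := by
  rcases dichotomy f hf hp C with h | ⟨v, hv, h⟩
  · exact Or.inl h
  refine Or.inr (T_of _ hp C ![v 1, - v 0] ?_ ?_)
  · intro h
    rcases ne_cases hv with h' | h'
    · exact h' (by simpa using congrFun h 1)
    · exact h' (by simpa using congrFun h 0)
  · intro X hX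
    obtain ⟨u, hu⟩ := h X hX
    rw [tr_apply, tr_apply, ← transpose_sub, hu]
    ext j
    rw [vm]
    simp [vecMulVec_apply]
    ring

lemma conflict {f : Equiv.Perm (Matrix (Fin 2) (Fin 2) F)} {p r : Fin 2 → F}
    (h : p 0 * r 1 ≠ p 1 * r 0) {C} (h1 : T f p C) (h2 : T (tr f) r C) : False := by
  obtain ⟨p', hp', H1⟩ := h1
  obtain ⟨r', hr', H2⟩ := h2
  set W : Matrix (Fin 2) (Fin 2) F := vecMulVec ![p' 1, - p' 0] ![r' 1, - r' 0] with hW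
  have hW0 : W ≠ 0 := by
    intro h0
    have e : ∀ i j, W i j = 0 := fun i j => by rw [h0]; rfl
    have e00 := e 0 0
    have e01 := e 0 1
    have e10 := e 1 0
    have e11 := e 1 1
    simp [hW] at e00 e01 e10 e11
    rcases ne_cases hp' with a | a <;> rcases ne_cases hr' with b | b <;> simp_all
  obtain ⟨X, hX⟩ := f.surjective (W + f C)
  have a1 : p ᵥ* (X - C) = 0 := by
    rw [H1, hX, add_sub_cancel_right, perp_iff hp']
    exact ⟨_, rfl⟩
  have a2 : r ᵥ* (X - C) = 0 := by
    rw [H2, tr_apply, tr_apply, ← transpose_sub, hX, add_sub_cancel_right, perp_iff hr']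
    exact ⟨![p' 1, - p' 0], by rw [hW, transpose_vecMulVec]⟩
  have := solve_unique h a1 a2
  rw [sub_eq_zero.1 this] at hX
  exact hW0 (by simpa using hX)

lemma exists_indep {p : Fin 2 → F} (hp : p ≠ 0) : ∃ r : Fin 2 → F, r ≠ 0 ∧ p 0 * r 1 ≠ p 1 * r 0 := by
  rcases ne_cases hp with h | h
  · exact ⟨![0, 1], fun e => by simpa using congrFun e 1, by simpa using h⟩
  · exact ⟨![1, 0], fun e => by simpa using congrFun e 0, by simpa using h.symm⟩

lemma allT_two [Finite F] (f : Equiv.Perm (Matrix (Fin 2) (Fin 2) F))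
    (hf : ∀ X Y, D (X - Y) → D (f X - f Y)) :
    (∀ p ≠ 0, ∀ C, T f p C) ∨ (∀ p ≠ 0, ∀ C, T (tr f) p C) := by
  by_cases h : ∀ p ≠ 0, ∀ C, T f p C
  · exact Or.inl h
  right
  push Not at h
  obtain ⟨p, hp, C₀, hC₀⟩ := h
  have h0 := (dich2 f hf hp C₀).resolve_left hC₀
  have hr : ∀ r : Fin 2 → F, r ≠ 0 → p 0 * r 1 ≠ p 1 * r 0 → ∀ C, T (tr f) r C := by
    intro r hr0 hd C
    obtain ⟨Z, z1, z2⟩ := solve hd (p ᵥ* C₀) (r ᵥ* C)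
    have hpZ : T (tr f) p Z := T_shift h0 (by rw [vecMul_sub, z1, sub_self])
    have hrZ : T (tr f) r Z := (dich2 f hf hr0 Z).resolve_left fun h =>
      conflict (by intro e; apply hd; linear_combination -e) h hpZ
    exact T_shift hrZ (by rw [vecMul_sub, z2, sub_self])
  intro r hr0 C
  by_cases hd : p 0 * r 1 = p 1 * r 0
  · obtain ⟨s, hs0, hs⟩ := exists_indep hr0
    refine (dich2 f hf hr0 C).resolve_left fun h => conflict hs h (hr s hs0 ?_ C)
    intro e
    apply hs
    rcases ne_cases hp with h | h
    · apply mul_left_cancel₀ h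
      linear_combination r 0 * e - s 0 * hd
    · apply mul_left_cancel₀ h
      linear_combination r 1 * e - s 1 * hd
  · exact hr r hr0 hd C

lemma T_unif {f : Equiv.Perm (Matrix (Fin 2) (Fin m) F)} (h : ∀ p ≠ 0, ∀ C, T f p C)
    {p : Fin 2 → F} (hp : p ≠ 0) :
    ∃ p' : Fin 2 → F, p' ≠ 0 ∧ ∀ X Y, p ᵥ* (X - Y) = 0 ↔ p' ᵥ* (f X - f Y) = 0 := by
  obtain ⟨p', hp', H⟩ := h p hp 0
  refine ⟨p', hp', fun X Y => ?_⟩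
  by_cases hY : p ᵥ* (Y - 0) = 0
  · have h1 := (H Y).1 hY
    have h2 := H X
    simp only [vecMul_sub, sub_eq_zero] at *
    rw [hY, h1]; exact h2
  · obtain ⟨q, hq, Hq⟩ := h p hp Y
    rw [Hq]
    have hd : p' 0 * q 1 = p' 1 * q 0 := by
      by_contra hd
      obtain ⟨Z, z1, z2⟩ := solve hd (p' ᵥ* f 0) (q ᵥ* f Y)
      obtain ⟨W, rfl⟩ := f.surjective Z
      have a1 := (H W).2 (by rw [vecMul_sub, z1, sub_self])
      have a2 := (Hq W).2 (by rw [vecMul_sub, z2, sub_self])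
      apply hY
      simp only [vecMul_sub, sub_eq_zero] at *
      rw [← a1, ← a2]
    have : ∃ k : F, k ≠ 0 ∧ q = k • p' := by
      obtain ⟨k, rfl⟩ := par (v := p') (b := q) hp' (by
        intro i j
        fin_cases i <;> fin_cases j <;> simp
        · exact hd
        · exact hd.symm)
      exact ⟨k, by rintro rfl; simp at hq, rfl⟩
    obtain ⟨k, hk, rfl⟩ := this
    rw [smul_vecMul, smul_eq_zero]
    simp [hk]

def pr (x y : Fin m → F) : Matrix (Fin 2) (Fin m) F := of ![x, y]

lemma pr_rows (X : Matrix (Fin 2) (Fin m) F) : pr (X 0) (X 1) = X := by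
  ext i j
  fin_cases i <;> rfl

lemma vm_pr (p : Fin 2 → F) (x y : Fin m → F) : p ᵥ* pr x y = p 0 • x + p 1 • y := by
  ext j
  rw [vm]; rfl

lemma pr_sub (x y x' y' : Fin m → F) : pr x y - pr x' y' = pr (x - x') (y - y') := by
  ext i j
  fin_cases i <;> rfl

lemma vm' (p : Fin 2 → F) (X : Matrix (Fin 2) (Fin m) F) : p ᵥ* X = p 0 • X 0 + p 1 • X 1 := by
  ext j
  rw [vm]; rfl

/-- the semilinear part -/
lemma semilinear [Finite F] (hm : 0 < m) (G : (Fin m → F) → (Fin m → F))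
    (hadd : ∀ x y, G (x - y) = G x - G y) (hinj : ∀ x, G x = 0 → x = 0)
    (hs : ∀ c : F, ∃ s : F, ∀ x, G (c • x) = s • G x) :
    ∃ (α : F ≃+* F) (B : (Matrix (Fin m) (Fin m) F)ˣ), ∀ x : Fin m → F,
      G x = (fun j => α (x j)) ᵥ* (B : Matrix (Fin m) (Fin m) F) := by
  choose σ hσ using hs
  have G0 : G 0 = 0 := by simpa using hadd 0 0
  have Gneg : ∀ x, G (-x) = - G x := fun x => by simpa [G0] using hadd 0 x
  have Gadd : ∀ x y, G (x + y) = G x + G y := fun x y => by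
    have := hadd x (-y)
    rwa [Gneg, sub_neg_eq_add, sub_neg_eq_add] at this
  let e : Fin m → F := Pi.single ⟨0, hm⟩ 1
  have he : G e ≠ 0 := by
    intro h
    have := congrFun (hinj _ h) ⟨0, hm⟩
    simp [e] at this
  have canc : ∀ a b : F, a • G e = b • G e → a = b := fun a b h => smul_left_injective F he h
  let φ : F →+* F :=
    { toFun := σ
      map_one' := canc _ _ (by rw [← hσ, one_smul, one_smul])
      map_mul' := fun a b => canc _ _ (by rw [← hσ, mul_smul, hσ, hσ, mul_smul])
      map_zero' := canc _ _ (by rw [← hσ, zero_smul, zero_smul, G0])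
      map_add' := fun a b => canc _ _ (by rw [← hσ, add_smul, Gadd, hσ, hσ, add_smul]) }
  have hφ : Function.Bijective φ := Finite.injective_iff_bijective.1 φ.injective
  let α : F ≃+* F := RingEquiv.ofBijective φ hφ
  have hα : ∀ c x, G (c • x) = α c • G x := hσ
  let GA : (Fin m → F) →+ (Fin m → F) := ⟨⟨G, G0⟩, Gadd⟩
  let B₀ : Matrix (Fin m) (Fin m) F := of fun i => G (Pi.single i 1)
  have hG : ∀ x : Fin m → F, G x = (fun j => α (x j)) ᵥ* B₀ := by
    intro x
    have hx : x = ∑ i, x i • (Pi.single i 1 : Fin m → F) := by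
      ext j
      simp [Finset.sum_apply, Pi.single_apply]
    have : GA x = ∑ i, GA (x i • (Pi.single i 1 : Fin m → F)) := by
      rw [← map_sum, ← hx]
    change G x = ∑ i, G (x i • (Pi.single i 1 : Fin m → F)) at this
    rw [this]
    ext j
    simp [hα, vecMul, dotProduct, B₀, Finset.sum_apply]
  have hB : IsUnit B₀ := by
    rw [← vecMul_injective_iff_isUnit]
    have hz : ∀ w : Fin m → F, w ᵥ* B₀ = 0 → w = 0 := by
      intro w hw
      have h1 : G (fun j => α.symm (w j)) = 0 := by rw [hG]; simpa using hw
      have h2 := hinj _ h1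
      ext j
      have := congrFun h2 j
      simpa using this
    intro w w' h
    have : (w - w') ᵥ* B₀ = 0 := by rw [sub_vecMul, sub_eq_zero]; exact h
    exact sub_eq_zero.1 (hz _ this)
  obtain ⟨B, hB'⟩ := hB
  exact ⟨α, B, fun x => by rw [hG, hB']⟩

lemma core [Finite F] (hm : 0 < m) (f : Equiv.Perm (Matrix (Fin 2) (Fin m) F))
    (h : ∀ p ≠ 0, ∀ C, T f p C) :
    ∃ (A : (Matrix (Fin 2) (Fin 2) F)ˣ) (B : (Matrix (Fin m) (Fin m) F)ˣ)
          (α : F ≃+* F) (C : Matrix (Fin 2) (Fin m) F),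
          ∀ X, f X = (A : Matrix (Fin 2) (Fin 2) F) * X.map ⇑α *
            (B : Matrix (Fin m) (Fin m) F) + C := by
  have ne0 : (![1, 0] : Fin 2 → F) ≠ 0 := fun e => by simpa using congrFun e 0
  have ne1 : (![0, 1] : Fin 2 → F) ≠ 0 := fun e => by simpa using congrFun e 1
  have ne2 : ∀ c, (![c, -1] : Fin 2 → F) ≠ 0 := fun c e => by simpa using congrFun e 1
  obtain ⟨p, hp, Hp⟩ := T_unif h ne0
  obtain ⟨r, hr, Hr⟩ := T_unif h ne1
  obtain ⟨s, hs, Hs⟩ := T_unif h (ne2 1)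
  let e : Fin m → F := Pi.single ⟨0, hm⟩ 1
  have he : e ≠ 0 := fun h => by simpa [e] using congrFun h ⟨0, hm⟩
  have hd : p 0 * r 1 ≠ p 1 * r 0 := by
    intro hd
    obtain ⟨k, rfl⟩ := par (v := p) (b := r) hp (by
        intro i j
        fin_cases i <;> fin_cases j <;> simp
        · exact hd
        · exact hd.symm)
    have h1 := (Hp (pr 0 e) (pr 0 0)).1 (by rw [pr_sub, vm_pr]; simp)
    have h2 := (Hr (pr 0 e) (pr 0 0)).2 (by rw [smul_vecMul, h1, smul_zero])
    rw [pr_sub, vm_pr] at h2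
    exact he (by simpa using h2)
  have hdd : p 0 * r 1 - p 1 * r 0 ≠ 0 := sub_ne_zero.2 hd
  -- s = a p + b r
  obtain ⟨a, b, hab⟩ : ∃ a b : F, s = a • p - b • r := by
    refine ⟨(s 0 * r 1 - s 1 * r 0) / (p 0 * r 1 - p 1 * r 0),
      - ((p 0 * s 1 - p 1 * s 0) / (p 0 * r 1 - p 1 * r 0)), ?_⟩
    ext i
    apply mul_left_cancel₀ hdd
    simp only [Pi.sub_apply, Pi.smul_apply, smul_eq_mul, neg_mul, sub_neg_eq_add, mul_add]
    rw [← mul_assoc, ← mul_assoc, mul_div_cancel₀ _ hdd, mul_div_cancel₀ _ hdd]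
    fin_cases i <;> simp <;> ring
  have ha : a ≠ 0 := by
    rintro rfl
    have h1 := (Hr (pr e 0) (pr 0 0)).1 (by rw [pr_sub, vm_pr]; simp)
    have h2 := (Hs (pr e 0) (pr 0 0)).2 (by rw [hab, sub_vecMul, smul_vecMul, smul_vecMul, h1]; simp)
    rw [pr_sub, vm_pr] at h2
    exact he (by simpa using h2)
  have hb : b ≠ 0 := by
    rintro rfl
    have h1 := (Hp (pr 0 e) (pr 0 0)).1 (by rw [pr_sub, vm_pr]; simp)
    have h2 := (Hs (pr 0 e) (pr 0 0)).2 (by rw [hab, sub_vecMul, smul_vecMul, smul_vecMul, h1]; simp)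
    rw [pr_sub, vm_pr] at h2
    exact he (by simpa using h2)
  let P₀ : Matrix (Fin 2) (Fin 2) F := of ![a • p, b • r]
  have hP : IsUnit P₀ := by
    rw [isUnit_iff_isUnit_det, isUnit_iff_ne_zero, det_fin_two]
    simp only [P₀, of_apply, cons_val_zero, cons_val_one, Pi.smul_apply, smul_eq_mul]
    have : a * p 0 * (b * r 1) - a * p 1 * (b * r 0) = a * b * (p 0 * r 1 - p 1 * r 0) := by ring
    rw [this]
    exact mul_ne_zero (mul_ne_zero ha hb) hdd
  obtain ⟨P, hPP⟩ := hP
  let g : Matrix (Fin 2) (Fin m) F → Matrix (Fin 2) (Fin m) F := fun X => P₀ * (f X - f 0)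
  have g0 : ∀ X, g X 0 = a • (p ᵥ* (f X - f 0)) := by
    intro X
    ext j
    simp only [g, mul_apply, Fin.sum_univ_two, Pi.smul_apply, vm]
    simp [P₀]; ring
  have g1 : ∀ X, g X 1 = b • (r ᵥ* (f X - f 0)) := by
    intro X
    ext j
    simp only [g, mul_apply, Fin.sum_univ_two, Pi.smul_apply, vm]
    simp [P₀]; ring
  have k0 : ∀ x y x' y', x = x' ↔ g (pr x y) 0 = g (pr x' y') 0 := by
    intro x y x' y'
    rw [g0, g0, ← sub_eq_zero (b := a • _), ← smul_sub, smul_eq_zero_iff_right ha, ← vecMul_sub,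
      sub_sub_sub_cancel_right, ← Hp, pr_sub, vm_pr]
    simp [sub_eq_zero]
  have k1 : ∀ x y x' y', y = y' ↔ g (pr x y) 1 = g (pr x' y') 1 := by
    intro x y x' y'
    rw [g1, g1, ← sub_eq_zero (b := b • _), ← smul_sub, smul_eq_zero_iff_right hb, ← vecMul_sub,
      sub_sub_sub_cancel_right, ← Hr, pr_sub, vm_pr]
    simp [sub_eq_zero]
  have k2 : ∀ x y x' y', x - y = x' - y' →
      g (pr x y) 0 - g (pr x y) 1 = g (pr x' y') 0 - g (pr x' y') 1 := by
    intro x y x' y' hxy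
    have h1 := (Hs (pr x y) (pr x' y')).1 (by
      rw [pr_sub, vm_pr]
      simp
      rw [show x - x' + (y' - y) = (x - y) - (x' - y') by abel, hxy, sub_self])
    rw [g0, g1, g0, g1, ← smul_vecMul, ← smul_vecMul, ← smul_vecMul, ← smul_vecMul,
      ← sub_vecMul, ← sub_vecMul, ← hab, ← sub_eq_zero, ← vecMul_sub, sub_sub_sub_cancel_right, h1]
  have gz : g (pr 0 0) = 0 := by
    have : (pr 0 0 : Matrix (Fin 2) (Fin m) F) = 0 := pr_rows 0
    simp [g, this]
  let G : (Fin m → F) → (Fin m → F) := fun x => g (pr x 0) 0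
  have G0 : G 0 = 0 := by simp only [G, gz]; rfl
  have e0 : ∀ x y, g (pr x y) 0 = G x := fun x y => (k0 x y x 0).1 rfl
  have e1 : ∀ x y, g (pr x y) 1 = G y := by
    intro x y
    rw [← (k1 y y x y).1 rfl]
    have := k2 y y 0 0 (by simp)
    rw [gz, e0] at this
    have h2 : G y - g (pr y y) 1 = 0 := this.trans (sub_self _)
    exact (sub_eq_zero.1 h2).symm
  have hadd : ∀ x y, G (x - y) = G x - G y := by
    intro x y
    have := k2 x y (x - y) 0 (by simp)
    rw [e0, e1, e0, e1, G0, sub_zero] at this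
    exact this.symm
  have hinj : ∀ x, G x = 0 → x = 0 := by
    intro x hx
    rw [k0 x 0 0 0, e0, e0, hx, G0]
  have hsm : ∀ c : F, ∃ t : F, ∀ x, G (c • x) = t • G x := by
    intro c
    obtain ⟨q, hq, Hq⟩ := T_unif h (ne2 c)
    have h1 : ∀ x, q ᵥ* (f (pr x (c • x)) - f 0) = 0 := by
      intro x
      rw [← Hq, sub_zero, vm_pr]; simp
    have h2 : q = (![q 0, q 1] : Fin 2 → F) := by ext i; fin_cases i <;> rfl
    set w : Fin 2 → F := q ᵥ* (↑P⁻¹ : Matrix (Fin 2) (Fin 2) F) with hw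
    have hwP : w ᵥ* P₀ = q := by
      rw [hw, vecMul_vecMul, ← hPP, Units.inv_mul, vecMul_one]
    have hw0 : w ≠ 0 := by
      intro h; rw [h] at hwP; simp at hwP; exact hq hwP.symm
    have h3 : ∀ x, w 0 • G x + w 1 • G (c • x) = 0 := by
      intro x
      rw [← e0 x (c • x), ← e1 x (c • x), ← vm', ← h1 x]
      simp only [g]
      rw [← vecMul_vecMul, hwP]
    have hw1 : w 1 ≠ 0 := by
      intro h
      have h4 := h3 e
      rw [h, zero_smul, add_zero] at h4
      rcases smul_eq_zero.1 h4 with h5 | h5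
      · rcases ne_cases hw0 with h6 | h6
        · exact h6 h5
        · exact h6 h
      · exact he (hinj _ h5)
    refine ⟨- (w 0 / w 1), fun x => ?_⟩
    ext j
    have := congrFun (h3 x) j
    simp at this
    simp
    field_simp
    linear_combination this
  obtain ⟨α, B, hB⟩ := semilinear hm G hadd hinj hsm
  refine ⟨P⁻¹, B, α, f 0, fun X => ?_⟩
  have hg : g X = X.map α * (B : Matrix (Fin m) (Fin m) F) := by
    ext i j
    rw [← pr_rows X]
    fin_cases i
    · simp only [Fin.zero_eta]
      rw [e0, hB]; rfl
    · simp only [Fin.mk_one]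
      rw [e1, hB]; rfl
  rw [Matrix.mul_assoc, ← hg]
  simp only [g]
  rw [← hPP, ← Matrix.mul_assoc, Units.inv_mul, Matrix.one_mul, sub_add_cancel]

lemma D_map {X : Matrix (Fin 2) (Fin m) F} (h : D X) (A : Matrix (Fin 2) (Fin 2) F)
    (B : Matrix (Fin m) (Fin m) F) (α : F ≃+* F) : D (A * X.map α * B) := by
  obtain ⟨u, v, rfl⟩ := h
  have : (vecMulVec u v).map α = vecMulVec (fun i => α (u i)) (fun j => α (v j)) := by
    ext i j; simp [vecMulVec_apply]
  exact ⟨_, _, by rw [this, mul_vecMulVec, vecMulVec_mul]⟩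

lemma D_map_iff {X : Matrix (Fin 2) (Fin m) F} (A : (Matrix (Fin 2) (Fin 2) F)ˣ)
    (B : (Matrix (Fin m) (Fin m) F)ˣ) (α : F ≃+* F) :
    D ((A : Matrix (Fin 2) (Fin 2) F) * X.map α * (B : Matrix (Fin m) (Fin m) F)) ↔ D X := by
  refine ⟨fun h => ?_, fun h => D_map h _ _ _⟩
  have h1 := D_map h (↑A⁻¹ : Matrix (Fin 2) (Fin 2) F) (↑B⁻¹ : Matrix (Fin m) (Fin m) F)
    (RingEquiv.refl F)
  have e : (↑A⁻¹ : Matrix (Fin 2) (Fin 2) F) *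
    ((A : Matrix (Fin 2) (Fin 2) F) * X.map α * (B : Matrix (Fin m) (Fin m) F)).map (RingEquiv.refl F)
     * (↑B⁻¹ : Matrix (Fin m) (Fin m) F) = X.map α := by
    have : ∀ M : Matrix (Fin 2) (Fin m) F, M.map (RingEquiv.refl F) = M := fun M => by ext; rfl
    rw [this, Matrix.mul_assoc, Matrix.mul_assoc, Units.mul_inv, Matrix.mul_one, ← Matrix.mul_assoc,
      Units.inv_mul, Matrix.one_mul]
  rw [e] at h1
  have h2 := D_map h1 1 1 α.symm
  rw [Matrix.one_mul, Matrix.mul_one] at h2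
  convert h2
  ext i j; simp

lemma D_transpose {X : Matrix (Fin 2) (Fin 2) F} : D Xᵀ ↔ D X := by
  constructor
  · rintro ⟨u, v, h⟩
    exact ⟨v, u, by rw [← transpose_transpose X, h, transpose_vecMulVec]⟩
  · rintro ⟨u, v, h⟩
    exact ⟨v, u, by rw [h, transpose_vecMulVec]⟩

lemma map_sub' {X Y : Matrix (Fin 2) (Fin m) F} (α : F ≃+* F) :
    X.map α - Y.map α = (X - Y).map α := by
  ext i j; simp

lemma hyp {f : Equiv.Perm (Matrix (Fin 2) (Fin m) F)}
    (h : ∀ X Y : Matrix (Fin 2) (Fin m) F,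
          (f X ≠ f Y ∧ (f X - f Y).rank = 1) ↔ (X ≠ Y ∧ (X - Y).rank = 1)) :
    ∀ X Y, D (X - Y) → D (f X - f Y) := by
  intro X Y hD
  by_cases e : X = Y
  · subst e; simpa using D_zero
  have := h X Y
  rw [adj_iff, adj_iff] at this
  exact (this.2 ⟨e, hD⟩).2

lemma back {f : Equiv.Perm (Matrix (Fin 2) (Fin m) F)}
    (h : ∀ X Y, D (f X - f Y) ↔ D (X - Y)) :
    ∀ X Y : Matrix (Fin 2) (Fin m) F,
          (f X ≠ f Y ∧ (f X - f Y).rank = 1) ↔ (X ≠ Y ∧ (X - Y).rank = 1) := by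
  intro X Y
  rw [adj_iff, adj_iff, h, f.injective.ne_iff]

lemma back1 {f : Equiv.Perm (Matrix (Fin 2) (Fin m) F)} (A : (Matrix (Fin 2) (Fin 2) F)ˣ)
    (B : (Matrix (Fin m) (Fin m) F)ˣ) (α : F ≃+* F) (C : Matrix (Fin 2) (Fin m) F)
    (h : ∀ X, f X = (A : Matrix (Fin 2) (Fin 2) F) * X.map ⇑α *
            (B : Matrix (Fin m) (Fin m) F) + C) (X Y : Matrix (Fin 2) (Fin m) F) :
    D (f X - f Y) ↔ D (X - Y) := by
  rw [h, h, add_sub_add_right_eq_sub, ← Matrix.sub_mul, ← Matrix.mul_sub, map_sub', D_map_iff]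

end BFG

/-- The automorphism group of the bilinear forms graph
`H_q(2, m)` (vertices the `2 × m` matrices over `F = GF(q)`, adjacency
`rank(X - Y) = 1`): for `m > 2` the automorphisms are precisely the maps
`X ↦ A · α(X) · B + C` with `A ∈ GL₂(q)`, `B ∈ GL_m(q)`, `α` a field
automorphism (entrywise) and `C` a `2 × m` matrix; for `m = 2` there are in
addition the maps `X ↦ A · α(X)ᵀ · B + C`. -/
theorem aut_bilinear_forms_graph {F : Type*} [Field F] [Fintype F] :
    (∀ m : ℕ, 2 < m → ∀ f : Equiv.Perm (Matrix (Fin 2) (Fin m) F),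
      (∀ X Y : Matrix (Fin 2) (Fin m) F,
          (f X ≠ f Y ∧ (f X - f Y).rank = 1) ↔ (X ≠ Y ∧ (X - Y).rank = 1)) ↔
        ∃ (A : (Matrix (Fin 2) (Fin 2) F)ˣ) (B : (Matrix (Fin m) (Fin m) F)ˣ)
          (α : F ≃+* F) (C : Matrix (Fin 2) (Fin m) F),
          ∀ X, f X = (A : Matrix (Fin 2) (Fin 2) F) * X.map ⇑α *
            (B : Matrix (Fin m) (Fin m) F) + C) ∧
    (∀ f : Equiv.Perm (Matrix (Fin 2) (Fin 2) F),
      (∀ X Y : Matrix (Fin 2) (Fin 2) F,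
          (f X ≠ f Y ∧ (f X - f Y).rank = 1) ↔ (X ≠ Y ∧ (X - Y).rank = 1)) ↔
        ∃ (A B : (Matrix (Fin 2) (Fin 2) F)ˣ) (α : F ≃+* F)
          (C : Matrix (Fin 2) (Fin 2) F),
          (∀ X, f X = (A : Matrix (Fin 2) (Fin 2) F) * X.map ⇑α *
            (B : Matrix (Fin 2) (Fin 2) F) + C) ∨
          (∀ X, f X = (A : Matrix (Fin 2) (Fin 2) F) * (X.map ⇑α)ᵀ *
            (B : Matrix (Fin 2) (Fin 2) F) + C)) := by
  classical
  refine ⟨fun m hm f => ⟨fun h => ?_, ?_⟩, fun f => ⟨fun h => ?_, ?_⟩⟩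
  · exact BFG.core (by omega) f fun p hp C => BFG.allT_big hm f (BFG.hyp h) hp C
  · rintro ⟨A, B, α, C, h⟩
    exact BFG.back (BFG.back1 A B α C h)
  · rcases BFG.allT_two f (BFG.hyp h) with h' | h'
    · obtain ⟨A, B, α, C, H⟩ := BFG.core (by omega) f h'
      exact ⟨A, B, α, C, Or.inl H⟩
    · obtain ⟨A, B, α, C, H⟩ := BFG.core (by omega) _ h'
      have hT : ∀ U : (Matrix (Fin 2) (Fin 2) F)ˣ, IsUnit (U : Matrix (Fin 2) (Fin 2) F)ᵀ :=
        fun U => (Matrix.isUnit_transpose _).2 U.isUnit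
      refine ⟨(hT B).unit, (hT A).unit, α, Cᵀ, Or.inr fun X => ?_⟩
      have := congrArg transpose (H X)
      rw [BFG.tr_apply, transpose_transpose] at this
      rw [this]
      simp [Matrix.transpose_mul, Matrix.mul_assoc]
  · rintro ⟨A, B, α, C, h | h⟩
    · exact BFG.back (BFG.back1 A B α C h)
    · refine BFG.back fun X Y => ?_
      rw [← BFG.D_transpose (X := X - Y), transpose_sub, h, h, add_sub_add_right_eq_sub,
        ← Matrix.sub_mul, ← Matrix.mul_sub, ← transpose_map, ← transpose_map, BFG.map_sub',
        BFG.D_map_iff]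
end

section
/- Let q be a prime power and F = GF(q), and let A(5, q) be the alternating forms graph: the graph whose vertices are the alternating 5×5 matrices over F (matrices X with Xᵀ = −X and all diagonal entries zero), two distinct matrices X, Y being adjacent if and only if rank(X − Y) = 2. Then the automorphism group of A(5, q) consists exactly of the maps X ↦ λ·P·α(X)·Pᵀ + C, where P ∈ GL_5(F), λ ∈ F^×, α is a field automorphism of F applied entrywise, and C is an alternating 5×5 matrix over F. -/
open Matrix

namespace AFG
variable {F : Type*} [Field F]

def AltS (F : Type*) [Field F] : Submodule F (Matrix (Fin 5) (Fin 5) F) where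
  carrier := {X | Xᵀ = -X ∧ ∀ i, X i i = 0}
  add_mem' := by
    rintro a b ⟨h1, h2⟩ ⟨h3, h4⟩
    exact ⟨by rw [transpose_add, h1, h3]; abel, fun i => by simp [h2, h4]⟩
  zero_mem' := by simp
  smul_mem' := by
    rintro c a ⟨h1, h2⟩
    exact ⟨by rw [transpose_smul, h1]; simp, fun i => by simp [h2]⟩

def Alt (F : Type*) [Field F] : Type _ := {X : Matrix (Fin 5) (Fin 5) F // Xᵀ = -X ∧ ∀ i, X i i = 0}

instance : AddCommGroup (Alt F) := inferInstanceAs (AddCommGroup (AltS F))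
instance : Module F (Alt F) := inferInstanceAs (Module F (AltS F))
instance [Finite F] : Finite (Alt F) := inferInstanceAs (Finite (AltS F))

def Alt.m (X : Alt F) : Matrix (Fin 5) (Fin 5) F := X.1

@[simp] theorem m_add (X Y : Alt F) : (X + Y).m = X.m + Y.m := rfl
@[simp] theorem m_sub (X Y : Alt F) : (X - Y).m = X.m - Y.m := rfl
@[simp] theorem m_neg (X : Alt F) : (-X).m = -X.m := rfl
@[simp] theorem m_zero : (0 : Alt F).m = 0 := rfl
@[simp] theorem m_smul (c : F) (X : Alt F) : (c • X).m = c • X.m := rfl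

@[ext] theorem alt_ext {X Y : Alt F} (h : ∀ i j, X.m i j = Y.m i j) : X = Y :=
  Subtype.ext (Matrix.ext h)

theorem alt_neg (X : Alt F) (i j : Fin 5) : X.m j i = - X.m i j := by
  have := congrFun (congrFun X.2.1 i) j
  exact this

theorem alt_diag (X : Alt F) (i : Fin 5) : X.m i i = 0 := X.2.2 i

def mk (M : Matrix (Fin 5) (Fin 5) F) (h : Mᵀ = -M ∧ ∀ i, M i i = 0) : Alt F := ⟨M, h⟩

@[simp] theorem mk_m (M : Matrix (Fin 5) (Fin 5) F) (h) : (mk M h).m = M := rfl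

/-- wedge product -/
def wd : (Fin 5 → F) →ₗ[F] (Fin 5 → F) →ₗ[F] Alt F :=
  LinearMap.mk₂ F (fun a b => mk (Matrix.of fun i j => a i * b j - b i * a j)
    ⟨by ext i j; simp; ring, fun i => by simp; ring⟩)
  (by intros; ext; simp; ring) (by intros; ext; simp; ring)
  (by intros; ext; simp; ring) (by intros; ext; simp; ring)

theorem wd_apply (a b : Fin 5 → F) (i j : Fin 5) : (wd a b).m i j = a i * b j - b i * a j := rfl

theorem wd_self (a : Fin 5 → F) : wd a a = 0 := by
  ext i j; rw [wd_apply]; simp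

theorem wd_anti (a b : Fin 5 → F) : wd a b = - wd b a := by
  ext i j; simp [wd_apply]

def Dec (X : Alt F) : Prop := ∃ u v, X = wd u v

def St (a : Fin 5 → F) : Submodule F (Alt F) := LinearMap.range (wd a)

theorem mem_St {a : Fin 5 → F} {X : Alt F} : X ∈ St a ↔ ∃ v, wd a v = X := Iff.rfl

/-- bilinear evaluation -/
def B (X : Alt F) (x y : Fin 5 → F) : F := x ⬝ᵥ (X.m *ᵥ y)

theorem B_wd (a b x y : Fin 5 → F) :
    B (wd a b) x y = (x ⬝ᵥ a) * (y ⬝ᵥ b) - (x ⬝ᵥ b) * (y ⬝ᵥ a) := by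
  have : (wd a b).m = vecMulVec a b - vecMulVec b a := by
    ext i j; simp [wd_apply, vecMulVec_apply]
  rw [B, this, sub_mulVec, vecMulVec_mulVec, vecMulVec_mulVec]
  simp [dotProduct_sub, dotProduct_smul, dotProduct_comm]
  ring

theorem B_add (X Y : Alt F) (x y) : B (X + Y) x y = B X x y + B Y x y := by
  simp [B, add_mulVec]
theorem B_sub (X Y : Alt F) (x y) : B (X - Y) x y = B X x y - B Y x y := by
  simp [B, sub_mulVec]
theorem B_smul (c : F) (X : Alt F) (x y) : B (c • X) x y = c * B X x y := by
  simp [B, smul_mulVec]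
theorem B_self (X : Alt F) (x) : B X x x = 0 := by
  simp only [B, dotProduct, mulVec, Fin.sum_univ_five, alt_diag X, alt_neg X 0 1, alt_neg X 0 2,
    alt_neg X 0 3, alt_neg X 0 4, alt_neg X 1 2, alt_neg X 1 3, alt_neg X 1 4,
    alt_neg X 2 3, alt_neg X 2 4, alt_neg X 3 4]
  ring
theorem B_anti (X : Alt F) (x y) : B X y x = - B X x y := by
  simp only [B, dotProduct, mulVec, Fin.sum_univ_five, alt_diag X, alt_neg X 0 1, alt_neg X 0 2,
    alt_neg X 0 3, alt_neg X 0 4, alt_neg X 1 2, alt_neg X 1 3, alt_neg X 1 4,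
    alt_neg X 2 3, alt_neg X 2 4, alt_neg X 3 4]
  ring

theorem Dec.pf {X : Alt F} (h : Dec X) (x y z w) :
    B X x y * B X z w - B X x z * B X y w + B X x w * B X y z = 0 := by
  obtain ⟨u, v, rfl⟩ := h
  simp only [B_wd]; ring

/-- dual frame -/
theorem exists_dual {b : Fin 5 → Fin 5 → F} (hb : LinearIndependent F b) :
    ∃ w : Fin 5 → Fin 5 → F, (∀ i j, w i ⬝ᵥ b j = if i = j then 1 else 0) ∧
      (∀ v : Fin 5 → F, v = ∑ i, (w i ⬝ᵥ v) • b i) ∧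
      ∀ X Y : Alt F, (∀ i j, i < j → B X (w i) (w j) = B Y (w i) (w j)) → X = Y := by
  have hu : IsUnit (Matrix.of b) := by
    rw [← Matrix.linearIndependent_rows_iff_isUnit]; exact hb
  obtain ⟨U, hU⟩ := hu
  -- rows of U are b
  have h1 : (U.1 : Matrix _ _ F) * (U⁻¹).1 = 1 := U.mul_inv
  have h2 : (U⁻¹).1 * (U.1 : Matrix _ _ F) = 1 := U.inv_mul
  set V : Matrix (Fin 5) (Fin 5) F := (U⁻¹).1
  rw [hU] at h1 h2
  refine ⟨fun i => Vᵀ i, ?_, ?_, ?_⟩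
  · intro i j
    have := congrFun (congrFun h1 j) i
    rw [Matrix.mul_apply] at this
    simp only [dotProduct, transpose_apply]
    simp only [Matrix.one_apply, eq_comm (a := j)] at this
    rw [← this]
    exact Finset.sum_congr rfl fun k _ => mul_comm _ _
  · intro v
    have : v = v ᵥ* (V * Matrix.of b) := by rw [h2, vecMul_one]
    conv_lhs => rw [this, ← vecMul_vecMul]
    ext k
    simp [vecMul, dotProduct, mul_comm]
  · intro X Y h
    have key : ∀ X : Alt F, ∀ i j, (Vᵀ * X.m * V) i j = B X (Vᵀ i) (Vᵀ j) := by
      intro X i j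
      rw [Matrix.mul_assoc, Matrix.mul_apply]
      rfl
    have e : Vᵀ * X.m * V = Vᵀ * Y.m * V := by
      ext i j
      rw [key, key]
      rcases lt_trichotomy i j with hij | rfl | hij
      · exact h _ _ hij
      · rw [B_self, B_self]
      · rw [B_anti X, B_anti Y, h _ _ hij]
    have h3 : (Matrix.of b)ᵀ * Vᵀ = 1 := by rw [← transpose_mul, h2, transpose_one]
    have hrec : ∀ Z : Matrix (Fin 5) (Fin 5) F, Z = (Matrix.of b)ᵀ * (Vᵀ * Z * V) * (Matrix.of b) := by
      intro Z
      calc Z = ((Matrix.of b)ᵀ * Vᵀ) * Z * (V * Matrix.of b) := by rw [h3, h2]; simp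
        _ = _ := by simp only [Matrix.mul_assoc]
    apply Subtype.ext
    change X.m = Y.m
    rw [hrec X.m, hrec Y.m, e]

theorem ext2 {p q : Fin 5 → F} (h : LinearIndependent F ![p, q]) :
    ∃ x, LinearIndependent F ![x, p, q] := by
  obtain ⟨x, hx⟩ := exists_linearIndependent_cons_of_lt_finrank h (by simp)
  exact ⟨x, hx⟩
theorem ext3 {p q r : Fin 5 → F} (h : LinearIndependent F ![p, q, r]) :
    ∃ x, LinearIndependent F ![x, p, q, r] := by
  obtain ⟨x, hx⟩ := exists_linearIndependent_cons_of_lt_finrank h (by simp)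
  exact ⟨x, hx⟩
theorem ext4 {p q r s : Fin 5 → F} (h : LinearIndependent F ![p, q, r, s]) :
    ∃ x, LinearIndependent F ![x, p, q, r, s] := by
  obtain ⟨x, hx⟩ := exists_linearIndependent_cons_of_lt_finrank h (by simp)
  exact ⟨x, hx⟩
theorem ext1 {p : Fin 5 → F} (h : p ≠ 0) :
    ∃ x, LinearIndependent F ![x, p] := by
  obtain ⟨x, hx⟩ := exists_linearIndependent_cons_of_lt_finrank
    (show LinearIndependent F ![p] by simpa using h) (by simp)
  exact ⟨x, hx⟩

end AFG


namespace AFG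
variable {F : Type*} [Field F]

theorem li_pair_of_wd {p q : Fin 5 → F} (h : wd p q ≠ 0) : LinearIndependent F ![p, q] := by
  rw [LinearIndependent.pair_iff]
  intro s t hst
  have h1 : t • wd p q = 0 := by
    have : wd p (s • p + t • q) = 0 := by rw [hst, map_zero]
    simpa [map_add, map_smul, wd_self] using this
  have h2 : s • wd p q = 0 := by
    have : wd (s • p + t • q) q = 0 := by rw [hst, map_zero, LinearMap.zero_apply]
    simpa [map_add, map_smul, wd_self] using this
  exact ⟨(smul_eq_zero.1 h2).resolve_right h, (smul_eq_zero.1 h1).resolve_right h⟩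

theorem li_swap {p q : Fin 5 → F} (h : LinearIndependent F ![p, q]) : LinearIndependent F ![q, p] := by
  rw [LinearIndependent.pair_iff] at *
  intro s t hst
  exact (h t s (by rw [add_comm]; exact hst)).symm

theorem exists_dual2 {p q : Fin 5 → F} (h : LinearIndependent F ![p, q]) :
    ∃ x y z, LinearIndependent F ![x, y, z, p, q] := by
  obtain ⟨z, hz⟩ := ext2 h
  obtain ⟨y, hy⟩ := ext3 hz
  obtain ⟨x, hx⟩ := ext4 hy
  exact ⟨x, y, z, hx⟩

theorem exists_dual3 {p q r : Fin 5 → F} (h : LinearIndependent F ![p, q, r]) :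
    ∃ x y, LinearIndependent F ![x, y, p, q, r] := by
  obtain ⟨y, hy⟩ := ext3 h
  obtain ⟨x, hx⟩ := ext4 hy
  exact ⟨x, y, hx⟩

theorem wd_ne_of_li {p q : Fin 5 → F} (h : LinearIndependent F ![p, q]) : wd p q ≠ 0 := by
  obtain ⟨x, y, z, hb⟩ := exists_dual2 h
  obtain ⟨w, hw, -, -⟩ := exists_dual hb
  intro h0
  have h1 : B (wd p q) (w 3) (w 4) = 1 := by
    have a1 := hw 3 3
    have a2 := hw 3 4
    have a3 := hw 4 3
    have a4 := hw 4 4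
    simp at a1 a2 a3 a4
    rw [B_wd, a1, a2, a3, a4]; ring
  rw [h0] at h1
  simp [B] at h1

theorem wd_mulVec (a b w : Fin 5 → F) :
    (wd a b).m *ᵥ w = (w ⬝ᵥ b) • a - (w ⬝ᵥ a) • b := by
  have : (wd a b).m = vecMulVec a b - vecMulVec b a := by
    ext i j; simp [wd_apply, vecMulVec_apply]
  rw [this, sub_mulVec, vecMulVec_mulVec, vecMulVec_mulVec]
  simp [dotProduct_comm]

theorem star_inter2 {p q : Fin 5 → F} (h : LinearIndependent F ![p, q]) {X : Alt F}
    (h1 : X ∈ St p) (h2 : X ∈ St q) : ∃ c : F, X = c • wd p q := by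
  obtain ⟨x, y, z, hb⟩ := exists_dual2 h
  obtain ⟨w, hw, -, -⟩ := exists_dual hb
  obtain ⟨u, rfl⟩ := h1
  obtain ⟨v, hv⟩ := h2
  have P : w 4 ⬝ᵥ p = 0 := hw 4 3
  have Q : w 4 ⬝ᵥ q = 1 := hw 4 4
  have e : (wd p u).m *ᵥ w 4 = (wd q v).m *ᵥ w 4 := by rw [hv]
  rw [wd_mulVec, wd_mulVec, P, Q, zero_smul, one_smul, sub_zero] at e
  have e2 : v = (w 4 ⬝ᵥ v) • q - (w 4 ⬝ᵥ u) • p := by rw [e]; abel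
  refine ⟨w 4 ⬝ᵥ u, ?_⟩
  rw [← hv, e2, map_sub, map_smul, map_smul, wd_self, wd_anti p q]
  simp

theorem star_inter3 {p q r : Fin 5 → F} (h : LinearIndependent F ![p, q, r]) {X : Alt F}
    (h1 : X ∈ St p) (h2 : X ∈ St q) (h3 : X ∈ St r) : X = 0 := by
  obtain ⟨x, y, hb⟩ := exists_dual3 h
  obtain ⟨w, hw, -, hX⟩ := exists_dual hb
  have hpq : LinearIndependent F ![p, q] := by
    have := hb.comp ![2, 3] (by decide)
    convert this using 1
    ext i; fin_cases i <;> rfl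
  obtain ⟨c, rfl⟩ := star_inter2 hpq h1 h2
  obtain ⟨t, ht⟩ := h3
  have e : B (c • wd p q) (w 2) (w 3) = B (wd r t) (w 2) (w 3) := by rw [ht]
  have a1 : w 2 ⬝ᵥ p = 1 := hw 2 2
  have a2 : w 2 ⬝ᵥ q = 0 := hw 2 3
  have a3 : w 2 ⬝ᵥ r = 0 := hw 2 4
  have a4 : w 3 ⬝ᵥ p = 0 := hw 3 2
  have a5 : w 3 ⬝ᵥ q = 1 := hw 3 3
  have a6 : w 3 ⬝ᵥ r = 0 := hw 3 4
  rw [B_smul, B_wd, B_wd, a1, a2, a3, a4, a5, a6] at e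
  have : c = 0 := by linear_combination e
  rw [this, zero_smul]

theorem mem_St_of_span {a b p : Fin 5 → F} (s t : F) (hp : p = s • a + t • b) (h0 : p ≠ 0) :
    wd a b ∈ St p := by
  by_cases hs : s = 0
  · have ht : t ≠ 0 := by rintro rfl; simp [hs] at hp; exact h0 hp
    refine ⟨-(t⁻¹ • a), ?_⟩
    rw [hp, hs]
    simp only [zero_smul, zero_add, map_neg, map_smul, LinearMap.smul_apply]
    rw [smul_smul, inv_mul_cancel₀ ht, one_smul, wd_anti a b]
  · refine ⟨s⁻¹ • b, ?_⟩
    rw [hp]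
    simp only [map_add, map_smul, LinearMap.smul_apply, LinearMap.add_apply, wd_self, smul_zero, add_zero]
    rw [smul_smul, inv_mul_cancel₀ hs, one_smul]

theorem li3_iff {p q r : Fin 5 → F} : LinearIndependent F ![p, q, r] ↔
    ∀ a b c : F, a • p + b • q + c • r = 0 → a = 0 ∧ b = 0 ∧ c = 0 := by
  rw [Fintype.linearIndependent_iff]
  constructor
  · intro h a b c habc
    have := h ![a, b, c] (by simpa [Fin.sum_univ_three] using habc)
    exact ⟨this 0, this 1, this 2⟩
  · intro h g hg
    have := h (g 0) (g 1) (g 2) (by simpa [Fin.sum_univ_three] using hg)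
    intro i
    match i with
    | 0 => exact this.1
    | 1 => exact this.2.1
    | 2 => exact this.2.2

theorem li3_of {p q r : Fin 5 → F} (h : wd p q ≠ 0) (h' : ∀ c : F, wd p r ≠ c • wd p q) :
    LinearIndependent F ![p, q, r] := by
  rw [li3_iff]
  intro a b c hg
  have h1 : b • wd p q + c • wd p r = 0 := by
    have : wd p (a • p + b • q + c • r) = 0 := by rw [hg, map_zero]
    simpa [map_add, map_smul, wd_self] using this
  have g2 : c = 0 := by
    by_contra hne
    apply h' (-(c⁻¹ * b))
    have : wd p r = c⁻¹ • (b • wd p q + c • wd p r) - (c⁻¹ * b) • wd p q := by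
      rw [smul_add, smul_smul, smul_smul, inv_mul_cancel₀ hne]; simp
    rw [this, h1, neg_smul]; simp
  rw [g2, zero_smul, add_zero] at hg
  have h5 := li_pair_of_wd h
  rw [LinearIndependent.pair_iff] at h5
  have := h5 a b hg
  exact ⟨this.1, this.2, g2⟩

theorem share {A C : Alt F} (hA : Dec A) (hC : Dec C) (hAC : Dec (C - A)) (h0 : A ≠ 0)
    (hne : ∀ c : F, C ≠ c • A) :
    ∃ p q r, LinearIndependent F ![p, q, r] ∧ A = wd p q ∧ C = wd p r := by
  obtain ⟨a, b, rfl⟩ := hA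
  obtain ⟨x, y, z, hb⟩ := exists_dual2 (li_pair_of_wd h0)
  obtain ⟨w, hw, hex, hX⟩ := exists_dual hb
  have P : ∀ i, w i ⬝ᵥ a = if i = 3 then 1 else 0 := fun i => hw i 3
  have Q : ∀ i, w i ⬝ᵥ b = if i = 4 then 1 else 0 := fun i => hw i 4
  have f1 : ∀ i j, i < 3 → j < 3 → B C (w i) (w j) = 0 := by
    intro i j hi hj
    have e1 := hC.pf (w i) (w j) (w 3) (w 4)
    have e2 := hAC.pf (w i) (w j) (w 3) (w 4)
    have n1 : i ≠ 3 := by rintro rfl; simp at hi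
    have n2 : j ≠ 3 := by rintro rfl; simp at hj
    have n3 : i ≠ 4 := by rintro rfl; revert hi; decide
    have n4 : j ≠ 4 := by rintro rfl; revert hj; decide
    simp [B_sub, B_wd, P, Q, n1, n2, n3, n4] at e2
    linear_combination e1 - e2
  -- find nonzero
  have : ∃ i, i < 3 ∧ ¬ (B C (w 3) (w i) = 0 ∧ B C (w 4) (w i) = 0) := by
    by_contra hcon
    push Not at hcon
    apply hne (B C (w 3) (w 4))
    refine hX _ _ fun i j hij => ?_
    rw [B_smul, B_wd, P, Q, P, Q]
    have f2 : ∀ i, i < 3 → B C (w i) (w 3) = 0 := fun i hi => by rw [B_anti, (hcon i hi).1, neg_zero]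
    have f3 : ∀ i, i < 3 → B C (w i) (w 4) = 0 := fun i hi => by rw [B_anti, (hcon i hi).2, neg_zero]
    by_cases hi : i < 3
    · have n1 : i ≠ 3 := by rintro rfl; simp at hi
      have n3 : i ≠ 4 := by rintro rfl; revert hi; decide
      simp only [n1, n3, if_false]
      by_cases hj : j < 3
      · rw [f1 _ _ hi hj]; ring
      · have : j = 3 ∨ j = 4 := by omega
        rcases this with rfl | rfl
        · rw [f2 _ hi]; ring
        · rw [f3 _ hi]; ring
    · have : i = 3 ∧ j = 4 := by omega
      obtain ⟨rfl, rfl⟩ := this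
      simp
  obtain ⟨i, hi, hne0⟩ := this
  have hpe : (C.m *ᵥ w i) = B C (w 3) (w i) • a + B C (w 4) (w i) • b := by
    have := hex (C.m *ᵥ w i)
    have b1 : w 0 ⬝ᵥ (C.m *ᵥ w i) = 0 := f1 0 i (by decide) hi
    have b2 : w 1 ⬝ᵥ (C.m *ᵥ w i) = 0 := f1 1 i (by decide) hi
    have b3 : w 2 ⬝ᵥ (C.m *ᵥ w i) = 0 := f1 2 i (by decide) hi
    rw [Fin.sum_univ_five, b1, b2, b3] at this
    simp only [zero_smul, zero_add] at this
    exact this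
  set p := C.m *ᵥ w i with hp
  have hp0 : p ≠ 0 := by
    intro h
    apply hne0
    change w 3 ⬝ᵥ p = 0 ∧ w 4 ⬝ᵥ p = 0
    rw [h]; simp
  obtain ⟨q, hq⟩ := mem_St_of_span _ _ hpe hp0
  obtain ⟨c, d, rfl⟩ := hC
  obtain ⟨r, hr⟩ := mem_St_of_span (a := c) (b := d) (p := p) (w i ⬝ᵥ d) (-(w i ⬝ᵥ c))
    (by rw [hp, wd_mulVec, neg_smul, sub_eq_add_neg]) hp0
  exact ⟨p, q, r, li3_of (by rw [hq]; exact h0) (by rw [hr, hq]; exact hne), hq.symm, hr.symm⟩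

end AFG


namespace AFG
variable {F : Type*} [Field F]

set_option linter.unusedSimpArgs false

theorem B_neg (X : Alt F) (x y) : B (-X) x y = - B X x y := by
  simp [B, neg_mulVec]

/-- element of the exterior square of a 3-space -/
def tri (p q r : Fin 5 → F) (c : Fin 3 → F) : Alt F := c 0 • wd p q + c 1 • wd p r + c 2 • wd q r

theorem five_pairs {R : Fin 5 → Fin 5 → Prop} (h01 : R 0 1) (h02 : R 0 2) (h03 : R 0 3) (h04 : R 0 4)
    (h12 : R 1 2) (h13 : R 1 3) (h14 : R 1 4) (h23 : R 2 3) (h24 : R 2 4) (h34 : R 3 4) :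
    ∀ i j, i < j → R i j := by
  intro i j hij
  fin_cases i <;> fin_cases j <;> first | assumption | exact absurd hij (by decide)

theorem trip {p q r : Fin 5 → F} (h : LinearIndependent F ![p, q, r]) {C : Alt F} (hC : Dec C)
    (h1 : Dec (C - wd p q)) (h2 : Dec (C - wd p r)) : C ∈ St p ∨ ∃ c, C = tri p q r c := by
  obtain ⟨x, y, hb⟩ := exists_dual3 h
  obtain ⟨w, hw, -, hX⟩ := exists_dual hb
  have X : ∀ i, w i ⬝ᵥ x = if i = 0 then 1 else 0 := fun i => hw i 0
  have Y : ∀ i, w i ⬝ᵥ y = if i = 1 then 1 else 0 := fun i => hw i 1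
  have P : ∀ i, w i ⬝ᵥ p = if i = 2 then 1 else 0 := fun i => hw i 2
  have Q : ∀ i, w i ⬝ᵥ q = if i = 3 then 1 else 0 := fun i => hw i 3
  have R : ∀ i, w i ⬝ᵥ r = if i = 4 then 1 else 0 := fun i => hw i 4
  have c01 : B C (w 0) (w 1) = 0 := by
    have e1 := hC.pf (w 0) (w 1) (w 2) (w 3)
    have e2 := h1.pf (w 0) (w 1) (w 2) (w 3)
    simp [B_sub, B_wd, P, Q] at e2
    linear_combination e1 - e2
  have c04 : B C (w 0) (w 4) = 0 := by
    have e1 := hC.pf (w 0) (w 4) (w 2) (w 3)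
    have e2 := h1.pf (w 0) (w 4) (w 2) (w 3)
    simp [B_sub, B_wd, P, Q] at e2
    linear_combination e1 - e2
  have c14 : B C (w 1) (w 4) = 0 := by
    have e1 := hC.pf (w 1) (w 4) (w 2) (w 3)
    have e2 := h1.pf (w 1) (w 4) (w 2) (w 3)
    simp [B_sub, B_wd, P, Q] at e2
    linear_combination e1 - e2
  have c03 : B C (w 0) (w 3) = 0 := by
    have e1 := hC.pf (w 0) (w 3) (w 2) (w 4)
    have e2 := h2.pf (w 0) (w 3) (w 2) (w 4)
    simp [B_sub, B_wd, P, R] at e2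
    linear_combination e1 - e2
  have c13 : B C (w 1) (w 3) = 0 := by
    have e1 := hC.pf (w 1) (w 3) (w 2) (w 4)
    have e2 := h2.pf (w 1) (w 3) (w 2) (w 4)
    simp [B_sub, B_wd, P, R] at e2
    linear_combination e1 - e2
  have d0 := hC.pf (w 0) (w 2) (w 3) (w 4)
  have d1 := hC.pf (w 1) (w 2) (w 3) (w 4)
  rw [c03, c04] at d0
  rw [c13, c14] at d1
  by_cases hz : B C (w 3) (w 4) = 0
  · left
    refine ⟨B C (w 2) (w 0) • x + B C (w 2) (w 1) • y + B C (w 2) (w 3) • q + B C (w 2) (w 4) • r, hX _ _ ?_⟩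
    apply five_pairs <;>
    simp [B_wd, map_add, map_smul, B_add, B_smul, X, Y, P, Q, R, c01, c03, c04, c13, c14, hz, B_anti C (w 2)]
  · right
    have c02 : B C (w 0) (w 2) = 0 := by
      have : B C (w 0) (w 2) * B C (w 3) (w 4) = 0 := by linear_combination d0
      exact (mul_eq_zero.1 this).resolve_right hz
    have c12 : B C (w 1) (w 2) = 0 := by
      have : B C (w 1) (w 2) * B C (w 3) (w 4) = 0 := by linear_combination d1
      exact (mul_eq_zero.1 this).resolve_right hz
    refine ⟨![B C (w 2) (w 3), B C (w 2) (w 4), B C (w 3) (w 4)], hX _ _ ?_⟩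
    apply five_pairs <;>
    simp [tri, B_wd, map_add, map_smul, B_add, B_smul, X, Y, P, Q, R, c01, c02, c03, c04, c12, c13, c14]

theorem tri_star {p q r : Fin 5 → F} (h : LinearIndependent F ![p, q, r]) {s : Fin 5 → F}
    (hs : ∀ c, wd p s ≠ tri p q r c) {c : Fin 3 → F} (hc : Dec (tri p q r c - wd p s)) :
    tri p q r c ∈ St p := by
  obtain ⟨x, y, hb⟩ := exists_dual3 h
  obtain ⟨w, hw, hex, hX⟩ := exists_dual hb
  have P : ∀ i, w i ⬝ᵥ p = if i = 2 then 1 else 0 := fun i => hw i 2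
  have Q : ∀ i, w i ⬝ᵥ q = if i = 3 then 1 else 0 := fun i => hw i 3
  have R : ∀ i, w i ⬝ᵥ r = if i = 4 then 1 else 0 := fun i => hw i 4
  by_cases hz : c 2 = 0
  · refine ⟨c 0 • q + c 1 • r, ?_⟩
    simp [tri, hz]
  · exfalso
    have e1 := hc.pf (w 0) (w 2) (w 3) (w 4)
    have e2 := hc.pf (w 1) (w 2) (w 3) (w 4)
    simp [tri, B_sub, B_add, B_smul, B_wd, P, Q, R, hz] at e1 e2
    have e3 := hex s
    rw [Fin.sum_univ_five, e1, e2] at e3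
    simp only [zero_smul, zero_add] at e3
    apply hs ![w 3 ⬝ᵥ s, w 4 ⬝ᵥ s, 0]
    conv_lhs => rw [e3]
    simp [tri, map_add, map_smul, wd_self]

theorem exists_out [Fintype F] {T : Set (Alt F)} (hT : Nat.card T = Nat.card F ^ 4)
    (g : (Fin 3 → F) → Alt F) : ∃ X ∈ T, ∀ c, X ≠ g c := by
  by_contra hcon
  push Not at hcon
  have hsub : T ⊆ Set.range g := fun X hX => by
    obtain ⟨c, hc⟩ := hcon X hX
    exact ⟨c, hc.symm⟩
  have h1 : Nat.card T ≤ Nat.card (Set.range g) := Nat.card_mono (Set.toFinite _) hsub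
  have h2 : Nat.card (Set.range g) ≤ Nat.card (Fin 3 → F) := Finite.card_range_le g
  have h3 : Nat.card (Fin 3 → F) = Nat.card F ^ 3 := by simp [Nat.card_fun]
  have h4 : Nat.card F ^ 3 < Nat.card F ^ 4 :=
    Nat.pow_lt_pow_right Finite.one_lt_card (by norm_num)
  omega

theorem card_St [Fintype F] {a : Fin 5 → F} (ha : a ≠ 0) : Nat.card (St a) = Nat.card F ^ 4 := by
  have h1 := LinearMap.finrank_range_add_finrank_ker (wd a)
  have h2 : LinearMap.ker (wd a) = Submodule.span F {a} := by
    ext v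
    rw [LinearMap.mem_ker, Submodule.mem_span_singleton]
    constructor
    · intro hv
      by_contra hcon
      push Not at hcon
      exact wd_ne_of_li ((LinearIndependent.pair_iff' ha).2 hcon) hv
    · rintro ⟨c, rfl⟩
      rw [map_smul, wd_self, smul_zero]
  rw [h2, finrank_span_singleton ha] at h1
  simp only [Module.finrank_fin_fun] at h1
  have h3 : Module.finrank F (St a) = 4 := by
    change Module.finrank F (LinearMap.range (wd a)) = 4
    omega
  have : Module.Finite F (St a) := by
    change Module.Finite F (LinearMap.range (wd a)); infer_instance
  rw [Module.natCard_eq_pow_finrank (K := F), h3]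

theorem classify [Fintype F] {T : Set (Alt F)} (hT : Nat.card T = Nat.card F ^ 4) (h0 : (0 : Alt F) ∈ T)
    (hd : ∀ X ∈ T, ∀ Y ∈ T, Dec (X - Y)) : ∃ p : Fin 5 → F, p ≠ 0 ∧ T = (St p : Set (Alt F)) := by
  have hd0 : ∀ X ∈ T, Dec X := fun X hX => by simpa using hd X hX 0 h0
  obtain ⟨A, hA, hA0⟩ := exists_out hT (fun _ => 0)
  have hA0 := hA0 0
  obtain ⟨C, hC, hCA⟩ := exists_out hT (fun c => c 0 • A)
  obtain ⟨p, q, r, hli, rfl, rfl⟩ := share (hd0 A hA) (hd0 C hC) (hd _ hC _ hA) hA0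
    (fun c => hCA (fun _ => c))
  obtain ⟨E, hE, hE'⟩ := exists_out hT (tri p q r)
  have hES : E ∈ St p := by
    rcases trip hli (hd0 E hE) (hd _ hE _ hA) (hd _ hE _ hC) with h | ⟨c, hc⟩
    · exact h
    · exact absurd hc (hE' c)
  obtain ⟨s, rfl⟩ := hES
  have hsub : T ⊆ (St p : Set (Alt F)) := by
    intro D hD
    rcases trip hli (hd0 D hD) (hd _ hD _ hA) (hd _ hD _ hC) with h | ⟨c, rfl⟩
    · exact h
    · exact tri_star hli hE' (hd _ hD _ hE)
  have hp : p ≠ 0 := by rintro rfl; simp at hA0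
  refine ⟨p, hp, ?_⟩
  apply Set.eq_of_subset_of_ncard_le hsub _ (Set.toFinite _)
  have := card_St hp
  rw [← Nat.card_coe_set_eq, ← Nat.card_coe_set_eq, hT]
  exact this.le

theorem lemM {p p' : Fin 5 → F} (h : LinearIndependent F ![p, p']) {A : Alt F}
    (hA : ∀ s, ∃ t, Dec (A + wd p s + wd p' t)) : ∃ s t, A = wd p s + wd p' t := by
  obtain ⟨x, y, z, hb⟩ := exists_dual2 h
  obtain ⟨w, hw, -, hX⟩ := exists_dual hb
  have X : ∀ i, w i ⬝ᵥ x = if i = 0 then 1 else 0 := fun i => hw i 0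
  have Y : ∀ i, w i ⬝ᵥ y = if i = 1 then 1 else 0 := fun i => hw i 1
  have Z : ∀ i, w i ⬝ᵥ z = if i = 2 then 1 else 0 := fun i => hw i 2
  have P : ∀ i, w i ⬝ᵥ p = if i = 3 then 1 else 0 := fun i => hw i 3
  have Q : ∀ i, w i ⬝ᵥ p' = if i = 4 then 1 else 0 := fun i => hw i 4
  have e0 : B A (w 0) (w 1) * B A (w 2) (w 3) - B A (w 0) (w 2) * B A (w 1) (w 3)
      + B A (w 0) (w 3) * B A (w 1) (w 2) = 0 := by
    obtain ⟨t, ht⟩ := hA 0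
    have := ht.pf (w 0) (w 1) (w 2) (w 3)
    simpa [B_add, B_wd, P, Q] using this
  have e1 : B A (w 1) (w 2) = 0 := by
    obtain ⟨t, ht⟩ := hA x
    have := ht.pf (w 0) (w 1) (w 2) (w 3)
    simp [B_add, B_wd, P, Q, X] at this
    linear_combination e0 - this
  have e2 : B A (w 0) (w 2) = 0 := by
    obtain ⟨t, ht⟩ := hA y
    have := ht.pf (w 0) (w 1) (w 2) (w 3)
    simp [B_add, B_wd, P, Q, Y] at this
    linear_combination this - e0
  have e3 : B A (w 0) (w 1) = 0 := by
    obtain ⟨t, ht⟩ := hA z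
    have := ht.pf (w 0) (w 1) (w 2) (w 3)
    simp [B_add, B_wd, P, Q, Z] at this
    linear_combination e0 - this
  refine ⟨B A (w 3) (w 0) • x + B A (w 3) (w 1) • y + B A (w 3) (w 2) • z + B A (w 3) (w 4) • p',
    B A (w 4) (w 0) • x + B A (w 4) (w 1) • y + B A (w 4) (w 2) • z, hX _ _ ?_⟩
  have a1 := fun i => B_anti A (w i) (w 3)
  have a2 := fun i => B_anti A (w i) (w 4)
  apply five_pairs <;>
  simp [B_wd, map_add, map_smul, B_add, B_smul, X, Y, Z, P, Q, e1, e2, e3, B_neg, a1 0, a1 1, a1 2, a2 0, a2 1, a2 2]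

theorem rank_iff {X : Alt F} (h0 : X ≠ 0) : X.m.rank = 2 ↔ Dec X := by
  obtain ⟨i, j, hij⟩ : ∃ i j, X.m i j ≠ 0 := by
    by_contra hcon
    push Not at hcon
    exact h0 (alt_ext fun i j => hcon i j)
  have hli : LinearIndependent F ![X.m.col i, X.m.col j] := by
    rw [LinearIndependent.pair_iff]
    intro s t hst
    have h1 := congrFun hst i
    have h2 := congrFun hst j
    simp [Matrix.col, alt_diag] at h1 h2
    rw [alt_neg X i j] at h2
    simp [hij] at h1 h2
    exact ⟨h2, h1⟩
  have hsub : Submodule.span F (Set.range ![X.m.col i, X.m.col j]) ≤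
      Submodule.span F (Set.range X.m.col) := by
    apply Submodule.span_mono
    rintro _ ⟨k, rfl⟩
    fin_cases k
    · exact ⟨i, rfl⟩
    · exact ⟨j, rfl⟩
  have hfr : Module.finrank F (Submodule.span F (Set.range ![X.m.col i, X.m.col j])) = 2 := by
    rw [finrank_span_eq_card hli]; simp
  constructor
  · intro hr
    rw [Matrix.rank_eq_finrank_span_cols] at hr
    have heq := Submodule.eq_of_le_of_finrank_eq hsub (by rw [hfr, hr])
    refine ⟨X.m.col i, (X.m i j)⁻¹ • X.m.col j, ?_⟩
    ext l k
    have hk : X.m.col k ∈ Submodule.span F (Set.range ![X.m.col i, X.m.col j]) := by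
      rw [heq]; exact Submodule.subset_span ⟨k, rfl⟩
    rw [Matrix.range_cons_cons_empty, Submodule.mem_span_pair] at hk
    obtain ⟨s, t, hst⟩ := hk
    have h1 := congrFun hst i
    have h2 := congrFun hst j
    have h3 := congrFun hst l
    simp [Matrix.col, alt_diag] at h1 h2 h3
    rw [alt_neg X i j] at h2
    rw [wd_apply]
    simp only [Matrix.col, Pi.neg_apply, Pi.smul_apply, smul_eq_mul, transpose_apply]
    rw [← h3, alt_neg X i k, alt_neg X j k, ← h1, ← h2]
    field_simp
    ring
  · rintro ⟨u, v, huv⟩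
    apply le_antisymm
    · have h1 : Submodule.span F (Set.range X.m.col) ≤ Submodule.span F (Set.range ![u, v]) := by
        rw [Submodule.span_le]
        rintro _ ⟨k, rfl⟩
        rw [Matrix.range_cons_cons_empty, SetLike.mem_coe, Submodule.mem_span_pair]
        refine ⟨v k, -u k, ?_⟩
        ext l
        simp [huv, Matrix.col, wd_apply]
        ring
      rw [Matrix.rank_eq_finrank_span_cols]
      refine (Submodule.finrank_mono h1).trans ?_
      have := finrank_range_le_card (R := F) ![u, v]
      simpa [Set.finrank] using this
    · rw [Matrix.rank_eq_finrank_span_cols, ← hfr]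
      exact Submodule.finrank_mono hsub

end AFG


namespace AFG
variable {F : Type*} [Field F]

theorem alt_sum (X : Alt F) : X = ∑ i : Fin 5, wd (Pi.single i 1) (fun j => if i < j then X.m i j else 0) := by
  ext k l
  rw [Fin.sum_univ_five]
  simp only [m_add, Matrix.add_apply, wd_apply]
  revert k l
  have h0 := alt_diag X
  have key : ∀ k l : Fin 5, ∑ i : Fin 5, ((Pi.single i 1 : Fin 5 → F) k * (if i < l then X.m i l else 0)
      - (if i < k then X.m i k else 0) * (Pi.single i 1 : Fin 5 → F) l) = X.m k l := by
    intro k l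
    have s1 : ∀ (g : Fin 5 → F) k, ∑ i, (Pi.single i 1 : Fin 5 → F) k * g i = g k := by
      intro g k; simp [Pi.single_apply]
    have s2 : ∀ (g : Fin 5 → F) k, ∑ i, g i * (Pi.single i 1 : Fin 5 → F) k = g k := by
      intro g k; simp [Pi.single_apply]
    rw [Finset.sum_sub_distrib, s1 (fun i => if i < l then X.m i l else 0) k,
      s2 (fun i => if i < k then X.m i k else 0) l]
    rcases lt_trichotomy k l with h | rfl | h
    · simp [h, h.not_gt]
    · simp [h0]
    · simp [h, h.not_gt, alt_neg X l k]
  intro k l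
  rw [← key k l, Fin.sum_univ_five]

theorem alt_induction {P : Alt F → Prop} (h0 : P 0) (hadd : ∀ X Y, P X → P Y → P (X + Y))
    (hd : ∀ u v, P (wd u v)) (X : Alt F) : P X := by
  rw [alt_sum X]
  exact Finset.sum_induction _ P hadd h0 fun i _ => hd _ _

theorem St_smul {c : F} (hc : c ≠ 0) (p : Fin 5 → F) : St (c • p) = St p := by
  ext X
  constructor
  · rintro ⟨v, rfl⟩
    exact ⟨c • v, by simp⟩
  · rintro ⟨v, rfl⟩
    exact ⟨c⁻¹ • v, by simp [smul_smul, hc]⟩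

theorem St_eq_of_not_li {p q : Fin 5 → F} (hp : p ≠ 0) (hq : q ≠ 0) (h : ¬ LinearIndependent F ![p, q]) :
    St q = St p := by
  rw [LinearIndependent.pair_iff' hp] at h
  push Not at h
  obtain ⟨c, rfl⟩ := h
  exact St_smul (by rintro rfl; simp at hq) p

theorem mem_St_right (a b : Fin 5 → F) : wd a b ∈ St b := ⟨-a, by rw [map_neg, wd_anti a b]⟩
theorem mem_St_left (a b : Fin 5 → F) : wd a b ∈ St a := ⟨b, rfl⟩
theorem dec_of_St {a : Fin 5 → F} {X : Alt F} (h : X ∈ St a) : Dec X := by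
  obtain ⟨v, rfl⟩ := h; exact ⟨a, v, rfl⟩

section
variable [Fintype F] {f : Alt F ≃ Alt F} (hf : ∀ X Y, Dec (f X - f Y) ↔ Dec (X - Y))
include hf

theorem star_img {a : Fin 5 → F} (ha : a ≠ 0) (X : Alt F) :
    ∃ p : Fin 5 → F, p ≠ 0 ∧ ∀ Y, Y - X ∈ St a ↔ f Y - f X ∈ St p := by
  let g : Alt F → Alt F := fun Z => f (X + Z) - f X
  have hg : Function.Injective g := by
    intro Z Z' h
    have : f (X + Z) = f (X + Z') := sub_left_injective h
    exact add_left_cancel (f.injective this)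
  obtain ⟨p, hp, hT⟩ := classify (T := g '' (St a : Set (Alt F)))
    (by rw [Nat.card_image_of_injective hg]; exact card_St ha)
    ⟨0, (St a).zero_mem, by simp [g]⟩
    (by
      rintro _ ⟨Z, hZ, rfl⟩ _ ⟨Z', hZ', rfl⟩
      have : g Z - g Z' = f (X + Z) - f (X + Z') := by simp only [g]; abel
      rw [this, hf]
      have : X + Z - (X + Z') = Z - Z' := by abel
      rw [this]
      exact dec_of_St ((St a).sub_mem hZ hZ'))
  refine ⟨p, hp, fun Y => ?_⟩
  have e : f Y - f X = g (Y - X) := by simp [g]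
  have : f Y - f X ∈ (St p : Set (Alt F)) ↔ Y - X ∈ (St a : Set (Alt F)) := by
    rw [← hT, e, hg.mem_set_image]
  exact this.symm

theorem sigma_step {a : Fin 5 → F} (ha : a ≠ 0) {p : Fin 5 → F} (hp : p ≠ 0) (A : Alt F) : ∀ X : Alt F,
    (∀ Y, Y - X ∈ St a ↔ f Y - f X ∈ St p) → (∀ Y, Y - (X + A) ∈ St a ↔ f Y - f (X + A) ∈ St p) := by
  induction A using alt_induction with
  | h0 => intro X h; simpa using h
  | hadd A A' h1 h2 => 
    intro X h
    have := h2 (X + A) (h1 X h)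
    rwa [add_assoc] at this
  | hd u v =>
    intro X h
    obtain ⟨p', hp', h'⟩ := star_img hf ha (X + wd u v)
    by_cases hin : wd u v ∈ St a
    · intro Y
      have e1 : f (X + wd u v) - f X ∈ St p := by rw [← h]; simpa using hin
      have e2 : Y - (X + wd u v) = (Y - X) - wd u v := by abel
      have e3 : f Y - f (X + wd u v) = (f Y - f X) - (f (X + wd u v) - f X) := by abel
      rw [e2, e3, Submodule.sub_mem_iff_left _ hin, Submodule.sub_mem_iff_left _ e1, h]
    · suffices hs : St p' = St p by rw [← hs]; exact h'
      apply St_eq_of_not_li hp hp'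
      intro hli
      obtain ⟨s, t, hst⟩ := lemM hli (A := f (X + wd u v) - f X) (by
        intro s
        have h3 : f.symm (f X - wd p s) - X ∈ St a := by
          rw [h, Equiv.apply_symm_apply]
          exact ⟨-s, by simp⟩
        set Y := f.symm (f X - wd p s) with hY
        have h4 : f (Y + wd u v) - f (X + wd u v) ∈ St p' := by
          rw [← h']; simpa using h3
        obtain ⟨t, ht⟩ := h4
        refine ⟨t, ?_⟩
        have h5 : Dec (f (Y + wd u v) - f Y) := by rw [hf]; exact ⟨u, v, by simp⟩
        have h6 : f Y = f X - wd p s := by rw [hY, Equiv.apply_symm_apply]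
        have : f (X + wd u v) - f X + wd p s + wd p' t = f (Y + wd u v) - f Y := by
          rw [ht, h6]; abel
        rw [this]; exact h5)
      apply hin
      have h1 : f.symm (f X + wd p s) - X ∈ St a := by
        rw [h, Equiv.apply_symm_apply]
        exact ⟨s, by simp⟩
      have h2 : f.symm (f X + wd p s) - (X + wd u v) ∈ St a := by
        rw [h', Equiv.apply_symm_apply]
        refine ⟨-t, ?_⟩
        have : f (X + wd u v) = f X + (wd p s + wd p' t) := by rw [← hst]; abel
        rw [this, map_neg]; abel
      have := (St a).sub_mem h1 h2
      have e : f.symm (f X + wd p s) - X - (f.symm (f X + wd p s) - (X + wd u v)) = wd u v := by abel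
      rwa [e] at this

theorem sigma_ex (a : Fin 5 → F) : ∃ p : Fin 5 → F, a ≠ 0 → p ≠ 0 ∧ ∀ X Y, Y - X ∈ St a ↔ f Y - f X ∈ St p := by
  by_cases ha : a = 0
  · exact ⟨0, fun h => absurd ha h⟩
  · obtain ⟨p, hp, h⟩ := star_img hf ha 0
    refine ⟨p, fun _ => ⟨hp, fun X => ?_⟩⟩
    have := sigma_step hf ha hp X 0 h
    simpa using this

end

/-- `s` is the induced map on points -/
def Ind (f : Alt F ≃ Alt F) (s : (Fin 5 → F) → (Fin 5 → F)) : Prop :=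
  ∀ a, a ≠ 0 → s a ≠ 0 ∧ ∀ X Y, Y - X ∈ St a ↔ f Y - f X ∈ St (s a)

theorem li3_cons {a b c : Fin 5 → F} : LinearIndependent F ![c, a, b] ↔
    LinearIndependent F ![a, b] ∧ c ∉ Submodule.span F {a, b} := by
  have := linearIndependent_finCons (K := F) (x := c) (v := ![a, b])
  rw [Matrix.range_cons_cons_empty] at this
  exact this

theorem li_ne {a b : Fin 5 → F} (h : LinearIndependent F ![a, b]) : a ≠ 0 ∧ b ≠ 0 :=
  ⟨h.ne_zero 0, h.ne_zero 1⟩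

theorem li3_ne {a b c : Fin 5 → F} (h : LinearIndependent F ![c, a, b]) : c ≠ 0 := h.ne_zero 0

variable {f : Alt F ≃ Alt F} {s : (Fin 5 → F) → (Fin 5 → F)} (hs : Ind f s)
include hs

theorem D_zero {a b c : Fin 5 → F} (h : LinearIndependent F ![c, a, b]) (d : Fin 5 → F) (Y : Alt F) :
    f (Y + wd a b + wd c d) - f (Y + wd a b) - f (Y + wd c d) + f Y = 0 := by
  have hab := (li3_cons.1 h).1
  obtain ⟨ha, hb⟩ := li_ne hab
  have hc := li3_ne h
  set D := f (Y + wd a b + wd c d) - f (Y + wd a b) - f (Y + wd c d) + f Y with hD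
  have m1 : ∀ x, x ≠ 0 → wd a b ∈ St x → D ∈ St (s x) := by
    intro x hx hm
    have e1 : f (Y + wd a b + wd c d) - f (Y + wd c d) ∈ St (s x) := by
      rw [← (hs x hx).2]
      have : Y + wd a b + wd c d - (Y + wd c d) = wd a b := by abel
      rwa [this]
    have e2 : f (Y + wd a b) - f Y ∈ St (s x) := by
      rw [← (hs x hx).2]; simpa using hm
    have e3 : D = (f (Y + wd a b + wd c d) - f (Y + wd c d)) - (f (Y + wd a b) - f Y) := by
      rw [hD]; abel
    rw [e3]; exact Submodule.sub_mem _ e1 e2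
  have m2 : D ∈ St (s c) := by
    have e1 : f (Y + wd a b + wd c d) - f (Y + wd a b) ∈ St (s c) := by
      rw [← (hs c hc).2]; simpa using mem_St_left c d
    have e2 : f (Y + wd c d) - f Y ∈ St (s c) := by
      rw [← (hs c hc).2]; simpa using mem_St_left c d
    have e3 : D = (f (Y + wd a b + wd c d) - f (Y + wd a b)) - (f (Y + wd c d) - f Y) := by
      rw [hD]; abel
    rw [e3]; exact Submodule.sub_mem _ e1 e2
  have key : ∀ x, x ≠ 0 → D ∈ St (s x) → f.symm (f 0 + D) ∈ St x := by
    intro x hx hm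
    have := ((hs x hx).2 0 (f.symm (f 0 + D))).2 (by simpa using hm)
    simpa using this
  have z := star_inter3 h (key c hc m2) (key a ha (m1 a ha (mem_St_left a b)))
    (key b hb (m1 b hb (mem_St_right a b)))
  have := f.apply_symm_apply (f 0 + D)
  rw [z] at this
  simpa using this

theorem f_add (f0 : f 0 = 0) (X Y : Alt F) : f (X + Y) = f X + f Y := by
  revert Y
  induction X using alt_induction with
  | h0 => intro Y; simp [f0]
  | hadd A B h1 h2 => intro Y; rw [add_assoc, h1, h2, h1, add_assoc]
  | hd a b =>
    by_cases h0 : wd a b = 0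
    · rw [h0]; simp [f0]
    have hab := li_pair_of_wd h0
    intro Z
    have key : ∀ Y, f (Y + wd a b + Z) - f (Y + wd a b) - f (Y + Z) + f Y = 0 := by
      induction Z using alt_induction with
      | h0 => intro Y; simp
      | hadd A B h1 h2 =>
        intro Y
        have e1 := h1 Y
        have e2 := h2 (Y + A)
        have e3 : Y + A + wd a b + B = Y + wd a b + (A + B) := by abel
        have e4 : Y + A + wd a b = Y + wd a b + A := by abel
        rw [e3, e4, add_assoc Y A B] at e2
        have : f (Y + wd a b + (A + B)) - f (Y + wd a b) - f (Y + (A + B)) + f Y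
          = (f (Y + wd a b + (A + B)) - f (Y + wd a b + A) - f (Y + (A + B)) + f (Y + A)) +
            (f (Y + wd a b + A) - f (Y + wd a b) - f (Y + A) + f Y) := by abel
        rw [this, e1, e2, add_zero]
      | hd c d =>
        intro Y
        by_cases hc : LinearIndependent F ![c, a, b]
        · exact D_zero hs hc d Y
        obtain ⟨e, he⟩ := ext2 hab
        have hce : LinearIndependent F ![c + e, a, b] := by
          rw [li3_cons] at hc he ⊢
          refine ⟨hab, fun hm => ?_⟩
          have hc' : c ∈ Submodule.span F {a, b} := by
            by_contra hcc; exact hc ⟨hab, hcc⟩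
          exact he.2 ((Submodule.add_mem_iff_right _ hc').1 hm)
        have e1 := D_zero hs hce d Y
        have e2 := D_zero hs he (-d) (Y + wd (c + e) d)
        have q1 : wd (c + e) d = wd c d + wd e d := by simp
        have q2 : wd e (-d) = - wd e d := by simp
        rw [q1] at e1 e2
        rw [q2] at e2
        have g1 : Y + (wd c d + wd e d) + wd a b + -wd e d = Y + wd a b + wd c d := by abel
        have g2 : Y + (wd c d + wd e d) + wd a b = Y + wd a b + (wd c d + wd e d) := by abel
        have g3 : Y + (wd c d + wd e d) + -wd e d = Y + wd c d := by abel
        rw [g1, g2, g3] at e2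
        have : f (Y + wd a b + wd c d) - f (Y + wd a b) - f (Y + wd c d) + f Y =
          (f (Y + wd a b + wd c d) - f (Y + wd a b + (wd c d + wd e d)) - f (Y + wd c d)
            + f (Y + (wd c d + wd e d))) + (f (Y + wd a b + (wd c d + wd e d)) - f (Y + wd a b)
            - f (Y + (wd c d + wd e d)) + f Y) := by abel
        rw [this, e1, e2, add_zero]
    have := key 0
    simp only [zero_add, f0, add_zero] at this
    rw [sub_sub, sub_eq_zero] at this
    exact this

end AFG


namespace AFG
variable {F : Type*} [Field F]

theorem li3_pair {a b c : Fin 5 → F} (h : LinearIndependent F ![a, b, c]) :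
    LinearIndependent F ![a, b] ∧ LinearIndependent F ![a, c] ∧ LinearIndependent F ![b, c] := by
  rw [li3_iff] at h
  refine ⟨?_, ?_, (li3_cons.1 (li3_iff.2 h)).1⟩
  · rw [LinearIndependent.pair_iff]
    intro s t hst
    have := h s t 0 (by simpa using hst)
    exact ⟨this.1, this.2.1⟩
  · rw [LinearIndependent.pair_iff]
    intro s t hst
    have := h s 0 t (by simpa using hst)
    exact ⟨this.1, this.2.2⟩

def e (i : Fin 5) : Fin 5 → F := Pi.single i 1

theorem li_e3 {i j k : Fin 5} (h1 : i ≠ j) (h2 : i ≠ k) (h3 : j ≠ k) {d : F} (hd : d ≠ 0) :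
    LinearIndependent F ![(e i : Fin 5 → F), e j, d • e k] := by
  rw [li3_iff]
  intro a b c h
  have g1 := congrFun h i
  have g2 := congrFun h j
  have g3 := congrFun h k
  simp [e, Pi.single_apply, h1, h2] at g1
  simp [e, Pi.single_apply, h1.symm, h3] at g2
  simp [e, Pi.single_apply, h2.symm, h3.symm, hd] at g3
  exact ⟨g1, g2, g3⟩

theorem li_e2 {i j : Fin 5} (h1 : i ≠ j) : LinearIndependent F ![(e i : Fin 5 → F), e j] := by
  rw [LinearIndependent.pair_iff]
  intro a b h
  have g1 := congrFun h i
  have g2 := congrFun h j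
  simp [e, Pi.single_apply, h1] at g1
  simp [e, Pi.single_apply, h1.symm] at g2
  exact ⟨g1, g2⟩

variable {f : Alt F ≃ Alt F} {s : (Fin 5 → F) → (Fin 5 → F)}

theorem mem_iff (hs : Ind f s) (f0 : f 0 = 0) {a : Fin 5 → F} (ha : a ≠ 0) (X : Alt F) :
    X ∈ St a ↔ f X ∈ St (s a) := by
  have := (hs a ha).2 0 X
  simpa [f0] using this

theorem s_li (hs : Ind f s) (f0 : f 0 = 0) {a b : Fin 5 → F} (h : LinearIndependent F ![a, b]) :
    LinearIndependent F ![s a, s b] := by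
  obtain ⟨ha, hb⟩ := li_ne h
  by_contra hn
  have hS := St_eq_of_not_li (hs a ha).1 (hs b hb).1 hn
  obtain ⟨x, hx⟩ := ext2 h
  have h1 : wd x a ∈ St b := by
    rw [mem_iff hs f0 hb, hS, ← mem_iff hs f0 ha]; exact mem_St_right _ _
  exact wd_ne_of_li (li3_pair hx).1 (star_inter3 hx (mem_St_left _ _) (mem_St_right _ _) h1)

theorem f_ne (f0 : f 0 = 0) {X : Alt F} (h : X ≠ 0) : f X ≠ 0 := by
  intro h1; rw [← f0] at h1; exact h (f.injective h1)

theorem f_scal (hs : Ind f s) (f0 : f 0 = 0) {a b : Fin 5 → F} (h : LinearIndependent F ![a, b]) (x : F) :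
    ∃ c : F, f (x • wd a b) = c • wd (s a) (s b) := by
  obtain ⟨ha, hb⟩ := li_ne h
  apply star_inter2 (s_li hs f0 h)
  · rw [← mem_iff hs f0 ha]; exact Submodule.smul_mem _ _ (mem_St_left _ _)
  · rw [← mem_iff hs f0 hb]; exact Submodule.smul_mem _ _ (mem_St_right _ _)

theorem F4 (hs : Ind f s) (f0 : f 0 = 0) {a b : Fin 5 → F} (h : LinearIndependent F ![a, b]) (x : F) :
    ∃ c : F, f (x • wd a b) = c • f (wd a b) := by
  obtain ⟨c, hc⟩ := f_scal hs f0 h x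
  obtain ⟨d, hd⟩ := f_scal hs f0 h 1
  rw [one_smul] at hd
  have d0 : d ≠ 0 := by
    rintro rfl
    rw [zero_smul] at hd
    exact f_ne f0 (wd_ne_of_li h) hd
  refine ⟨c * d⁻¹, ?_⟩
  rw [hc, hd, smul_smul, mul_assoc, inv_mul_cancel₀ d0, mul_one]

def Q (f : Alt F ≃ Alt F) (α : F → F) (a b : Fin 5 → F) : Prop :=
  ∀ c, f (c • wd a b) = α c • f (wd a b)

theorem f_neg (hs : Ind f s) (f0 : f 0 = 0) (X : Alt F) : f (-X) = - f X := by
  have := f_add hs f0 X (-X)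
  rw [add_neg_cancel, f0] at this
  exact (neg_eq_of_add_eq_zero_right this.symm).symm

theorem Q_symm (hs : Ind f s) (f0 : f 0 = 0) {α : F → F} {a b : Fin 5 → F} (h : Q f α a b) : Q f α b a := by
  intro c
  rw [wd_anti b a, smul_neg, f_neg hs f0, f_neg hs f0, h c, smul_neg]

theorem Q_step (hs : Ind f s) (f0 : f 0 = 0) {α : F → F} {a b b' : Fin 5 → F}
    (hl : LinearIndependent F ![a, b, b']) (h : Q f α a b) : Q f α a b' := by
  intro c
  obtain ⟨l1, l2, l3⟩ := li3_pair hl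
  have l4 : LinearIndependent F ![a, b + b'] := by
    rw [li3_iff] at hl
    rw [LinearIndependent.pair_iff]
    intro x y hxy
    have := hl x y y (by rw [← hxy, smul_add, add_assoc])
    exact ⟨this.1, this.2.1⟩
  obtain ⟨μ, hμ⟩ := F4 hs f0 l2 c
  obtain ⟨ν, hν⟩ := F4 hs f0 l4 c
  rw [map_add, smul_add, f_add hs f0, f_add hs f0, h c, hμ] at hν
  have V0 := f_ne f0 (wd_ne_of_li l2)
  have e1 : (α c - ν) • f (wd a b) = (ν - μ) • f (wd a b') := by
    rw [sub_smul, sub_smul]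
    rw [smul_add] at hν
    rw [sub_eq_sub_iff_add_eq_add, hν]; abel
  have x0 : α c - ν = 0 := by
    by_contra hx
    have e2 : f (wd a b) = ((α c - ν)⁻¹ * (ν - μ)) • f (wd a b') := by
      rw [← smul_smul, ← e1, smul_smul, inv_mul_cancel₀ hx, one_smul]
    have e3 : wd a b ∈ St b' := by
      rw [mem_iff hs f0 (li_ne l2).2, e2]
      apply Submodule.smul_mem
      rw [← mem_iff hs f0 (li_ne l2).2]
      exact mem_St_right _ _
    exact wd_ne_of_li l1 (star_inter3 hl (mem_St_left _ _) (mem_St_right _ _) e3)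
  rw [x0, zero_smul] at e1
  have y0 := (smul_eq_zero.1 e1.symm).resolve_right V0
  rw [hμ, ← sub_eq_zero.1 y0, sub_eq_zero.1 x0]

theorem exists_alpha [Fintype F] (hs : Ind f s) (f0 : f 0 = 0) :
    ∃ α : F ≃+* F, ∀ i j, Q f α (e i) (e j) := by
  choose α hα using F4 hs f0 (li_e2 (F := F) (i := 0) (j := 1) (by decide))
  have h01 : Q f α (e 0) (e 1) := hα
  have hstep : ∀ {i j k : Fin 5} {d : F}, d ≠ 0 → i ≠ j → i ≠ k → j ≠ k → Q f α (e i) (e j) →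
      Q f α (e i) (d • e k) := fun hd h1 h2 h3 h => Q_step hs f0 (li_e3 h1 h2 h3 hd) h
  have hstep1 : ∀ {i j k : Fin 5}, i ≠ j → i ≠ k → j ≠ k → Q f α (e i) (e j) →
      Q f α (e i) (e k) := by
    intro i j k h1 h2 h3 h
    have := hstep one_ne_zero h1 h2 h3 h
    rwa [one_smul] at this
  have U0 := f_ne f0 (wd_ne_of_li (li_e2 (F := F) (i := 0) (j := 1) (by decide)))
  have a1 : α 1 = 1 := by
    have := h01 1
    rw [one_smul] at this
    have h : (α 1 - 1) • f (wd (e 0) (e 1)) = 0 := by rw [sub_smul, ← this, one_smul, sub_self]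
    exact sub_eq_zero.1 ((smul_eq_zero.1 h).resolve_right U0)
  have aadd : ∀ x y, α (x + y) = α x + α y := by
    intro x y
    have := h01 (x + y)
    rw [add_smul, f_add hs f0, h01, h01, ← add_smul] at this
    exact (smul_left_injective _ U0 this).symm
  have a0 : α 0 = 0 := by have := aadd 0 0; simpa using this
  have h12 : Q f α (e 1) (e 2) := hstep1 (by decide) (by decide) (by decide) (Q_symm hs f0 h01)
  have amul : ∀ x y, α (x * y) = α x * α y := by
    intro x y
    by_cases hy : y = 0
    · simp [hy, a0]
    have h := hstep (k := 0) hy (by decide) (by decide) (by decide) h12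
    have h2 := h x
    have h3 := Q_symm hs f0 h01
    rw [(wd (e 1)).map_smul, smul_smul, h3, h3, smul_smul] at h2
    have U0 := f_ne f0 (wd_ne_of_li (li_e2 (F := F) (i := 1) (j := 0) (by decide)))
    exact smul_left_injective _ U0 h2
  let φ : F →+* F := { toFun := α, map_one' := a1, map_mul' := amul, map_zero' := a0, map_add' := aadd }
  have hb : Function.Bijective φ := Finite.injective_iff_bijective.1 φ.injective
  refine ⟨RingEquiv.ofBijective φ hb, ?_⟩
  have hQ : ∀ i j, i ≠ j → Q f α (e i) (e j) := by
    have h0 : ∀ k, k ≠ 0 → Q f α (e 0) (e k) := by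
      intro k hk
      by_cases h1 : k = 1
      · rw [h1]; exact h01
      · exact hstep1 (by decide) (Ne.symm hk) (Ne.symm h1) h01
    intro i j hij
    by_cases hi : i = 0
    · rw [hi] at hij ⊢; exact h0 j (Ne.symm hij)
    by_cases hj : j = 0
    · rw [hj]; exact Q_symm hs f0 (h0 i hi)
    exact hstep1 hi hij (Ne.symm hj) (Q_symm hs f0 (h0 i hi))
  intro i j
  by_cases hij : i = j
  · intro c; rw [hij, wd_self, smul_zero, f0, smul_zero]
  · exact hQ i j hij

end AFG


namespace AFG
variable {F : Type*} [Field F]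

theorem vec_e (v : Fin 5 → F) : v = ∑ j, v j • e j := by
  ext k; simp [e, Finset.sum_apply, Pi.single_apply]

theorem alt_ind_e {P : Alt F → Prop} (h0 : P 0) (hadd : ∀ X Y, P X → P Y → P (X + Y))
    (hd : ∀ (x : F) i j, P (x • wd (e i) (e j))) (X : Alt F) : P X := by
  rw [alt_sum X]
  refine Finset.sum_induction _ P hadd h0 fun i _ => ?_
  rw [vec_e (fun j => if i < j then X.m i j else 0), map_sum]
  refine Finset.sum_induction _ P hadd h0 fun j _ => ?_
  rw [(wd (Pi.single i 1)).map_smul]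
  exact hd _ _ _

theorem B_sum (G : Fin 5 → Alt F) (x y : Fin 5 → F) : B (∑ k, G k) x y = ∑ k, B (G k) x y :=
  map_sum (AddMonoidHom.mk' (fun X => B X x y) (fun X Y => B_add X Y x y)) G _

theorem conj_wd (P : Matrix (Fin 5) (Fin 5) F) (u v : Fin 5 → F) :
    P * (wd u v).m * Pᵀ = (wd (P *ᵥ u) (P *ᵥ v)).m := by
  have h : ∀ a b : Fin 5 → F, (wd a b).m = vecMulVec a b - vecMulVec b a := by
    intro a b; ext i j; simp [wd_apply, vecMulVec_apply]
  rw [h, h, mul_sub, sub_mul, mul_vecMulVec, mul_vecMulVec, vecMulVec_mul, vecMulVec_mul,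
    vecMul_transpose, vecMul_transpose]

theorem map_wd (α : F ≃+* F) (u v : Fin 5 → F) :
    (wd u v).m.map α = (wd (fun i => α (u i)) (fun i => α (v i))).m := by
  ext i j; simp [wd_apply]

theorem dec_fwd (P : Matrix (Fin 5) (Fin 5) F) (l : F) (α : F ≃+* F) {X Z : Alt F}
    (h : Z.m = l • (P * X.m.map α * Pᵀ)) (hX : Dec X) : Dec Z := by
  obtain ⟨u, v, rfl⟩ := hX
  refine ⟨l • (P *ᵥ fun i => α (u i)), P *ᵥ fun i => α (v i), ?_⟩
  apply Subtype.ext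
  change Z.m = Alt.m _
  rw [h, map_wd, conj_wd, map_smul]; rfl

theorem dec_bwd (P : (Matrix (Fin 5) (Fin 5) F)ˣ) (l : Fˣ) (α : F ≃+* F) {X Z : Alt F}
    (h : Z.m = (l : F) • ((P : Matrix (Fin 5) (Fin 5) F) * X.m.map α * (P : Matrix (Fin 5) (Fin 5) F)ᵀ))
    (hZ : Dec Z) : Dec X := by
  let R : Matrix (Fin 5) (Fin 5) F := (P⁻¹).1
  have h1 : R * P.1 = 1 := P.inv_mul
  have h2 : P.1ᵀ * Rᵀ = 1 := by rw [← transpose_mul, h1, transpose_one]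
  have h3 : X.m.map α = (l : F)⁻¹ • (R * Z.m * Rᵀ) := by
    rw [h, Matrix.mul_smul, Matrix.smul_mul, smul_smul, inv_mul_cancel₀ l.ne_zero, one_smul]
    have h5 : (R * P.1) * X.m.map α * (P.1ᵀ * Rᵀ) = X.m.map α := by rw [h1, h2]; simp
    rw [← h5]
    simp only [Matrix.mul_assoc]
    simp only [← Matrix.mul_assoc R P.1, h1, Matrix.one_mul]
    simp [h2]
  refine dec_fwd (R.map α.symm) (α.symm (l : F)⁻¹) α.symm (X := Z) ?_ hZ
  have h4 : X.m = (X.m.map α).map α.symm := by ext i j; simp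
  rw [h4, h3]
  ext i j
  simp [Matrix.mul_apply, map_sum]

variable {f : Alt F ≃ Alt F} {s : (Fin 5 → F) → (Fin 5 → F)}

theorem p_li (f0 : f 0 = 0) (hadd : ∀ X Y, f (X + Y) = f X + f Y) (p : Fin 5 → Fin 5 → F)
    (h : ∀ (x : F) i j, ∃ c : F, f (x • wd (e i) (e j)) = c • wd (p i) (p j)) : LinearIndependent F p := by
  have : IsUnit (Matrix.of p) := by
    rw [Matrix.isUnit_iff_isUnit_det, isUnit_iff_ne_zero]
    intro hdet
    obtain ⟨w, w0, hw⟩ := Matrix.exists_mulVec_eq_zero_iff.2 hdet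
    have hp : ∀ i, w ⬝ᵥ p i = 0 := by
      intro i
      have := congrFun hw i
      rw [dotProduct_comm]; exact this
    have hk : ∀ X, (f X).m *ᵥ w = 0 := by
      intro X
      induction X using alt_ind_e with
      | h0 => simp [f0]
      | hadd X Y h1 h2 => rw [hadd, m_add, add_mulVec, h1, h2, add_zero]
      | hd x i j =>
        obtain ⟨c, hc⟩ := h x i j
        rw [hc, m_smul, smul_mulVec, wd_mulVec, hp, hp]; simp
    obtain ⟨k, hk0⟩ := Function.ne_iff.1 w0
    obtain ⟨j, hj⟩ := exists_ne k
    have := hk (f.symm (wd (e k) (e j)))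
    rw [Equiv.apply_symm_apply, wd_mulVec] at this
    have := congrFun this j
    simp [e, hj] at this
    exact hk0 this
  rw [← Matrix.linearIndependent_rows_iff_isUnit] at this
  exact this

theorem main_form [Fintype F] (hs : Ind f s) (f0 : f 0 = 0) :
    ∃ (P : (Matrix (Fin 5) (Fin 5) F)ˣ) (lam : Fˣ) (α : F ≃+* F), ∀ X, (f X).m =
      (lam : F) • ((P : Matrix (Fin 5) (Fin 5) F) * X.m.map α * (P : Matrix (Fin 5) (Fin 5) F)ᵀ) := by
  obtain ⟨α, hQ⟩ := exists_alpha hs f0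
  set p : Fin 5 → Fin 5 → F := fun i => s (e i) with hpdef
  have hsc : ∀ (x : F) i j, ∃ c : F, f (x • wd (e i) (e j)) = c • wd (p i) (p j) := by
    intro x i j
    by_cases hij : i = j
    · refine ⟨0, ?_⟩
      rw [hij, wd_self, smul_zero, f0, zero_smul]
    · exact f_scal hs f0 (li_e2 hij) x
  have hp := p_li f0 (f_add hs f0) p hsc
  obtain ⟨w, hw, hwe, -⟩ := exists_dual hp
  choose c hc using hsc 1
  simp only [one_smul] at hc
  have hwd : ∀ i j, i ≠ j → wd (p i) (p j) ≠ 0 := fun i j hij => wd_ne_of_li (s_li hs f0 (li_e2 hij))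
  have c0 : ∀ i j, i ≠ j → c i j ≠ 0 := by
    intro i j hij h
    have h1 := hc i j
    rw [h, zero_smul] at h1
    exact f_ne f0 (wd_ne_of_li (li_e2 hij)) h1
  have csymm : ∀ i j, i ≠ j → c i j = c j i := by
    intro i j hij
    have h1 := hc j i
    rw [wd_anti (e j), f_neg hs f0, hc i j, wd_anti (p j), smul_neg, neg_inj] at h1
    exact smul_left_injective _ (hwd i j hij) h1
  let u : Fin 5 → F := ∑ j, e j
  have hu : ∀ i, LinearIndependent F ![e i, u] := by
    intro i
    have : ∀ k, u k = 1 := by intro k; simp [u, e, Finset.sum_apply, Pi.single_apply]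
    obtain ⟨j, hj⟩ := exists_ne i
    rw [LinearIndependent.pair_iff]
    intro a b h
    have g1 := congrFun h j
    have g2 := congrFun h i
    simp [e, this, hj] at g1 g2
    rw [g1] at g2
    exact ⟨by simpa using g2, g1⟩
  let d : Fin 5 → F := fun j => w j ⬝ᵥ s u
  have ht : ∀ i, ∃ t : F, ∀ j, i ≠ j → c i j = t * d j := by
    intro i
    obtain ⟨t, ht⟩ := f_scal hs f0 (hu i) 1
    refine ⟨t, fun j hij => ?_⟩
    rw [one_smul] at ht
    have h1 : f (wd (e i) u) = ∑ k, c i k • wd (p i) (p k) := by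
      have : wd (e i) u = ∑ k, wd (e i) (e k) := by simp only [u, map_sum]
      rw [this]
      have h2 := map_sum (AddMonoidHom.mk' (fun X => f X) (f_add hs f0)) (fun k => wd (e i) (e k)) Finset.univ
      refine h2.trans ?_
      exact Finset.sum_congr rfl fun k _ => hc i k
    rw [h1] at ht
    have h3 := congrArg (fun X => B X (w i) (w j)) ht
    simp only [B_sum, B_smul, B_wd] at h3
    change _ = t * (w i ⬝ᵥ p i * d j - w i ⬝ᵥ s u * w j ⬝ᵥ p i) at h3
    simp only [hw, if_neg hij.symm] at h3
    simpa using h3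
  choose t ht using ht
  have t0 : ∀ i, t i ≠ 0 := by
    intro i h
    obtain ⟨j, hj⟩ := exists_ne i
    exact c0 i j hj.symm (by rw [ht i j hj.symm, h, zero_mul])
  have d0 : ∀ i, d i ≠ 0 := by
    intro i h
    obtain ⟨j, hj⟩ := exists_ne i
    exact c0 j i hj (by rw [ht j i hj, h, mul_zero])
  set l : F := t 0 / d 0 with hl
  have htl : ∀ i, t i = l * d i := by
    intro i
    by_cases hi : i = 0
    · rw [hi, hl, div_mul_cancel₀ _ (d0 0)]
    · have := csymm i 0 hi
      rw [ht i 0 hi, ht 0 i (Ne.symm hi)] at this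
      rw [hl, div_mul_eq_mul_div, eq_div_iff (d0 0), this]
  have l0 : l ≠ 0 := div_ne_zero (t0 0) (d0 0)
  have hfin : ∀ i j, f (wd (e i) (e j)) = l • wd (d i • p i) (d j • p j) := by
    intro i j
    by_cases hij : i = j
    · rw [hij, wd_self, wd_self, f0, smul_zero]
    · rw [hc, ht i j hij, htl i]
      simp only [map_smul, LinearMap.smul_apply, smul_smul]
      congr 1; ring
  have hrow : IsUnit (Matrix.of fun i => d i • p i) := by
    rw [← Matrix.linearIndependent_rows_iff_isUnit]
    exact hp.units_smul (fun i => Units.mk0 (d i) (d0 i))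
  have hcol : IsUnit (Matrix.of fun i => d i • p i)ᵀ := by
    rw [Matrix.isUnit_iff_isUnit_det, det_transpose, ← Matrix.isUnit_iff_isUnit_det]; exact hrow
  obtain ⟨P, hP⟩ := hcol
  have hPe : ∀ i, P.1 *ᵥ e i = d i • p i := by
    intro i; rw [hP, e, mulVec_single_one]; rfl
  refine ⟨P, Units.mk0 l l0, α, fun X => ?_⟩
  induction X using alt_ind_e with
  | h0 => 
    have : (0 : Matrix (Fin 5) (Fin 5) F).map α = 0 := by ext; simp
    rw [f0, m_zero, this]; simp
  | hadd X Y h1 h2 =>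
    have : (X + Y).m.map α = X.m.map α + Y.m.map α := by ext; simp
    rw [f_add hs f0, m_add, h1, h2, this, mul_add, add_mul, smul_add]
  | hd x i j =>
    have : (x • wd (e i) (e j)).m.map α = α x • (wd (e i) (e j)).m := by
      have he : ∀ i : Fin 5, (fun k => α ((e i : Fin 5 → F) k)) = e i := by
        intro i; ext k; simp only [e, Pi.single_apply]; split_ifs <;> simp
      have h := map_wd α (e i) (e j)
      rw [he, he] at h
      rw [← h]; ext; simp
    rw [hQ i j x, hfin, this, Matrix.mul_smul, Matrix.smul_mul, conj_wd, hPe, hPe, m_smul, m_smul, smul_comm]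
    rfl

end AFG


/-- The automorphism group of the alternating forms graph
`A(5, q)` (vertices the alternating `5 × 5` matrices over `F = GF(q)`,
adjacency `rank(X - Y) = 2`) consists exactly of the maps
`X ↦ λ • (P · α(X) · Pᵀ) + C` with `P ∈ GL₅(q)`, `λ ∈ Fˣ`, `α` a field
automorphism (entrywise) and `C` alternating. -/
theorem aut_alternating_forms_graph {F : Type*} [Field F] [Fintype F]
    (f : Equiv.Perm {X : Matrix (Fin 5) (Fin 5) F // Xᵀ = -X ∧ ∀ i, X i i = 0}) :
    (∀ X Y : {X : Matrix (Fin 5) (Fin 5) F // Xᵀ = -X ∧ ∀ i, X i i = 0},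
        (f X ≠ f Y ∧ ((f X : Matrix (Fin 5) (Fin 5) F) - (f Y : Matrix (Fin 5) (Fin 5) F)).rank = 2) ↔
        (X ≠ Y ∧ ((X : Matrix (Fin 5) (Fin 5) F) - (Y : Matrix (Fin 5) (Fin 5) F)).rank = 2)) ↔
      ∃ (P : (Matrix (Fin 5) (Fin 5) F)ˣ) (lam : Fˣ) (α : F ≃+* F)
        (C : Matrix (Fin 5) (Fin 5) F),
        (Cᵀ = -C ∧ ∀ i, C i i = 0) ∧
        ∀ X : {X : Matrix (Fin 5) (Fin 5) F // Xᵀ = -X ∧ ∀ i, X i i = 0},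
          (f X : Matrix (Fin 5) (Fin 5) F) =
            (lam : F) • ((P : Matrix (Fin 5) (Fin 5) F) *
              (X : Matrix (Fin 5) (Fin 5) F).map ⇑α * (P : Matrix (Fin 5) (Fin 5) F)ᵀ) + C := by
  have adj : ∀ X Y : AFG.Alt F, (X ≠ Y ∧ (X.m - Y.m).rank = 2) ↔ (X ≠ Y ∧ AFG.Dec (X - Y)) := by
    intro X Y
    refine and_congr_right fun h => ?_
    exact AFG.rank_iff (X := X - Y) (sub_ne_zero.2 h)
  let g : AFG.Alt F ≃ AFG.Alt F := f
  constructor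
  · intro h
    have h' : ∀ X Y, AFG.Dec (g X - g Y) ↔ AFG.Dec (X - Y) := by
      intro X Y
      by_cases hXY : X = Y
      · rw [hXY, sub_self, sub_self]
      · have h1 : (g X ≠ g Y ∧ ((g X).m - (g Y).m).rank = 2) ↔ (X ≠ Y ∧ (X.m - Y.m).rank = 2) := h X Y
        rw [adj, adj] at h1
        have hg : g X ≠ g Y := fun hh => hXY (g.injective hh)
        simpa [hg, hXY] using h1
    let k : AFG.Alt F ≃ AFG.Alt F := g.trans (Equiv.subRight (g 0))
    have hk : ∀ X, k X = g X - g 0 := fun X => rfl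
    have hf : ∀ X Y, AFG.Dec (k X - k Y) ↔ AFG.Dec (X - Y) := by
      intro X Y
      rw [hk, hk, sub_sub_sub_cancel_right]; exact h' X Y
    choose s hs using AFG.sigma_ex hf
    obtain ⟨P, lam, α, hX⟩ := AFG.main_form (f := k) (s := s) hs (by rw [hk, sub_self])
    refine ⟨P, lam, α, (g 0).m, (g 0).2, fun X => ?_⟩
    have : (g X - g 0).m = _ := hX X
    rw [AFG.m_sub, sub_eq_iff_eq_add] at this
    exact this
  · rintro ⟨P, lam, α, C, -, hX⟩ X Y
    change (g X ≠ g Y ∧ ((g X).m - (g Y).m).rank = 2) ↔ _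
    refine (adj (g X) (g Y)).trans (Iff.trans ?_ (adj X Y).symm)
    refine and_congr g.injective.ne_iff ?_
    have hZ : (g X - g Y).m = (lam : F) • ((P : Matrix (Fin 5) (Fin 5) F) *
        (AFG.Alt.m X - AFG.Alt.m Y).map α * (P : Matrix (Fin 5) (Fin 5) F)ᵀ) := by
      have h1 : (g X).m = _ := hX X
      have h2 : (g Y).m = _ := hX Y
      have h3 : (AFG.Alt.m X - AFG.Alt.m Y).map α = (AFG.Alt.m X).map α - (AFG.Alt.m Y).map α := by
        ext; simp
      rw [AFG.m_sub, h1, h2, h3, mul_sub, sub_mul, smul_sub, add_sub_add_right_eq_sub]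
      rfl
    exact ⟨AFG.dec_bwd P lam α (Z := g X - g Y) hZ, AFG.dec_fwd P.1 lam α (Z := g X - g Y) hZ⟩
end
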